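/- arXiv:2308.00948 — 2 statements merged into one kernel-verified Lean document; each statement's English description precedes it below -/
import Mathlib

section
/- Let n ≥ 3 and τ ∈ (0, 2(n-1)/n). Let φ : ℝⁿ → ℝ be a smooth positive function such that the conformal metric g = φ⁻²g₀ is complete, i.e., every C¹ curve γ : [0,∞) → ℝⁿ with ‖γ(t)‖ → ∞ satisfies ∫₀^∞ φ(γ(t))⁻¹ ‖γ'(t)‖ dt = ∞. Suppose the scalar curvature of g is nonnegative, i.e., 2·φ(x)·Δφ(x) ≥ n·‖∇φ(x)‖² for all x, and suppose there exists p ∈ ℝⁿ such that for every r > 0 the integral over the Euclidean sphere S_r(p) (with respect to Euclidean surface measure dσ) of the radial component of the modified Schouten tensor is nonnegative: ∫_{S_r(p)} φ(x)⁻² [ (n−2)·φ(x)·D²φ(x)(∂_r,∂_r) + (1−τ)·φ(x)·Δφ(x) − (n−1−τn/2)·‖∇φ(x)‖² ] dσ(x) ≥ 0, where ∂_r = (x−p)/‖x−p‖. Then φ is constant (hence g is isometric to g₀ up to scaling). -/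
open MeasureTheory Filter Set

/-- The Euclidean Hessian of `φ` at `x` evaluated at `(v, v)`. -/
noncomputable def hess2 {n : ℕ} (φ : EuclideanSpace ℝ (Fin n) → ℝ)
    (x v : EuclideanSpace ℝ (Fin n)) : ℝ :=
  fderiv ℝ (fun y => fderiv ℝ φ y v) x v

/-- The Euclidean Laplacian of `φ` at `x`. -/
noncomputable def lapl {n : ℕ} (φ : EuclideanSpace ℝ (Fin n) → ℝ)
    (x : EuclideanSpace ℝ (Fin n)) : ℝ :=
  ∑ i : Fin n, hess2 φ x (EuclideanSpace.single i 1)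

/-- The integral of `F` over the Euclidean sphere `S_r(p)` with respect to the
`(n-1)`-dimensional Euclidean surface measure, expressed via the surface measure
`volume.toSphere` on the unit sphere by scaling: `∫_{S_r(p)} F dσ = r^{n-1} ∫_{S^{n-1}} F(p + rθ)`. -/
noncomputable def sphereIntegral {n : ℕ} (p : EuclideanSpace ℝ (Fin n)) (r : ℝ)
    (F : EuclideanSpace ℝ (Fin n) → ℝ) : ℝ :=
  r ^ (n - 1) *
    ∫ θ : Metric.sphere (0 : EuclideanSpace ℝ (Fin n)) 1,
      F (p + r • (θ : EuclideanSpace ℝ (Fin n))) ∂(volume.toSphere)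

/-- The unit sphere of `ℝⁿ`. -/
abbrev USphere (n : ℕ) : Type := Metric.sphere (0 : EuclideanSpace ℝ (Fin n)) 1

/-- The normalized surface measure of the unit sphere. -/
noncomputable def sphereProb (n : ℕ) : Measure (USphere n) :=
  ((volume : Measure (EuclideanSpace ℝ (Fin n))).toSphere univ)⁻¹ • volume.toSphere

instance sphereProb_isProbabilityMeasure (n : ℕ) [NeZero n] :
    IsProbabilityMeasure (sphereProb n) := by
  constructor
  have h0 : (volume : Measure (EuclideanSpace ℝ (Fin n))).toSphere univ ≠ 0 := by
    have : Nontrivial (EuclideanSpace ℝ (Fin n)) := by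
      have : Nonempty (Fin n) := ⟨0⟩
      infer_instance
    rw [Ne, Measure.measure_univ_eq_zero]
    exact Measure.toSphere_ne_zero _
  rw [sphereProb, Measure.smul_apply, smul_eq_mul,
    ENNReal.inv_mul_cancel h0 (measure_ne_top _ _)]

/-- The average of a function over the unit sphere. -/
noncomputable def avg {n : ℕ} (F : USphere n → ℝ) : ℝ := ∫ x, F x ∂sphereProb n

section avg

variable {n : ℕ} [NeZero n]

theorem integrable_sphereProb {F : USphere n → ℝ} (hF : Continuous F) :
    Integrable F (sphereProb n) :=
  hF.integrable_of_hasCompactSupport (HasCompactSupport.of_compactSpace F)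

theorem avg_const (c : ℝ) : avg (fun _ : USphere n => c) = c := by
  simp [avg]

theorem avg_add {F G : USphere n → ℝ} (hF : Continuous F) (hG : Continuous G) :
    avg (fun x => F x + G x) = avg F + avg G :=
  integral_add (integrable_sphereProb hF) (integrable_sphereProb hG)

theorem avg_sub {F G : USphere n → ℝ} (hF : Continuous F) (hG : Continuous G) :
    avg (fun x => F x - G x) = avg F - avg G :=
  integral_sub (integrable_sphereProb hF) (integrable_sphereProb hG)

omit [NeZero n] in
theorem avg_neg (F : USphere n → ℝ) : avg (fun x => -F x) = -avg F :=
  integral_neg F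

omit [NeZero n] in
theorem avg_const_mul (c : ℝ) (F : USphere n → ℝ) : avg (fun x => c * F x) = c * avg F :=
  integral_const_mul c F

omit [NeZero n] in
theorem avg_mul_const (c : ℝ) (F : USphere n → ℝ) : avg (fun x => F x * c) = avg F * c :=
  integral_mul_const c F

theorem avg_sum {ι : Type*} (s : Finset ι) {F : ι → USphere n → ℝ}
    (hF : ∀ i, Continuous (F i)) :
    avg (fun x => ∑ i ∈ s, F i x) = ∑ i ∈ s, avg (F i) :=
  integral_finsetSum s fun i _ => integrable_sphereProb (hF i)

theorem avg_mono {F G : USphere n → ℝ} (hF : Continuous F) (hG : Continuous G)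
    (h : ∀ x, F x ≤ G x) : avg F ≤ avg G :=
  integral_mono (integrable_sphereProb hF) (integrable_sphereProb hG) h

omit [NeZero n] in
theorem avg_nonneg {F : USphere n → ℝ} (h : ∀ x, 0 ≤ F x) : 0 ≤ avg F :=
  integral_nonneg h

omit [NeZero n] in
theorem abs_avg_le (F : USphere n → ℝ) : |avg F| ≤ avg (fun x => |F x|) :=
  abs_integral_le_integral_abs

/-- The Cauchy–Schwarz inequality for spherical averages. -/
theorem sq_avg_mul_le {F G : USphere n → ℝ} (hF : Continuous F) (hG : Continuous G) :
    avg (fun x => F x * G x) ^ 2 ≤ avg (fun x => F x ^ 2) * avg (fun x => G x ^ 2) := by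
  set a := avg (fun x => F x ^ 2)
  set b := avg (fun x => F x * G x)
  set c := avg (fun x => G x ^ 2)
  have key : ∀ r : ℝ, 0 ≤ a * (r * r) + (-2 * b) * r + c := by
    intro r
    have h0 : 0 ≤ avg (fun x => (r * F x - G x) ^ 2) := avg_nonneg fun x => sq_nonneg _
    have h1 : (fun x => (r * F x - G x) ^ 2) =
        fun x => (r * r) * F x ^ 2 + ((-2 * r) * (F x * G x) + G x ^ 2) := by
      ext x; ring
    rw [h1, avg_add (by fun_prop) (by fun_prop), avg_add (by fun_prop) (by fun_prop),
      avg_const_mul, avg_const_mul] at h0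
    change 0 ≤ r * r * a + (-2 * r * b + c) at h0
    linarith
  have := discrim_le_zero key
  rw [discrim] at this
  nlinarith

theorem sq_avg_le {F : USphere n → ℝ} (hF : Continuous F) :
    avg F ^ 2 ≤ avg (fun x => F x ^ 2) := by
  have := sq_avg_mul_le hF (continuous_const (y := (1 : ℝ)))
  simpa [avg_const] using this

/-- Differentiation under the spherical average. -/
theorem hasDerivAt_avg {F F' : ℝ → USphere n → ℝ} {I : Set ℝ} (hI : IsOpen I)
    (hF : ∀ t ∈ I, Continuous (F t))
    (hF' : ContinuousOn (fun z : ℝ × USphere n => F' z.1 z.2) (I ×ˢ univ))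
    (h : ∀ t ∈ I, ∀ x, HasDerivAt (fun s => F s x) (F' t x) t) {t : ℝ} (ht : t ∈ I) :
    HasDerivAt (fun s => avg (F s)) (avg (F' t)) t := by
  obtain ⟨ε, hε, hball⟩ := Metric.nhds_basis_closedBall.mem_iff.1 (hI.mem_nhds ht)
  have hcomp : IsCompact (Metric.closedBall t ε ×ˢ (univ : Set (USphere n))) :=
    (isCompact_closedBall t ε).prod isCompact_univ
  obtain ⟨C, hC⟩ := hcomp.exists_bound_of_continuousOn
    (hF'.mono (prod_mono hball (subset_refl _)))
  have hF't : Continuous (F' t) := by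
    have : ContinuousOn (fun x : USphere n => F' t x) univ :=
      hF'.comp (f := fun x : USphere n => (t, x)) (by fun_prop) (fun x _ => ⟨ht, mem_univ _⟩)
    rwa [← continuousOn_univ]
  exact (hasDerivAt_integral_of_dominated_loc_of_deriv_le (bound := fun _ => C)
    (s := Metric.closedBall t ε) (Metric.closedBall_mem_nhds t hε)
    ((hI.mem_nhds ht) |> fun hm => by
      filter_upwards [hm] with s hs using (hF s hs).aestronglyMeasurable)
    (integrable_sphereProb (hF t ht)) hF't.aestronglyMeasurable
    (ae_of_all _ fun x s hs => hC (s, x) ⟨hs, mem_univ _⟩) (integrable_const C)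
    (ae_of_all _ fun x s hs => h s (hball hs) x)).2

/-- Continuity of spherical averages in a parameter. -/
theorem continuous_avg {X : Type*} [TopologicalSpace X] [FirstCountableTopology X]
    [LocallyCompactSpace X] {F : X → USphere n → ℝ}
    (hF : Continuous (fun z : X × USphere n => F z.1 z.2)) :
    Continuous (fun t => avg (F t)) := by
  have := continuous_parametric_integral_of_continuous (μ := sphereProb n) hF isCompact_univ
  simpa [avg] using this

/-- Fubini's theorem for continuous functions on the product of two spheres. -/
theorem avg_comm {F : USphere n → USphere n → ℝ}
    (hF : Continuous (fun z : USphere n × USphere n => F z.1 z.2)) :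
    avg (fun x => avg (fun y => F x y)) = avg (fun y => avg (fun x => F x y)) :=
  integral_integral_swap
    (hF.integrable_of_hasCompactSupport (HasCompactSupport.of_compactSpace _))

end avg

section isometries

variable {n : ℕ}

/-- The action of a linear isometry on the unit sphere. -/
noncomputable def sphereMap (L : EuclideanSpace ℝ (Fin n) ≃ₗᵢ[ℝ] EuclideanSpace ℝ (Fin n))
    (x : USphere n) : USphere n := ⟨L x, by simp⟩

open scoped Pointwise in
theorem measurePreserving_sphereMap
    (L : EuclideanSpace ℝ (Fin n) ≃ₗᵢ[ℝ] EuclideanSpace ℝ (Fin n)) :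
    MeasurePreserving (sphereMap L) (sphereProb n) (sphereProb n) := by
  have hc : Continuous (sphereMap L) :=
    Continuous.subtype_mk (L.continuous.comp continuous_subtype_val) _
  refine ⟨hc.measurable, ?_⟩
  ext s hs
  rw [Measure.map_apply hc.measurable hs, sphereProb, Measure.smul_apply, Measure.smul_apply,
    Measure.toSphere_apply' _ hs, Measure.toSphere_apply' _ (hc.measurable hs)]
  congr 2
  have : Ioo (0 : ℝ) 1 • (Subtype.val '' (sphereMap L ⁻¹' s)) =
      L ⁻¹' (Ioo (0 : ℝ) 1 • (Subtype.val '' s)) := by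
    ext z
    simp only [Set.mem_smul, mem_image, mem_preimage]
    constructor
    · rintro ⟨r, hr, y, ⟨x, hx, rfl⟩, rfl⟩
      exact ⟨r, hr, L x, ⟨sphereMap L x, hx, rfl⟩, by simp⟩
    · rintro ⟨r, hr, y, ⟨x, hx, rfl⟩, hz⟩
      refine ⟨r, hr, L.symm x, ⟨⟨L.symm x, by simp⟩, ?_, rfl⟩, ?_⟩
      · simpa [sphereMap] using hx
      · rw [← L.symm.map_smul, hz, L.symm_apply_apply]
  rw [this]
  exact L.measurePreserving.measure_preimage_emb L.toHomeomorph.measurableEmbedding _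

theorem avg_comp_sphereMap (L : EuclideanSpace ℝ (Fin n) ≃ₗᵢ[ℝ] EuclideanSpace ℝ (Fin n))
    (F : USphere n → ℝ) : avg (fun x => F (sphereMap L x)) = avg F := by
  have hc : Continuous (sphereMap L) :=
    Continuous.subtype_mk (L.continuous.comp continuous_subtype_val) _
  have he : MeasurableEmbedding (sphereMap L) := by
    refine (Continuous.isClosedEmbedding hc fun x y hxy => ?_).measurableEmbedding
    have := congrArg Subtype.val hxy
    exact Subtype.ext (L.injective this)
  exact (measurePreserving_sphereMap L).integral_comp he F

@[fun_prop]
theorem continuous_sphereMap (L : EuclideanSpace ℝ (Fin n) ≃ₗᵢ[ℝ] EuclideanSpace ℝ (Fin n)) :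
    Continuous (sphereMap L) :=
  Continuous.subtype_mk (L.continuous.comp continuous_subtype_val) _

end isometries

section rotations

variable {n : ℕ}

theorem norm_sq_add_single_add_single {i j : Fin n} (h : i ≠ j) (x : EuclideanSpace ℝ (Fin n))
    (a b : ℝ) :
    ‖x + (a • EuclideanSpace.single i (1 : ℝ) + b • EuclideanSpace.single j (1 : ℝ))‖ ^ 2 =
      ‖x‖ ^ 2 + 2 * a * x i + 2 * b * x j + a ^ 2 + b ^ 2 := by
  have h1 : ‖a • EuclideanSpace.single i (1 : ℝ) + b • EuclideanSpace.single j (1 : ℝ)‖ ^ 2 =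
      a ^ 2 + b ^ 2 := by
    rw [norm_add_sq_real, norm_smul, norm_smul]
    simp [inner_smul_left, inner_smul_right, EuclideanSpace.inner_single_left, h]
  rw [norm_add_sq_real, h1, inner_add_right, inner_smul_right, inner_smul_right,
    EuclideanSpace.inner_single_right, EuclideanSpace.inner_single_right]
  simp
  ring

/-- The rotation by the angle `s` in the plane of two distinct coordinates, as a linear map. -/
noncomputable def rotLin (q : Fin n × Fin n) (s : ℝ) :
    EuclideanSpace ℝ (Fin n) →ₗ[ℝ] EuclideanSpace ℝ (Fin n) where
  toFun x := x + (((Real.cos s - 1) * x q.1 - Real.sin s * x q.2) •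
      EuclideanSpace.single q.1 (1 : ℝ) +
    ((Real.cos s - 1) * x q.2 + Real.sin s * x q.1) • EuclideanSpace.single q.2 (1 : ℝ))
  map_add' x y := by
    simp only [PiLp.add_apply]
    module
  map_smul' c x := by
    simp only [PiLp.smul_apply, smul_eq_mul, RingHom.id_apply]
    module

/-- The rotation by the angle `s` in a coordinate plane; the identity if the two coordinates
coincide. -/
noncomputable def rot (q : Fin n × Fin n) (s : ℝ) :
    EuclideanSpace ℝ (Fin n) ≃ₗᵢ[ℝ] EuclideanSpace ℝ (Fin n) :=
  if h : q.1 = q.2 then LinearIsometryEquiv.refl ℝ _ else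
    LinearIsometry.toLinearIsometryEquiv
      { toLinearMap := rotLin q s
        norm_map' := fun x => by
          have : ‖rotLin q s x‖ ^ 2 = ‖x‖ ^ 2 := by
            change ‖x + _‖ ^ 2 = _
            rw [norm_sq_add_single_add_single h]
            linear_combination (x q.1 ^ 2 + x q.2 ^ 2) * Real.sin_sq_add_cos_sq s
          exact (sq_eq_sq₀ (norm_nonneg _) (norm_nonneg _)).1 this } rfl

/-- The rotational vector field in a coordinate plane. -/
noncomputable def rotField (q : Fin n × Fin n) (x : EuclideanSpace ℝ (Fin n)) :
    EuclideanSpace ℝ (Fin n) :=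
  x q.1 • EuclideanSpace.single q.2 (1 : ℝ) - x q.2 • EuclideanSpace.single q.1 (1 : ℝ)

theorem rot_apply_of_eq {q : Fin n × Fin n} (h : q.1 = q.2) (s : ℝ)
    (x : EuclideanSpace ℝ (Fin n)) : rot q s x = x := by
  rw [rot, dif_pos h]; rfl

theorem rot_apply_of_ne {q : Fin n × Fin n} (h : q.1 ≠ q.2) (s : ℝ)
    (x : EuclideanSpace ℝ (Fin n)) :
    rot q s x = x + (((Real.cos s - 1) * x q.1 - Real.sin s * x q.2) •
      EuclideanSpace.single q.1 (1 : ℝ) +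
    ((Real.cos s - 1) * x q.2 + Real.sin s * x q.1) • EuclideanSpace.single q.2 (1 : ℝ)) := by
  rw [rot, dif_neg h]; rfl

theorem hasDerivAt_rot (q : Fin n × Fin n) (x : EuclideanSpace ℝ (Fin n)) (s : ℝ) :
    HasDerivAt (fun s => rot q s x) (rotField q (rot q s x)) s := by
  by_cases h : q.1 = q.2
  · have : rotField q (rot q s x) = 0 := by simp [rotField, h]
    rw [this]
    simpa only [rot_apply_of_eq h] using hasDerivAt_const s x
  · have h1 : (rot q s x) q.1 = Real.cos s * x q.1 - Real.sin s * x q.2 := by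
      rw [rot_apply_of_ne h]; simp [h]; ring
    have h2 : (rot q s x) q.2 = Real.cos s * x q.2 + Real.sin s * x q.1 := by
      rw [rot_apply_of_ne h]; simp [Ne.symm h]; ring
    rw [rotField, h1, h2]
    simp only [rot_apply_of_ne h]
    have hc := (Real.hasDerivAt_cos s).sub_const 1
    have hs := Real.hasDerivAt_sin s
    have e1 := ((hc.mul_const (x q.1)).sub (hs.mul_const (x q.2))).smul_const
      (EuclideanSpace.single q.1 (1 : ℝ))
    have e2 := ((hc.mul_const (x q.2)).add (hs.mul_const (x q.1))).smul_const
      (EuclideanSpace.single q.2 (1 : ℝ))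
    refine ((e1.add e2).const_add x).congr_deriv ?_
    module

theorem continuous_rot (q : Fin n × Fin n) :
    Continuous (fun z : ℝ × EuclideanSpace ℝ (Fin n) => rot q z.1 z.2) := by
  by_cases h : q.1 = q.2
  · simpa only [rot_apply_of_eq h] using continuous_snd
  · simp only [rot_apply_of_ne h]
    fun_prop

/-- The action of the coordinate rotations on the unit sphere. -/
noncomputable def srot (q : Fin n × Fin n) (s : ℝ) : USphere n → USphere n := sphereMap (rot q s)

theorem continuous_srot (q : Fin n × Fin n) :
    Continuous (fun z : ℝ × USphere n => srot q z.1 z.2) := by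
  have h : Continuous (fun z : ℝ × USphere n => (z.1, (z.2 : EuclideanSpace ℝ (Fin n)))) := by
    fun_prop
  exact Continuous.subtype_mk (Continuous.comp' (continuous_rot q) h) _

theorem continuous_srot_right (q : Fin n × Fin n) (s : ℝ) : Continuous (srot q s) :=
  continuous_sphereMap _

theorem avg_comp_srot (q : Fin n × Fin n) (s : ℝ) (F : USphere n → ℝ) :
    avg (fun x => F (srot q s x)) = avg F := avg_comp_sphereMap _ F

/-- `G` is the derivative of `F` along the rotations in a coordinate plane. -/
def HasRot (q : Fin n × Fin n) (F G : USphere n → ℝ) : Prop :=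
  ∀ x s, HasDerivAt (fun s => F (srot q s x)) (G (srot q s x)) s

namespace HasRot

variable {q : Fin n × Fin n} {F F' G G' : USphere n → ℝ}

theorem mul (hF : HasRot q F F') (hG : HasRot q G G') :
    HasRot q (fun x => F x * G x) (fun x => F' x * G x + F x * G' x) :=
  fun x s => (hF x s).mul (hG x s)

theorem add_const (c : ℝ) (hF : HasRot q F F') : HasRot q (fun x => F x + c) F' :=
  fun x s => (hF x s).add_const c

theorem comp {κ κ' : ℝ → ℝ} (hκ : ∀ x, HasDerivAt κ (κ' (F x)) (F x)) (hF : HasRot q F F') :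
    HasRot q (fun x => κ (F x)) (fun x => κ' (F x) * F' x) :=
  fun x s => (hκ (srot q s x)).comp s (hF x s)

variable [NeZero n]

theorem avg_eq_zero (h : HasRot q F G) (hF : Continuous F) (hG : Continuous G) : avg G = 0 := by
  have hGc : Continuous (fun z : ℝ × USphere n => G (srot q z.1 z.2)) :=
    hG.comp (continuous_srot q)
  have hFc : ∀ t, Continuous (fun x => F (srot q t x)) := fun t =>
    hF.comp (continuous_srot_right q t)
  have h1 : HasDerivAt (fun s => avg (fun x => F (srot q s x)))
      (avg (fun x => G (srot q 0 x))) 0 :=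
    hasDerivAt_avg (F := fun s x => F (srot q s x)) (F' := fun s x => G (srot q s x))
      isOpen_univ (fun t _ => hFc t) hGc.continuousOn (fun t _ x => h x t) (mem_univ _)
  have h2 : (fun s => avg (fun x => F (srot q s x))) = fun _ => avg F :=
    funext fun s => avg_comp_srot q s F
  rw [h2, avg_comp_srot q 0 G] at h1
  exact h1.unique (hasDerivAt_const _ _)

/-- Integration by parts on the sphere. -/
theorem avg_mul (hF : HasRot q F F') (hG : HasRot q G G') (cF : Continuous F)
    (cF' : Continuous F') (cG : Continuous G) (cG' : Continuous G') :
    avg (fun x => F x * G' x) = -avg (fun x => F' x * G x) := by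
  have := (hF.mul hG).avg_eq_zero (by fun_prop) (by fun_prop)
  rw [avg_add (by fun_prop) (by fun_prop)] at this
  linarith

end HasRot

end rotations

section zonal

variable {n : ℕ}

/-- The inner product of two points of the unit sphere. -/
noncomputable def sdot (x y : USphere n) : ℝ :=
  inner ℝ (x : EuclideanSpace ℝ (Fin n)) (y : EuclideanSpace ℝ (Fin n))

@[fun_prop]
theorem continuous_sdot {X : Type*} [TopologicalSpace X] {f g : X → USphere n}
    (hf : Continuous f) (hg : Continuous g) : Continuous (fun z => sdot (f z) (g z)) := by
  unfold sdot; fun_prop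

theorem sdot_comm (x y : USphere n) : sdot x y = sdot y x := real_inner_comm _ _

theorem norm_usphere (x : USphere n) : ‖(x : EuclideanSpace ℝ (Fin n))‖ = 1 := by simp

theorem sdot_mem (x y : USphere n) : sdot x y ∈ Icc (-1 : ℝ) 1 := by
  have := abs_real_inner_le_norm (x : EuclideanSpace ℝ (Fin n)) (y : EuclideanSpace ℝ (Fin n))
  rw [norm_usphere, norm_usphere, one_mul] at this
  exact abs_le.1 this

theorem sdot_srot (q : Fin n × Fin n) (s : ℝ) (x y : USphere n) :
    sdot (srot q s x) (srot q s y) = sdot x y :=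
  LinearIsometryEquiv.inner_map_map _ _ _

theorem sum_sq_usphere (x : USphere n) :
    ∑ i, (x : EuclideanSpace ℝ (Fin n)) i ^ 2 = 1 := by
  rw [← EuclideanSpace.real_norm_sq_eq, norm_usphere, one_pow]

theorem sdot_eq_sum (x y : USphere n) :
    sdot x y = ∑ i, (x : EuclideanSpace ℝ (Fin n)) i * (y : EuclideanSpace ℝ (Fin n)) i := by
  simp [sdot, PiLp.inner_apply, mul_comm]

/-- The first rotational derivative of the inner product. -/
noncomputable def sdot₁ (q : Fin n × Fin n) (x y : USphere n) : ℝ :=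
  (x : EuclideanSpace ℝ (Fin n)) q.1 * (y : EuclideanSpace ℝ (Fin n)) q.2 -
    (x : EuclideanSpace ℝ (Fin n)) q.2 * (y : EuclideanSpace ℝ (Fin n)) q.1

/-- The second rotational derivative of the inner product. -/
noncomputable def sdot₂ (q : Fin n × Fin n) (x y : USphere n) : ℝ :=
  if q.1 = q.2 then 0 else
    -((x : EuclideanSpace ℝ (Fin n)) q.1 * (y : EuclideanSpace ℝ (Fin n)) q.1 +
      (x : EuclideanSpace ℝ (Fin n)) q.2 * (y : EuclideanSpace ℝ (Fin n)) q.2)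

theorem continuous_sdot₁ (q : Fin n × Fin n) (y : USphere n) :
    Continuous (fun x => sdot₁ q x y) := by
  unfold sdot₁; fun_prop

theorem continuous_sdot₂ (q : Fin n × Fin n) (y : USphere n) :
    Continuous (fun x => sdot₂ q x y) := by
  unfold sdot₂; split_ifs <;> fun_prop

theorem hasDerivAt_srot_apply (q : Fin n × Fin n) (x : USphere n) (s : ℝ) (i : Fin n) :
    HasDerivAt (fun s => (srot q s x : EuclideanSpace ℝ (Fin n)) i)
      (rotField q (srot q s x : EuclideanSpace ℝ (Fin n)) i) s :=
  ((EuclideanSpace.proj (𝕜 := ℝ) i).hasFDerivAt.comp_hasDerivAt s (hasDerivAt_rot q x s))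

theorem hasRot_sdot (q : Fin n × Fin n) (y : USphere n) :
    HasRot q (fun x => sdot x y) (fun x => sdot₁ q x y) := by
  intro x s
  have h := (hasDerivAt_rot q (x : EuclideanSpace ℝ (Fin n)) s).inner ℝ
    (hasDerivAt_const s (y : EuclideanSpace ℝ (Fin n)))
  refine h.congr_deriv ?_
  simp only [rotField, sdot₁, inner_zero_right, zero_add, inner_sub_left, inner_smul_left,
    EuclideanSpace.inner_single_left]
  simp [srot, sphereMap]

theorem hasRot_sdot₁ (q : Fin n × Fin n) (y : USphere n) :
    HasRot q (fun x => sdot₁ q x y) (fun x => sdot₂ q x y) := by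
  intro x s
  have h := ((hasDerivAt_srot_apply q x s q.1).mul_const
    ((y : EuclideanSpace ℝ (Fin n)) q.2)).sub
    ((hasDerivAt_srot_apply q x s q.2).mul_const ((y : EuclideanSpace ℝ (Fin n)) q.1))
  refine h.congr_deriv ?_
  by_cases hq : q.1 = q.2
  · simp [rotField, sdot₂, hq]
  · simp [rotField, sdot₂, hq, Ne.symm hq]
    ring

theorem sum_sdot₁_sq (x y : USphere n) : ∑ q, sdot₁ q x y ^ 2 = 2 * (1 - sdot x y ^ 2) := by
  have hx := sum_sq_usphere x
  have hy := sum_sq_usphere y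
  set a : Fin n → ℝ := fun i => (x : EuclideanSpace ℝ (Fin n)) i
  set b : Fin n → ℝ := fun i => (y : EuclideanSpace ℝ (Fin n)) i
  have h1 : ∑ q : Fin n × Fin n, sdot₁ q x y ^ 2 =
      ∑ i, ∑ j, (a i ^ 2 * b j ^ 2 + b i ^ 2 * a j ^ 2 - 2 * ((a i * b i) * (a j * b j))) := by
    rw [Fintype.sum_prod_type]
    refine Finset.sum_congr rfl fun i _ => Finset.sum_congr rfl fun j _ => ?_
    simp only [sdot₁, a, b]
    ring
  rw [h1, sdot_eq_sum]
  simp only [Finset.sum_add_distrib, Finset.sum_sub_distrib, ← Finset.mul_sum, ← Finset.sum_mul]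
  change (∑ i, a i ^ 2) * (∑ i, b i ^ 2) + (∑ i, b i ^ 2) * (∑ i, a i ^ 2) -
    2 * ((∑ i, a i * b i) * ∑ i, a i * b i) = 2 * (1 - (∑ i, a i * b i) ^ 2)
  have hx' : ∑ i, a i ^ 2 = 1 := hx
  have hy' : ∑ i, b i ^ 2 = 1 := hy
  rw [hx', hy']; ring

theorem sum_sdot₂ (x y : USphere n) : ∑ q, sdot₂ q x y = -(2 * (n - 1) * sdot x y) := by
  set a : Fin n → ℝ := fun i =>
    (x : EuclideanSpace ℝ (Fin n)) i * (y : EuclideanSpace ℝ (Fin n)) i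
  have h1 : ∑ q : Fin n × Fin n, sdot₂ q x y =
      ∑ i, ∑ j, (-(a i + a j) + if i = j then 2 * a i else 0) := by
    rw [Fintype.sum_prod_type]
    refine Finset.sum_congr rfl fun i _ => Finset.sum_congr rfl fun j _ => ?_
    simp only [sdot₂]
    by_cases h : i = j
    · subst h; simp [a]; ring
    · simp [h, a]
  rw [h1, sdot_eq_sum]
  simp only [Finset.sum_add_distrib, Finset.sum_neg_distrib, Finset.sum_const, Finset.card_univ,
    Fintype.card_fin, nsmul_eq_mul, Finset.sum_ite_eq, Finset.mem_univ, if_true,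
    ← Finset.mul_sum]
  change -(n * ∑ i, a i + n * ∑ i, a i) + 2 * ∑ i, a i = -(2 * (n - 1) * ∑ i, a i)
  ring

theorem continuous_zonal {κ : ℝ → ℝ} (hκ : ContinuousOn κ (Icc (-1) 1)) {X : Type*}
    [TopologicalSpace X] {f g : X → USphere n} (hf : Continuous f) (hg : Continuous g) :
    Continuous (fun z => κ (sdot (f z) (g z))) :=
  hκ.comp_continuous (by fun_prop) fun z => sdot_mem _ _

variable [NeZero n]

/-- Moving the spherical Laplacian onto a zonal kernel. -/
theorem avg_zonal_laplacian {κ κ₁ κ₂ : ℝ → ℝ}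
    (h1 : ∀ c ∈ Icc (-1 : ℝ) 1, HasDerivAt κ (κ₁ c) c)
    (h2 : ∀ c ∈ Icc (-1 : ℝ) 1, HasDerivAt κ₁ (κ₂ c) c)
    (h3 : ContinuousOn κ₂ (Icc (-1) 1)) (y : USphere n) {g : USphere n → ℝ}
    {g₁ g₂ : Fin n × Fin n → USphere n → ℝ} (hg : ∀ q, HasRot q g (g₁ q))
    (hg₁ : ∀ q, HasRot q (g₁ q) (g₂ q)) (cg : Continuous g) (cg₁ : ∀ q, Continuous (g₁ q))
    (cg₂ : ∀ q, Continuous (g₂ q)) :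
    avg (fun x => κ (sdot x y) * ((1 / 2) * ∑ q, g₂ q x)) =
      avg (fun x => ((1 - sdot x y ^ 2) * κ₂ (sdot x y) - (n - 1) * sdot x y * κ₁ (sdot x y))
        * g x) := by
  have c0 : Continuous fun x => κ (sdot x y) := continuous_zonal
    (fun c hc => (h1 c hc).continuousAt.continuousWithinAt) continuous_id continuous_const
  have c1 : Continuous fun x => κ₁ (sdot x y) := continuous_zonal
    (fun c hc => (h2 c hc).continuousAt.continuousWithinAt) continuous_id continuous_const
  have c2 : Continuous fun x => κ₂ (sdot x y) := continuous_zonal h3 continuous_id continuous_const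
  have d1 := fun q => continuous_sdot₁ q y
  have d2 := fun q => continuous_sdot₂ q y
  have key : ∀ q, avg (fun x => κ (sdot x y) * g₂ q x) =
      avg (fun x => (κ₂ (sdot x y) * sdot₁ q x y ^ 2 + κ₁ (sdot x y) * sdot₂ q x y) * g x) := by
    intro q
    have r0 : HasRot q (fun x => κ (sdot x y)) (fun x => κ₁ (sdot x y) * sdot₁ q x y) :=
      (hasRot_sdot q y).comp fun x => h1 _ (sdot_mem x y)
    have r1 : HasRot q (fun x => κ₁ (sdot x y)) (fun x => κ₂ (sdot x y) * sdot₁ q x y) :=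
      (hasRot_sdot q y).comp fun x => h2 _ (sdot_mem x y)
    have r2 := r1.mul (hasRot_sdot₁ q y)
    rw [r0.avg_mul (hg₁ q) c0 (c1.mul (d1 q)) (cg₁ q) (cg₂ q),
      r2.avg_mul (hg q) (c1.mul (d1 q)) (((c2.mul (d1 q)).mul (d1 q)).add (c1.mul (d2 q)))
        cg (cg₁ q), neg_neg]
    congr 1; ext x; ring
  have e1 : (fun x => κ (sdot x y) * ((1 / 2) * ∑ q, g₂ q x)) =
      fun x => (1 / 2) * ∑ q, κ (sdot x y) * g₂ q x := by
    ext x; rw [← Finset.mul_sum]; ring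
  rw [e1, avg_const_mul,
    avg_sum (F := fun q x => κ (sdot x y) * g₂ q x) _ (fun q => c0.mul (cg₂ q)),
    Finset.sum_congr rfl fun q _ => key q,
    ← avg_sum (F := fun q x => (κ₂ (sdot x y) * sdot₁ q x y ^ 2 +
      κ₁ (sdot x y) * sdot₂ q x y) * g x) _
      (fun q => ((c2.mul ((d1 q).pow 2)).add (c1.mul (d2 q))).mul cg), ← avg_const_mul]
  congr 1; ext x
  rw [← Finset.sum_mul, Finset.sum_add_distrib, ← Finset.mul_sum, ← Finset.mul_sum,
    sum_sdot₁_sq, sum_sdot₂]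
  ring

end zonal

section kernel

/-- The squared distance `|x - e^t η|²` in terms of `c = ⟨x, η⟩`. -/
noncomputable def pA (t c : ℝ) : ℝ := 1 + Real.exp t ^ 2 - 2 * Real.exp t * c

/-- The Poisson kernel of the ball in logarithmic radius. -/
noncomputable def pK (ν t c : ℝ) : ℝ := (1 - Real.exp t ^ 2) * pA t c ^ (-ν)

/-- The radial derivative of the Poisson kernel. -/
noncomputable def pKt (ν t c : ℝ) : ℝ :=
  -2 * Real.exp t ^ 2 * pA t c ^ (-ν) -
    ν * (1 - Real.exp t ^ 2) * (pA t c - (1 - Real.exp t ^ 2)) * pA t c ^ (-ν - 1)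

/-- The second radial derivative of the Poisson kernel. -/
noncomputable def pKtt (ν t c : ℝ) : ℝ :=
  -4 * Real.exp t ^ 2 * pA t c ^ (-ν) +
    2 * Real.exp t ^ 2 * ν * (pA t c - (1 - Real.exp t ^ 2)) * pA t c ^ (-ν - 1) -
    ν * (-2 * Real.exp t ^ 2 * (pA t c - (1 - Real.exp t ^ 2)) + (1 - Real.exp t ^ 2) *
      ((pA t c - (1 - Real.exp t ^ 2)) + 2 * Real.exp t ^ 2)) * pA t c ^ (-ν - 1) +
    ν * (ν + 1) * (1 - Real.exp t ^ 2) * (pA t c - (1 - Real.exp t ^ 2)) ^ 2 *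
      pA t c ^ (-ν - 1 - 1)

/-- The derivative of the Poisson kernel in the angular variable. -/
noncomputable def pKc (ν t c : ℝ) : ℝ :=
  2 * Real.exp t * ν * (1 - Real.exp t ^ 2) * pA t c ^ (-ν - 1)

/-- The second derivative of the Poisson kernel in the angular variable. -/
noncomputable def pKcc (ν t c : ℝ) : ℝ :=
  4 * Real.exp t ^ 2 * ν * (ν + 1) * (1 - Real.exp t ^ 2) * pA t c ^ (-ν - 1 - 1)

theorem pA_lower {t c : ℝ} (hc : c ∈ Icc (-1 : ℝ) 1) : (1 - Real.exp t) ^ 2 ≤ pA t c := by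
  unfold pA; nlinarith [Real.exp_pos t, hc.2]

theorem pA_upper {t c : ℝ} (hc : c ∈ Icc (-1 : ℝ) 1) : pA t c ≤ (1 + Real.exp t) ^ 2 := by
  unfold pA; nlinarith [Real.exp_pos t, hc.1]

theorem pA_pos {t c : ℝ} (ht : t < 0) (hc : c ∈ Icc (-1 : ℝ) 1) : 0 < pA t c := by
  have h : Real.exp t < 1 := by simpa using ht
  exact lt_of_lt_of_le (by nlinarith) (pA_lower hc)

theorem one_sub_exp_sq_pos {t : ℝ} (ht : t < 0) : 0 < 1 - Real.exp t ^ 2 := by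
  have h : Real.exp t < 1 := by simpa using ht
  nlinarith [Real.exp_pos t]

theorem pK_pos (ν : ℝ) {t c : ℝ} (ht : t < 0) (hc : c ∈ Icc (-1 : ℝ) 1) : 0 < pK ν t c :=
  mul_pos (one_sub_exp_sq_pos ht) (Real.rpow_pos_of_pos (pA_pos ht hc) _)

theorem hasDerivAt_exp_sq (t : ℝ) :
    HasDerivAt (fun t => Real.exp t ^ 2) (2 * Real.exp t ^ 2) t := by
  refine ((Real.hasDerivAt_exp t).pow 2).congr_deriv ?_
  norm_num; ring

theorem hasDerivAt_pA_left (t c : ℝ) :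
    HasDerivAt (fun t => pA t c) (pA t c - (1 - Real.exp t ^ 2)) t := by
  refine (((hasDerivAt_exp_sq t).const_add 1).sub
    (((Real.hasDerivAt_exp t).const_mul 2).mul_const c)).congr_deriv ?_
  unfold pA; ring

theorem hasDerivAt_pA_right (t c : ℝ) :
    HasDerivAt (fun c => pA t c) (-2 * Real.exp t) c := by
  refine (((hasDerivAt_id c).const_mul (2 * Real.exp t)).const_sub
    (1 + Real.exp t ^ 2)).congr_deriv ?_
  ring

theorem hasDerivAt_pA_rpow_left (μ : ℝ) {t c : ℝ} (ht : t < 0) (hc : c ∈ Icc (-1 : ℝ) 1) :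
    HasDerivAt (fun t => pA t c ^ μ)
      ((pA t c - (1 - Real.exp t ^ 2)) * μ * pA t c ^ (μ - 1)) t :=
  (hasDerivAt_pA_left t c).rpow_const (Or.inl (pA_pos ht hc).ne')

theorem hasDerivAt_pA_rpow_right (μ : ℝ) {t c : ℝ} (ht : t < 0) (hc : c ∈ Icc (-1 : ℝ) 1) :
    HasDerivAt (fun c => pA t c ^ μ) ((-2 * Real.exp t) * μ * pA t c ^ (μ - 1)) c :=
  (hasDerivAt_pA_right t c).rpow_const (Or.inl (pA_pos ht hc).ne')

theorem hasDerivAt_pK (ν : ℝ) {t c : ℝ} (ht : t < 0) (hc : c ∈ Icc (-1 : ℝ) 1) :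
    HasDerivAt (fun t => pK ν t c) (pKt ν t c) t := by
  refine (((hasDerivAt_exp_sq t).const_sub 1).mul
    (hasDerivAt_pA_rpow_left (-ν) ht hc)).congr_deriv ?_
  unfold pKt; ring

theorem hasDerivAt_pKt (ν : ℝ) {t c : ℝ} (ht : t < 0) (hc : c ∈ Icc (-1 : ℝ) 1) :
    HasDerivAt (fun t => pKt ν t c) (pKtt ν t c) t := by
  have hB := (hasDerivAt_exp_sq t).const_sub 1
  have hD := (hasDerivAt_pA_left t c).sub hB
  refine ((((hasDerivAt_exp_sq t).const_mul (-2)).mul (hasDerivAt_pA_rpow_left (-ν) ht hc)).sub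
    (((hB.const_mul ν).mul hD).mul (hasDerivAt_pA_rpow_left (-ν - 1) ht hc))).congr_deriv ?_
  unfold pKtt
  simp only [Pi.mul_apply, Pi.sub_apply]
  ring

theorem hasDerivAt_pK_right (ν : ℝ) {t c : ℝ} (ht : t < 0) (hc : c ∈ Icc (-1 : ℝ) 1) :
    HasDerivAt (fun c => pK ν t c) (pKc ν t c) c := by
  refine ((hasDerivAt_pA_rpow_right (-ν) ht hc).const_mul _).congr_deriv ?_
  unfold pKc; ring

theorem hasDerivAt_pKc (ν : ℝ) {t c : ℝ} (ht : t < 0) (hc : c ∈ Icc (-1 : ℝ) 1) :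
    HasDerivAt (fun c => pKc ν t c) (pKcc ν t c) c := by
  refine ((hasDerivAt_pA_rpow_right (-ν - 1) ht hc).const_mul _).congr_deriv ?_
  unfold pKcc; ring

theorem pK_pde (ν : ℝ) {t c : ℝ} (ht : t < 0) (hc : c ∈ Icc (-1 : ℝ) 1) :
    (1 - c ^ 2) * pKcc ν t c - (2 * ν - 1) * c * pKc ν t c =
      -(pKtt ν t c + (2 * ν - 2) * pKt ν t c) := by
  have hA := pA_pos ht hc
  have e1 : pA t c ^ (-ν - 1) = pA t c ^ (-ν - 1 - 1) * pA t c := by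
    rw [← Real.rpow_add_one hA.ne']; ring_nf
  have e2 : pA t c ^ (-ν) = pA t c ^ (-ν - 1 - 1) * pA t c * pA t c := by
    rw [← e1, ← Real.rpow_add_one hA.ne']; ring_nf
  unfold pKcc pKc pKtt pKt
  rw [e2, e1]
  set X := pA t c ^ (-ν - 1 - 1)
  unfold pA
  ring

theorem continuousOn_pA_rpow (μ : ℝ) :
    ContinuousOn (fun z : ℝ × ℝ => pA z.1 z.2 ^ μ) (Iio 0 ×ˢ Icc (-1) 1) := by
  refine ContinuousOn.rpow_const (Continuous.continuousOn (by unfold pA; fun_prop)) ?_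
  exact fun z hz => Or.inl (pA_pos hz.1 hz.2).ne'

theorem continuousOn_pK (ν : ℝ) :
    ContinuousOn (fun z : ℝ × ℝ => pK ν z.1 z.2) (Iio 0 ×ˢ Icc (-1) 1) :=
  ContinuousOn.mul (Continuous.continuousOn (by fun_prop)) (continuousOn_pA_rpow _)

theorem continuousOn_pKt (ν : ℝ) :
    ContinuousOn (fun z : ℝ × ℝ => pKt ν z.1 z.2) (Iio 0 ×ˢ Icc (-1) 1) :=
  (ContinuousOn.mul (Continuous.continuousOn (by fun_prop)) (continuousOn_pA_rpow _)).sub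
    (ContinuousOn.mul (Continuous.continuousOn (by unfold pA; fun_prop)) (continuousOn_pA_rpow _))

theorem continuousOn_pKtt (ν : ℝ) :
    ContinuousOn (fun z : ℝ × ℝ => pKtt ν z.1 z.2) (Iio 0 ×ˢ Icc (-1) 1) :=
  (((ContinuousOn.mul (Continuous.continuousOn (by fun_prop)) (continuousOn_pA_rpow _)).add
    (ContinuousOn.mul (Continuous.continuousOn (by unfold pA; fun_prop))
      (continuousOn_pA_rpow _))).sub
    (ContinuousOn.mul (Continuous.continuousOn (by unfold pA; fun_prop))
      (continuousOn_pA_rpow _))).add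
    (ContinuousOn.mul (Continuous.continuousOn (by unfold pA; fun_prop)) (continuousOn_pA_rpow _))

theorem continuousOn_pKcc (ν : ℝ) {t : ℝ} (ht : t < 0) :
    ContinuousOn (fun c => pKcc ν t c) (Icc (-1) 1) := by
  have h := (continuousOn_pA_rpow (-ν - 1 - 1)).comp (f := fun c : ℝ => (t, c)) (s := Icc (-1) 1)
    (by fun_prop) (fun c hc => ⟨ht, hc⟩)
  exact continuousOn_const.mul h

/-- The radial derivative of the Poisson kernel decays at the centre. -/
theorem abs_pKt_le {ν : ℝ} (hν : 0 < ν) {t c : ℝ} (ht : t < -1) (hc : c ∈ Icc (-1 : ℝ) 1) :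
    |pKt ν t c| ≤ (2 * 4 ^ ν + 4 * ν * 4 ^ (ν + 1)) * Real.exp t := by
  have hs : Real.exp t < 1 / 2 := by
    have h1 : Real.exp t < Real.exp (-1) := Real.exp_lt_exp.2 ht
    have h2 : Real.exp (-1) < 1 / 2 := by
      rw [Real.exp_neg, inv_eq_one_div]
      exact one_div_lt_one_div_of_lt (by norm_num) (by linarith [Real.exp_one_gt_d9])
    linarith
  have h0 := Real.exp_pos t
  have hA : (1 / 4 : ℝ) ≤ pA t c := le_trans (by nlinarith) (pA_lower hc)
  have hb : ∀ μ : ℝ, 0 < μ → pA t c ^ (-μ) ≤ 4 ^ μ := by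
    intro μ hμ
    calc pA t c ^ (-μ) ≤ (1 / 4 : ℝ) ^ (-μ) :=
          Real.rpow_le_rpow_of_nonpos (by norm_num) hA (by linarith)
      _ = 4 ^ μ := by
        rw [one_div, Real.inv_rpow (by norm_num), Real.rpow_neg (by norm_num), inv_inv]
  have hp : ∀ μ : ℝ, 0 ≤ pA t c ^ μ := fun μ => Real.rpow_nonneg (by linarith) _
  have hd : |pA t c - (1 - Real.exp t ^ 2)| ≤ 4 * Real.exp t := by
    have : pA t c - (1 - Real.exp t ^ 2) = 2 * Real.exp t * (Real.exp t - c) := by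
      unfold pA; ring
    rw [this, abs_mul, abs_of_pos (by positivity)]
    have : |Real.exp t - c| ≤ 2 := abs_le.2 ⟨by linarith [hc.2], by linarith [hc.1]⟩
    nlinarith
  have e : -ν - 1 = -(ν + 1) := by ring
  have hB : |1 - Real.exp t ^ 2| ≤ 1 := abs_le.2 ⟨by nlinarith, by nlinarith⟩
  unfold pKt
  rw [e]
  refine (abs_sub _ _).trans ?_
  rw [abs_mul, abs_mul, abs_mul, abs_mul, abs_mul, abs_of_nonneg (hp (-ν)),
    abs_of_nonneg (hp (-(ν + 1))), abs_of_pos hν, abs_of_pos (by positivity : 0 < Real.exp t ^ 2)]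
  have t1 : |(-2 : ℝ)| * Real.exp t ^ 2 * pA t c ^ (-ν) ≤ 2 * Real.exp t * 4 ^ ν := by
    have : |(-2 : ℝ)| = 2 := by norm_num
    rw [this]
    exact mul_le_mul (by nlinarith) (hb ν hν) (hp _) (by positivity)
  have t2 : ν * |1 - Real.exp t ^ 2| * |pA t c - (1 - Real.exp t ^ 2)| * pA t c ^ (-(ν + 1)) ≤
      ν * 1 * (4 * Real.exp t) * 4 ^ (ν + 1) := by
    gcongr
    exact hb _ (by linarith)
  linarith

end kernel

section poisson

variable {n : ℕ}

/-- The integral operator with a zonal kernel. -/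
noncomputable def zonalOp (κ : ℝ → ℝ) (g : USphere n → ℝ) (η : USphere n) : ℝ :=
  avg fun x => κ (sdot x η) * g x

variable [NeZero n]

theorem hasRot_zonalOp {κ : ℝ → ℝ} (hκ : ContinuousOn κ (Icc (-1) 1)) {q : Fin n × Fin n}
    {g g' : USphere n → ℝ} (hg : HasRot q g g') (cg : Continuous g) (cg' : Continuous g') :
    HasRot q (zonalOp κ g) (zonalOp κ g') := by
  have key : ∀ (f : USphere n → ℝ) (η : USphere n) (s : ℝ), zonalOp κ f (srot q s η) =
      avg fun x => κ (sdot x η) * f (srot q s x) := by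
    intro f η s
    rw [zonalOp, ← avg_comp_srot q s]
    simp only [sdot_srot]
  intro η s
  simp only [key]
  have c0 : Continuous fun z : ℝ × USphere n => κ (sdot z.2 η) :=
    continuous_zonal hκ continuous_snd continuous_const
  have c1 : Continuous fun z : ℝ × USphere n => g' (srot q z.1 z.2) :=
    cg'.comp (continuous_srot q)
  have c2 : Continuous fun x : USphere n => κ (sdot x η) :=
    continuous_zonal hκ continuous_id continuous_const
  exact hasDerivAt_avg (F := fun s x => κ (sdot x η) * g (srot q s x))
    (F' := fun s x => κ (sdot x η) * g' (srot q s x)) isOpen_univ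
    (fun t _ => c2.mul (cg.comp (continuous_srot_right q t))) (c0.mul c1).continuousOn
    (fun t _ x => (hg x t).const_mul _) (mem_univ s)

theorem continuous_zonalOp {κ : ℝ → ℝ} (hκ : ContinuousOn κ (Icc (-1) 1))
    {g : USphere n → ℝ} (cg : Continuous g) : Continuous (zonalOp κ g) := by
  have c0 : Continuous fun z : USphere n × USphere n => κ (sdot z.2 z.1) :=
    continuous_zonal hκ continuous_snd continuous_fst
  exact continuous_avg (F := fun η x => κ (sdot x η) * g x) (c0.mul (cg.comp continuous_snd))

theorem continuousOn_zonalOp {K : ℝ → ℝ → ℝ}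
    (hK : ContinuousOn (fun z : ℝ × ℝ => K z.1 z.2) (Iio 0 ×ˢ Icc (-1) 1))
    {g : USphere n → ℝ} (cg : Continuous g) :
    ContinuousOn (fun z : ℝ × USphere n => zonalOp (K z.1) g z.2) (Iio 0 ×ˢ univ) := by
  rw [continuousOn_iff_continuous_domRestrict]
  have : LocallyCompactSpace ↥(Iio (0 : ℝ) ×ˢ (univ : Set (USphere n))) :=
    (isOpen_Iio.prod isOpen_univ).locallyCompactSpace
  have c0 : Continuous fun z : ↥(Iio (0 : ℝ) ×ˢ (univ : Set (USphere n))) × USphere n =>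
      K z.1.1.1 (sdot z.2 z.1.1.2) :=
    hK.comp_continuous (f := fun z : ↥(Iio (0 : ℝ) ×ˢ (univ : Set (USphere n))) × USphere n =>
      (z.1.1.1, sdot z.2 z.1.1.2)) (by fun_prop) fun z => ⟨z.1.2.1, sdot_mem _ _⟩
  exact continuous_avg (F := fun (z : ↥(Iio (0 : ℝ) ×ˢ (univ : Set (USphere n)))) x =>
    K z.1.1 (sdot x z.1.2) * g x) (c0.mul (cg.comp continuous_snd))

theorem slice_continuousOn {K : ℝ → ℝ → ℝ}
    (hK : ContinuousOn (fun z : ℝ × ℝ => K z.1 z.2) (Iio 0 ×ˢ Icc (-1) 1)) {t : ℝ} (ht : t < 0) :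
    ContinuousOn (K t) (Icc (-1) 1) :=
  hK.comp (f := fun c : ℝ => (t, c)) (by fun_prop) fun _ hc => ⟨ht, hc⟩

theorem hasDerivAt_zonalOp {K K' : ℝ → ℝ → ℝ}
    (hK : ContinuousOn (fun z : ℝ × ℝ => K z.1 z.2) (Iio 0 ×ˢ Icc (-1) 1))
    (hK' : ContinuousOn (fun z : ℝ × ℝ => K' z.1 z.2) (Iio 0 ×ˢ Icc (-1) 1))
    (h : ∀ t < 0, ∀ c ∈ Icc (-1 : ℝ) 1, HasDerivAt (fun t => K t c) (K' t c) t)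
    {g : USphere n → ℝ} (cg : Continuous g) (η : USphere n) {t : ℝ} (ht : t < 0) :
    HasDerivAt (fun t => zonalOp (K t) g η) (zonalOp (K' t) g η) t := by
  have c1 : ContinuousOn (fun z : ℝ × USphere n => K' z.1 (sdot z.2 η)) (Iio 0 ×ˢ univ) :=
    hK'.comp (f := fun z : ℝ × USphere n => (z.1, sdot z.2 η))
      (Continuous.continuousOn (by fun_prop)) fun z hz => ⟨hz.1, sdot_mem _ _⟩
  exact hasDerivAt_avg (F := fun t x => K t (sdot x η) * g x)
    (F' := fun t x => K' t (sdot x η) * g x) isOpen_Iio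
    (fun t ht => (continuous_zonal (slice_continuousOn hK ht) continuous_id
      continuous_const).mul cg)
    (c1.mul (cg.comp continuous_snd).continuousOn)
    (fun t ht x => (h t ht _ (sdot_mem x η)).mul_const _) ht

/-- The Poisson extension is harmonic. -/
theorem zonalOp_laplacian {t : ℝ} (ht : t < 0) (η : USphere n) {g : USphere n → ℝ}
    {g₁ g₂ : Fin n × Fin n → USphere n → ℝ} (hg : ∀ q, HasRot q g (g₁ q))
    (hg₁ : ∀ q, HasRot q (g₁ q) (g₂ q)) (cg : Continuous g) (cg₁ : ∀ q, Continuous (g₁ q))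
    (cg₂ : ∀ q, Continuous (g₂ q)) :
    (1 / 2) * ∑ q, zonalOp (pK (n / 2) t) (g₂ q) η =
      -(zonalOp (pKtt (n / 2) t) g η + (n - 2) * zonalOp (pKt (n / 2) t) g η) := by
  have c0 : Continuous fun x => pK (n / 2) t (sdot x η) :=
    continuous_zonal (slice_continuousOn (continuousOn_pK _) ht) continuous_id continuous_const
  have c1 : Continuous fun x => pKt (n / 2) t (sdot x η) :=
    continuous_zonal (slice_continuousOn (continuousOn_pKt _) ht) continuous_id continuous_const
  have c2 : Continuous fun x => pKtt (n / 2) t (sdot x η) :=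
    continuous_zonal (slice_continuousOn (continuousOn_pKtt _) ht) continuous_id continuous_const
  have h := avg_zonal_laplacian (fun c hc => hasDerivAt_pK_right (n / 2) ht hc)
    (fun c hc => hasDerivAt_pKc (n / 2) ht hc) (continuousOn_pKcc _ ht) η hg hg₁ cg cg₁ cg₂
  have e1 : (1 / 2) * ∑ q, zonalOp (pK (n / 2) t) (g₂ q) η =
      avg (fun x => pK (n / 2) t (sdot x η) * ((1 / 2) * ∑ q, g₂ q x)) := by
    unfold zonalOp
    rw [← avg_sum (F := fun q x => pK (n / 2) t (sdot x η) * g₂ q x) _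
      (fun q => c0.mul (cg₂ q)), ← avg_const_mul]
    congr 1; ext x; rw [← Finset.mul_sum]; ring
  rw [e1, h]
  unfold zonalOp
  rw [← avg_const_mul, ← avg_add (F := fun x => pKtt (n / 2) t (sdot x η) * g x)
    (G := fun x => (n - 2) * (pKt (n / 2) t (sdot x η) * g x)) (c2.mul cg)
    (continuous_const.mul (c1.mul cg)), ← avg_neg]
  congr 1; ext x
  have := pK_pde (n / 2) ht (sdot_mem x η)
  linear_combination g x * this

theorem abs_zonalOp_le {κ : ℝ → ℝ} (hκ : ContinuousOn κ (Icc (-1) 1)) {C : ℝ}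
    (hC : ∀ c ∈ Icc (-1 : ℝ) 1, |κ c| ≤ C)
    {g : USphere n → ℝ} (cg : Continuous g) (η : USphere n) :
    |zonalOp κ g η| ≤ C * avg (fun x => |g x|) := by
  have c0 : Continuous fun x => κ (sdot x η) :=
    continuous_zonal hκ continuous_id continuous_const
  rw [← avg_const_mul]
  refine (abs_avg_le _).trans (avg_mono (c0.mul cg).abs (by fun_prop) fun x => ?_)
  rw [abs_mul]
  exact mul_le_mul_of_nonneg_right (hC _ (sdot_mem _ _)) (abs_nonneg _)

theorem half_natCast_pos : (0 : ℝ) < n / 2 := by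
  have : 0 < n := Nat.pos_of_ne_zero (NeZero.ne n)
  positivity

/-- The Poisson kernel has unit mass. -/
theorem avg_pK (hn : 3 ≤ n) {t : ℝ} (ht : t < 0) (η : USphere n) :
    avg (fun x => pK (n / 2) t (sdot x η)) = 1 := by
  have hn' : (3 : ℝ) ≤ n := by exact_mod_cast hn
  set m : ℝ → ℝ := fun t => zonalOp (pK (n / 2) t) (fun _ => 1) η
  set m' : ℝ → ℝ := fun t => zonalOp (pKt (n / 2) t) (fun _ => 1) η
  set m₂ : ℝ → ℝ := fun t => zonalOp (pKtt (n / 2) t) (fun _ => 1) η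
  have d1 : ∀ t < 0, HasDerivAt m (m' t) t := fun t ht =>
    hasDerivAt_zonalOp (continuousOn_pK _) (continuousOn_pKt _)
      (fun t ht c hc => hasDerivAt_pK _ ht hc) continuous_const η ht
  have d2 : ∀ t < 0, HasDerivAt m' (m₂ t) t := fun t ht =>
    hasDerivAt_zonalOp (continuousOn_pKt _) (continuousOn_pKtt _)
      (fun t ht c hc => hasDerivAt_pKt _ ht hc) continuous_const η ht
  have ode : ∀ t < 0, m₂ t + (n - 2) * m' t = 0 := by
    intro t ht
    have := zonalOp_laplacian (g := fun _ => (1 : ℝ)) (g₁ := fun _ _ => 0) (g₂ := fun _ _ => 0)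
      ht η (fun q x s => hasDerivAt_const _ _) (fun q x s => hasDerivAt_const _ _)
      continuous_const (fun _ => continuous_const) (fun _ => continuous_const)
    have z : zonalOp (pK (n / 2) t) (fun _ => (0 : ℝ)) η = 0 := by
      simp [zonalOp, avg]
    simp only [z, Finset.sum_const_zero, mul_zero] at this
    linarith
  have d3 : ∀ t < 0, HasDerivAt (fun t => Real.exp ((n - 2) * t) * m' t) 0 t := by
    intro t ht
    have he : HasDerivAt (fun t : ℝ => Real.exp ((n - 2) * t))
        (Real.exp ((n - 2) * t) * ((n - 2) * 1)) t :=
      ((hasDerivAt_id t).const_mul ((n : ℝ) - 2)).exp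
    refine (he.mul (d2 t ht)).congr_deriv ?_
    linear_combination Real.exp ((n - 2) * t) * ode t ht
  have conv : ∀ {f : ℝ → ℝ}, (∀ t < 0, HasDerivAt f 0 t) → ∀ s < 0, ∀ t < 0, f s = f t := by
    intro f hf s hs t ht
    exact (convex_Iio (0 : ℝ)).is_const_of_fderivWithin_eq_zero (𝕜 := ℝ)
      (fun u hu => (hf u hu).differentiableAt.differentiableWithinAt)
      (fun u hu => by
        rw [fderivWithin_of_isOpen isOpen_Iio hu]
        have := (hf u hu).hasFDerivAt.fderiv
        rw [this]; ext; simp) hs ht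
  have hbound : ∀ t < -1, |m' t| ≤
      ((2 : ℝ) * 4 ^ ((n : ℝ) / 2) + 4 * ((n : ℝ) / 2) * 4 ^ ((n : ℝ) / 2 + 1)) *
      Real.exp t := by
    intro t ht
    have := abs_zonalOp_le (slice_continuousOn (continuousOn_pKt (n / 2)) (by linarith : t < 0))
      (fun c hc => abs_pKt_le half_natCast_pos ht hc) (continuous_const (y := (1 : ℝ))) η
    simpa [avg_const] using this
  have hexp : Tendsto Real.exp atBot (nhds 0) := Real.tendsto_exp_atBot
  have hm'0 : ∀ t < 0, m' t = 0 := by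
    intro t ht
    have lim : Tendsto (fun s => Real.exp ((n - 2) * s) * m' s) atBot (nhds 0) := by
      have := hexp.const_mul
        ((2 : ℝ) * 4 ^ ((n : ℝ) / 2) + 4 * ((n : ℝ) / 2) * 4 ^ ((n : ℝ) / 2 + 1))
      rw [mul_zero] at this
      refine squeeze_zero_norm' ?_ this
      filter_upwards [eventually_lt_atBot (-1)] with s hs
      rw [Real.norm_eq_abs, abs_mul, abs_of_pos (Real.exp_pos _)]
      have h1 : Real.exp ((n - 2) * s) ≤ 1 := by
        rw [Real.exp_le_one_iff]; nlinarith
      calc _ ≤ 1 * |m' s| := mul_le_mul_of_nonneg_right h1 (abs_nonneg _)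
        _ ≤ _ := by rw [one_mul]; exact hbound s hs
    have lim2 : Tendsto (fun s => Real.exp ((n - 2) * s) * m' s) atBot
        (nhds (Real.exp ((n - 2) * t) * m' t)) := by
      refine tendsto_const_nhds.congr' ?_
      filter_upwards [eventually_lt_atBot 0] with s hs
      exact conv d3 t ht s hs
    have := tendsto_nhds_unique lim2 lim
    exact (mul_eq_zero.1 this).resolve_left (Real.exp_pos _).ne'
  have hm : ∀ s < 0, m s = m t := fun s hs =>
    conv (fun u hu => by rw [← hm'0 u hu]; exact d1 u hu) s hs t ht
  have hlim : Tendsto m atBot (nhds 1) := by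
    have l1 : Tendsto (fun t => (1 - Real.exp t ^ 2) * ((1 + Real.exp t) ^ 2) ^ (-((n : ℝ) / 2)))
        atBot (nhds 1) := by
      have h1 : Tendsto (fun t => ((1 + Real.exp t) ^ 2)) atBot (nhds ((1 + 0) ^ 2)) :=
        (hexp.const_add 1).pow 2
      have h2 := ((hexp.pow 2).const_sub 1).mul (h1.rpow_const (p := -((n : ℝ) / 2))
        (Or.inl (by norm_num)))
      simpa using h2
    have l2 : Tendsto (fun t => (1 - Real.exp t ^ 2) * ((1 - Real.exp t) ^ 2) ^ (-((n : ℝ) / 2)))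
        atBot (nhds 1) := by
      have h1 : Tendsto (fun t => ((1 - Real.exp t) ^ 2)) atBot (nhds ((1 - 0) ^ 2)) :=
        (hexp.const_sub 1).pow 2
      have h2 := ((hexp.pow 2).const_sub 1).mul (h1.rpow_const (p := -((n : ℝ) / 2))
        (Or.inl (by norm_num)))
      simpa using h2
    have hm_eq : ∀ t, m t = avg (fun x => pK (n / 2) t (sdot x η)) := fun t => by
      simp [m, zonalOp]
    have cK : ∀ s < 0, Continuous fun x => pK (n / 2) s (sdot x η) := fun s hs =>
      continuous_zonal (slice_continuousOn (continuousOn_pK _) hs) continuous_id continuous_const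
    refine tendsto_of_tendsto_of_tendsto_of_le_of_le' l1 l2 ?_ ?_
    · filter_upwards [eventually_lt_atBot 0] with s hs
      rw [hm_eq, ← avg_const (n := n) ((1 - Real.exp s ^ 2) * _)]
      refine avg_mono continuous_const (cK s hs) fun x => ?_
      exact mul_le_mul_of_nonneg_left (Real.rpow_le_rpow_of_nonpos (pA_pos hs (sdot_mem _ _))
        (pA_upper (sdot_mem _ _)) (by linarith [half_natCast_pos (n := n)]))
        (one_sub_exp_sq_pos hs).le
    · filter_upwards [eventually_lt_atBot 0] with s hs
      rw [hm_eq, ← avg_const (n := n) ((1 - Real.exp s ^ 2) * _)]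
      refine avg_mono (cK s hs) continuous_const fun x => ?_
      have he : Real.exp s < 1 := by simpa using hs
      exact mul_le_mul_of_nonneg_left (Real.rpow_le_rpow_of_nonpos (by nlinarith)
        (pA_lower (sdot_mem _ _)) (by linarith [half_natCast_pos (n := n)]))
        (one_sub_exp_sq_pos hs).le
  have hlim2 : Tendsto m atBot (nhds (m t)) := by
    refine tendsto_const_nhds.congr' ?_
    filter_upwards [eventually_lt_atBot 0] with s hs
    exact (hm s hs).symm
  have := tendsto_nhds_unique hlim2 hlim
  simpa [m, zonalOp] using this

/-- The Poisson extension operator contracts the mean square. -/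
theorem avg_zonalOp_pK_sq_le (hn : 3 ≤ n) {t : ℝ} (ht : t < 0) {g : USphere n → ℝ}
    (cg : Continuous g) :
    avg (fun η => zonalOp (pK (n / 2) t) g η ^ 2) ≤ avg (fun x => g x ^ 2) := by
  have cκ := slice_continuousOn (continuousOn_pK ((n : ℝ) / 2)) ht
  have cK2 : Continuous fun z : USphere n × USphere n => pK (n / 2) t (sdot z.2 z.1) :=
    continuous_zonal cκ continuous_snd continuous_fst
  have cF : Continuous fun z : USphere n × USphere n => pK (n / 2) t (sdot z.2 z.1) * g z.2 ^ 2 :=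
    cK2.mul ((cg.comp continuous_snd).pow 2)
  have step : ∀ η, zonalOp (pK (n / 2) t) g η ^ 2 ≤
      avg (fun x => pK (n / 2) t (sdot x η) * g x ^ 2) := by
    intro η
    have cK : Continuous fun x => pK (n / 2) t (sdot x η) :=
      continuous_zonal cκ continuous_id continuous_const
    set z := zonalOp (pK (n / 2) t) g η with hz
    have h0 : 0 ≤ avg (fun x => pK (n / 2) t (sdot x η) * (g x - z) ^ 2) :=
      avg_nonneg fun x => mul_nonneg (pK_pos _ ht (sdot_mem _ _)).le (sq_nonneg _)
    have e : (fun x => pK (n / 2) t (sdot x η) * (g x - z) ^ 2) = fun x =>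
        pK (n / 2) t (sdot x η) * g x ^ 2 + ((-2 * z) * (pK (n / 2) t (sdot x η) * g x) +
          z ^ 2 * pK (n / 2) t (sdot x η)) := by
      ext x; ring
    have hz' : avg (fun x => pK (n / 2) t (sdot x η) * g x) = z := rfl
    have c1 : Continuous fun x => pK (n / 2) t (sdot x η) * g x ^ 2 := cK.mul (cg.pow 2)
    have c2 : Continuous fun x => (-2 * z) * (pK (n / 2) t (sdot x η) * g x) :=
      continuous_const.mul (cK.mul cg)
    have c3 : Continuous fun x => z ^ 2 * pK (n / 2) t (sdot x η) := continuous_const.mul cK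
    have c4 : Continuous fun x => (-2 * z) * (pK (n / 2) t (sdot x η) * g x) +
        z ^ 2 * pK (n / 2) t (sdot x η) := c2.add c3
    rw [e, avg_add c1 c4, avg_add c2 c3, avg_const_mul, avg_const_mul, avg_pK hn ht,
      hz'] at h0
    nlinarith
  refine (avg_mono ((continuous_zonalOp cκ cg).pow 2) (continuous_avg cF) step).trans ?_
  rw [avg_comm cF]
  refine le_of_eq ?_
  congr 1; ext x
  rw [avg_mul_const]
  simp only [sdot_comm x]
  rw [avg_pK hn ht, one_mul]

end poisson

section rellich

variable {n : ℕ} [NeZero n]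

/-- Rellich's inequality: the radial derivative of the Poisson extension is controlled by the
tangential gradient of the boundary values. -/
theorem avg_zonalOp_pKt_sq_le (hn : 3 ≤ n) {t : ℝ} (ht : t < 0) {g : USphere n → ℝ}
    {g₁ g₂ : Fin n × Fin n → USphere n → ℝ} (hg : ∀ q, HasRot q g (g₁ q))
    (hg₁ : ∀ q, HasRot q (g₁ q) (g₂ q)) (cg : Continuous g) (cg₁ : ∀ q, Continuous (g₁ q))
    (cg₂ : ∀ q, Continuous (g₂ q)) :
    avg (fun η => zonalOp (pKt (n / 2) t) g η ^ 2) ≤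
      (1 / 2) * ∑ q, avg (fun x => g₁ q x ^ 2) := by
  have hn' : (3 : ℝ) ≤ n := by exact_mod_cast hn
  set ν : ℝ := (n : ℝ) / 2 with hν
  have cκ := continuousOn_pK ν
  have cκt := continuousOn_pKt ν
  have cκtt := continuousOn_pKtt ν
  set h : ℝ → ℝ := fun t => avg (fun η => zonalOp (pKt ν t) g η ^ 2) with hh
  set k : Fin n × Fin n → ℝ → ℝ := fun q t => avg (fun η => zonalOp (pK ν t) (g₁ q) η ^ 2) with hk
  have dh : ∀ t < 0, HasDerivAt h
      (avg fun η => 2 * zonalOp (pKt ν t) g η * zonalOp (pKtt ν t) g η) t := by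
    intro t ht
    refine hasDerivAt_avg (F := fun t η => zonalOp (pKt ν t) g η ^ 2)
      (F' := fun t η => 2 * zonalOp (pKt ν t) g η * zonalOp (pKtt ν t) g η) isOpen_Iio
      (fun t ht => (continuous_zonalOp (slice_continuousOn cκt ht) cg).pow 2)
      ((continuousOn_const.mul (continuousOn_zonalOp cκt cg)).mul (continuousOn_zonalOp cκtt cg))
      (fun t ht η => ?_) ht
    refine ((hasDerivAt_zonalOp cκt cκtt (fun t ht c hc => hasDerivAt_pKt ν ht hc) cg η
      ht).pow 2).congr_deriv ?_
    norm_num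
  have dk : ∀ q, ∀ t < 0, HasDerivAt (k q)
      (avg fun η => 2 * zonalOp (pK ν t) (g₁ q) η * zonalOp (pKt ν t) (g₁ q) η) t := by
    intro q t ht
    refine hasDerivAt_avg (F := fun t η => zonalOp (pK ν t) (g₁ q) η ^ 2)
      (F' := fun t η => 2 * zonalOp (pK ν t) (g₁ q) η * zonalOp (pKt ν t) (g₁ q) η) isOpen_Iio
      (fun t ht => (continuous_zonalOp (slice_continuousOn cκ ht) (cg₁ q)).pow 2)
      ((continuousOn_const.mul (continuousOn_zonalOp cκ (cg₁ q))).mul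
        (continuousOn_zonalOp cκt (cg₁ q))) (fun t ht η => ?_) ht
    refine ((hasDerivAt_zonalOp cκ cκt (fun t ht c hc => hasDerivAt_pK ν ht hc) (cg₁ q) η
      ht).pow 2).congr_deriv ?_
    norm_num
  set a : ℝ → ℝ := fun t => h t - (1 / 2) * ∑ q, k q t with ha
  have da : ∀ t < 0, HasDerivAt a (-(2 * (n - 2) * h t)) t := by
    intro t ht
    have := (dh t ht).sub ((HasDerivAt.fun_sum (u := Finset.univ)
      fun q _ => dk q t ht).const_mul (1 / 2))
    refine this.congr_deriv ?_
    have c0 : Continuous (zonalOp (pKt ν t) g) := continuous_zonalOp (slice_continuousOn cκt ht) cg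
    have c1 : Continuous (zonalOp (pKtt ν t) g) :=
      continuous_zonalOp (slice_continuousOn cκtt ht) cg
    have c2 : ∀ q, Continuous (zonalOp (pK ν t) (g₂ q)) := fun q =>
      continuous_zonalOp (slice_continuousOn cκ ht) (cg₂ q)
    have c3 : ∀ q, Continuous (zonalOp (pK ν t) (g₁ q)) := fun q =>
      continuous_zonalOp (slice_continuousOn cκ ht) (cg₁ q)
    have c4 : ∀ q, Continuous (zonalOp (pKt ν t) (g₁ q)) := fun q =>
      continuous_zonalOp (slice_continuousOn cκt ht) (cg₁ q)
    have ibp : ∀ q, avg (fun η => 2 * zonalOp (pK ν t) (g₁ q) η * zonalOp (pKt ν t) (g₁ q) η) =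
        -2 * avg (fun η => zonalOp (pK ν t) (g₂ q) η * zonalOp (pKt ν t) g η) := by
      intro q
      have h1 := hasRot_zonalOp (slice_continuousOn cκ ht) (hg₁ q) (cg₁ q) (cg₂ q)
      have h2 := hasRot_zonalOp (slice_continuousOn cκt ht) (hg q) cg (cg₁ q)
      have := h1.avg_mul h2 (c3 q) (c2 q) c0 (c4 q)
      rw [neg_mul, ← mul_neg, ← this, ← avg_const_mul]
      congr 1; ext η; ring
    rw [Finset.sum_congr rfl fun q _ => ibp q, ← Finset.mul_sum,
      ← avg_sum _ (F := fun q η => zonalOp (pK ν t) (g₂ q) η * zonalOp (pKt ν t) g η)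
        (fun q => (c2 q).mul c0)]
    have e : ∀ η, ∑ q, zonalOp (pK ν t) (g₂ q) η * zonalOp (pKt ν t) g η =
        -2 * (zonalOp (pKtt ν t) g η * zonalOp (pKt ν t) g η) +
          (-2 * (n - 2)) * zonalOp (pKt ν t) g η ^ 2 := by
      intro η
      rw [← Finset.sum_mul]
      have := zonalOp_laplacian ht η hg hg₁ cg cg₁ cg₂
      linear_combination 2 * zonalOp (pKt ν t) g η * this
    have e2 : (fun η => 2 * zonalOp (pKt ν t) g η * zonalOp (pKtt ν t) g η) =
        fun η => 2 * (zonalOp (pKtt ν t) g η * zonalOp (pKt ν t) g η) := by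
      ext η; ring
    simp only [e]
    rw [e2, avg_add (by fun_prop) (by fun_prop), avg_const_mul, avg_const_mul, avg_const_mul]
    simp only [hh]
    ring
  have hnn : ∀ t, 0 ≤ h t := fun t => avg_nonneg fun η => sq_nonneg _
  have hknn : ∀ q t, 0 ≤ k q t := fun q t => avg_nonneg fun η => sq_nonneg _
  have anti : AntitoneOn a (Iio 0) := by
    refine antitoneOn_of_deriv_nonpos (convex_Iio 0)
      (fun t ht => (da t ht).continuousAt.continuousWithinAt)
      (fun t ht => (da t (by simpa using ht)).differentiableAt.differentiableWithinAt)
      (fun t ht => ?_)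
    rw [(da t (by simpa using ht)).deriv]
    nlinarith [hnn t]
  have hlim : Tendsto h atBot (nhds 0) := by
    set C : ℝ := ((2 : ℝ) * 4 ^ ν + 4 * ν * 4 ^ (ν + 1)) * avg (fun x => |g x|)
    have l0 : Tendsto (fun t => (C * Real.exp t) ^ 2) atBot (nhds 0) := by
      have := (Real.tendsto_exp_atBot.const_mul C).pow 2
      simpa using this
    refine squeeze_zero' (Eventually.of_forall hnn) ?_ l0
    filter_upwards [eventually_lt_atBot (-1)] with t ht
    have ht0 : t < 0 := by linarith
    have c0 : Continuous (zonalOp (pKt ν t) g) := continuous_zonalOp (slice_continuousOn cκt ht0) cg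
    calc h t ≤ avg (fun _ : USphere n => (C * Real.exp t) ^ 2) := by
          refine avg_mono (by fun_prop) continuous_const fun η => ?_
          have := abs_zonalOp_le (slice_continuousOn cκt ht0)
            (fun c hc => abs_pKt_le half_natCast_pos ht hc) cg η
          rw [← sq_abs]
          refine pow_le_pow_left₀ (abs_nonneg _) (this.trans (le_of_eq ?_)) 2
          simp only [C]; ring
      _ = _ := avg_const _
  have hale : a t ≤ 0 := by
    refine ge_of_tendsto hlim ?_
    filter_upwards [eventually_lt_atBot t] with s hs
    have h1 := anti (show s ∈ Iio 0 from hs.trans ht) ht hs.le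
    have h2 : a s ≤ h s := by
      have := Finset.sum_nonneg fun q (_ : q ∈ Finset.univ) => hknn q s
      simp only [ha]; linarith
    exact h1.trans h2
  have hkle : ∀ q, k q t ≤ avg (fun x => g₁ q x ^ 2) := fun q =>
    avg_zonalOp_pK_sq_le hn ht (cg₁ q)
  have := Finset.sum_le_sum fun q (_ : q ∈ Finset.univ) => hkle q
  simp only [ha] at hale
  change h t ≤ _
  linarith

end rellich

section approximation

variable {n : ℕ} [NeZero n]

/-- The Poisson extension converges uniformly to the boundary values. -/
theorem eventually_abs_zonalOp_sub_le (hn : 3 ≤ n) {g : USphere n → ℝ} (cg : Continuous g)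
    {ε : ℝ} (hε : 0 < ε) :
    ∀ᶠ t in nhdsWithin 0 (Iio (0 : ℝ)), ∀ η, |zonalOp (pK (n / 2) t) g η - g η| ≤ ε := by
  set ν : ℝ := (n : ℝ) / 2 with hν
  have hν0 : 0 < ν := half_natCast_pos
  obtain ⟨M, hM⟩ := isCompact_univ.exists_bound_of_continuousOn cg.continuousOn
  have hM0 : 0 ≤ M := (norm_nonneg _).trans (hM
    (nonempty_of_isProbabilityMeasure (sphereProb n)).some (mem_univ _))
  obtain ⟨δ, hδ, hδg⟩ := Metric.uniformContinuous_iff.1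
    (CompactSpace.uniformContinuous_of_continuous cg) (ε / 2) (by linarith)
  have hlim : Tendsto (fun t : ℝ => 2 * M * ((1 - Real.exp t ^ 2) * (Real.exp t * δ ^ 2) ^ (-ν)))
      (nhdsWithin 0 (Iio (0 : ℝ))) (nhds 0) := by
    have h1 : Tendsto (fun t : ℝ => Real.exp t) (nhds 0) (nhds 1) := by
      simpa using Real.continuous_exp.tendsto 0
    have h2 := (((h1.pow 2).const_sub 1).mul ((h1.mul_const (δ ^ 2)).rpow_const (p := -ν)
      (Or.inl (by positivity)))).const_mul (2 * M)
    simp only [one_pow, sub_self, zero_mul, mul_zero] at h2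
    exact h2.mono_left nhdsWithin_le_nhds
  filter_upwards [hlim.eventually (gt_mem_nhds (show 0 < ε / 2 by linarith)),
    self_mem_nhdsWithin] with t hsmall ht η
  have ht : t < 0 := ht
  have cK : Continuous fun x => pK ν t (sdot x η) :=
    continuous_zonal (slice_continuousOn (continuousOn_pK ν) ht) continuous_id continuous_const
  have e : zonalOp (pK ν t) g η - g η = avg (fun x => pK ν t (sdot x η) * (g x - g η)) := by
    have h1 : (fun x => pK ν t (sdot x η) * (g x - g η)) =
        fun x => pK ν t (sdot x η) * g x - pK ν t (sdot x η) * g η := by ext x; ring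
    have c1 : Continuous fun x => pK ν t (sdot x η) * g x := cK.mul cg
    have c2 : Continuous fun x => pK ν t (sdot x η) * g η := cK.mul continuous_const
    rw [h1, avg_sub c1 c2, avg_mul_const, avg_pK hn ht, one_mul]
    rfl
  rw [e]
  set b : ℝ := 2 * M * ((1 - Real.exp t ^ 2) * (Real.exp t * δ ^ 2) ^ (-ν)) with hb
  have hpt : ∀ x, |pK ν t (sdot x η) * (g x - g η)| ≤ (ε / 2) * pK ν t (sdot x η) + b := by
    intro x
    have hK := pK_pos ν ht (sdot_mem x η)
    have hB := one_sub_exp_sq_pos ht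
    rw [abs_mul, abs_of_pos hK]
    by_cases hx : dist x η < δ
    · have h1 := (hδg hx).le
      rw [Real.dist_eq] at h1
      have hb0 : 0 ≤ b := by positivity
      nlinarith
    · have hd : δ ^ 2 ≤ 2 * (1 - sdot x η) := by
        have h1 : dist x η ^ 2 = 2 * (1 - sdot x η) := by
          rw [Subtype.dist_eq, dist_eq_norm, norm_sub_sq_real, norm_usphere, norm_usphere, sdot]
          ring
        rw [← h1]
        exact pow_le_pow_left₀ hδ.le (not_lt.1 hx) 2
      have hA : Real.exp t * δ ^ 2 ≤ pA t (sdot x η) := by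
        have : pA t (sdot x η) = (1 - Real.exp t) ^ 2 + Real.exp t * (2 * (1 - sdot x η)) := by
          unfold pA; ring
        rw [this]
        nlinarith [Real.exp_pos t, sq_nonneg (1 - Real.exp t),
          mul_le_mul_of_nonneg_left hd (Real.exp_pos t).le]
      have hKle : pK ν t (sdot x η) ≤ (1 - Real.exp t ^ 2) * (Real.exp t * δ ^ 2) ^ (-ν) :=
        mul_le_mul_of_nonneg_left (Real.rpow_le_rpow_of_nonpos (by positivity) hA (by linarith))
          hB.le
      have hg : |g x - g η| ≤ 2 * M := by
        have h1 := hM x (mem_univ _)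
        have h2 := hM η (mem_univ _)
        rw [Real.norm_eq_abs] at h1 h2
        exact (abs_sub _ _).trans (by linarith)
      have : pK ν t (sdot x η) * |g x - g η| ≤
          ((1 - Real.exp t ^ 2) * (Real.exp t * δ ^ 2) ^ (-ν)) * (2 * M) :=
        mul_le_mul hKle hg (abs_nonneg _) (by positivity)
      have h3 : 0 < (ε / 2) * pK ν t (sdot x η) := by positivity
      rw [hb]; linarith
  have c1 : Continuous fun x => |pK ν t (sdot x η) * (g x - g η)| :=
    (cK.mul (cg.sub continuous_const)).abs
  have c2 : Continuous fun x => (ε / 2) * pK ν t (sdot x η) := continuous_const.mul cK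
  have c3 : Continuous fun x => (ε / 2) * pK ν t (sdot x η) + b := c2.add continuous_const
  calc |avg (fun x => pK ν t (sdot x η) * (g x - g η))|
      ≤ avg (fun x => |pK ν t (sdot x η) * (g x - g η)|) := abs_avg_le _
    _ ≤ avg (fun x => (ε / 2) * pK ν t (sdot x η) + b) := avg_mono c1 c3 hpt
    _ = ε / 2 + b := by
        rw [avg_add c2 continuous_const, avg_const_mul, avg_pK hn ht, avg_const, mul_one]
    _ ≤ ε := by linarith

/-- Weak convergence of the Poisson extension to the boundary values. -/
theorem tendsto_avg_mul_zonalOp (hn : 3 ≤ n) {g G : USphere n → ℝ} (cg : Continuous g)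
    (cG : Continuous G) :
    Tendsto (fun t => avg (fun η => G η * zonalOp (pK (n / 2) t) g η))
      (nhdsWithin 0 (Iio (0 : ℝ))) (nhds (avg fun η => G η * g η)) := by
  rw [Metric.tendsto_nhds]
  intro ε hε
  have hA : 0 ≤ avg (fun x => |G x|) := avg_nonneg fun x => abs_nonneg _
  set δ : ℝ := ε / (2 * (avg (fun x => |G x|) + 1))
  have hδ : 0 < δ := by positivity
  filter_upwards [eventually_abs_zonalOp_sub_le hn cg hδ, self_mem_nhdsWithin] with t h1 ht
  have cZ : Continuous (zonalOp (pK (n / 2) t) g) :=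
    continuous_zonalOp (slice_continuousOn (continuousOn_pK _) ht) cg
  rw [Real.dist_eq, ← avg_sub (by fun_prop) (by fun_prop)]
  calc |avg fun x => G x * zonalOp (pK (n / 2) t) g x - G x * g x|
      ≤ avg fun x => |G x * zonalOp (pK (n / 2) t) g x - G x * g x| := abs_avg_le _
    _ ≤ avg fun x => |G x| * δ := by
        refine avg_mono (by fun_prop) (by fun_prop) fun x => ?_
        rw [← mul_sub, abs_mul]
        exact mul_le_mul_of_nonneg_left (h1 x) (abs_nonneg _)
    _ = avg (fun x => |G x|) * δ := avg_mul_const _ _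
    _ ≤ ε / 2 := by
        simp only [δ]
        rw [mul_div_assoc', div_le_div_iff₀ (by positivity) (by norm_num)]
        nlinarith
    _ < ε := by linarith

end approximation

section consequences

variable {n : ℕ} [NeZero n]

/-- A function whose Poisson extension dominates the radial derivative of that of `g` has its
negative part controlled by the tangential gradient of `g`. -/
theorem avg_negPart_sq_le (hn : 3 ≤ n) {g v : USphere n → ℝ}
    {g₁ g₂ : Fin n × Fin n → USphere n → ℝ} (hg : ∀ q, HasRot q g (g₁ q))
    (hg₁ : ∀ q, HasRot q (g₁ q) (g₂ q)) (cg : Continuous g) (cg₁ : ∀ q, Continuous (g₁ q))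
    (cg₂ : ∀ q, Continuous (g₂ q)) (cv : Continuous v)
    (h : ∀ t < 0, ∀ η, zonalOp (pKt (n / 2) t) g η ≤ zonalOp (pK (n / 2) t) v η) :
    avg (fun x => max (-v x) 0 ^ 2) ≤ (1 / 2) * ∑ q, avg (fun x => g₁ q x ^ 2) := by
  set ζ : USphere n → ℝ := fun x => max (-v x) 0 with hζ
  have cζ : Continuous ζ := by fun_prop
  set T := (1 / 2) * ∑ q, avg (fun x => g₁ q x ^ 2) with hT
  set Y := avg (fun x => ζ x ^ 2) with hY
  have hY0 : 0 ≤ Y := avg_nonneg fun x => sq_nonneg _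
  have hT0 : 0 ≤ T := by
    have := Finset.sum_nonneg fun q (_ : q ∈ Finset.univ) =>
      (avg_nonneg fun x => sq_nonneg (g₁ q x))
    positivity
  have hlim := tendsto_avg_mul_zonalOp hn cv cζ
  have e : avg (fun η => ζ η * v η) = -Y := by
    rw [hY, ← avg_neg]
    congr 1; ext x
    simp only [hζ]
    rcases le_total (-v x) 0 with h | h
    · rw [max_eq_right h]; ring
    · rw [max_eq_left h]; ring
  rw [e] at hlim
  have key : -√(Y * T) ≤ -Y := by
    refine ge_of_tendsto hlim ?_
    filter_upwards [self_mem_nhdsWithin] with t ht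
    have ht : t < 0 := ht
    have c1 : Continuous (zonalOp (pKt (n / 2) t) g) :=
      continuous_zonalOp (slice_continuousOn (continuousOn_pKt _) ht) cg
    have c2 : Continuous (zonalOp (pK (n / 2) t) v) :=
      continuous_zonalOp (slice_continuousOn (continuousOn_pK _) ht) cv
    have h1 : avg (fun η => ζ η * zonalOp (pKt (n / 2) t) g η) ≤
        avg (fun η => ζ η * zonalOp (pK (n / 2) t) v η) :=
      avg_mono (by fun_prop) (by fun_prop) fun x =>
        mul_le_mul_of_nonneg_left (h t ht x) (le_max_right _ _)
    have h2 := sq_avg_mul_le cζ c1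
    have h3 := avg_zonalOp_pKt_sq_le hn ht hg hg₁ cg cg₁ cg₂
    have h4 : |avg (fun η => ζ η * zonalOp (pKt (n / 2) t) g η)| ≤ √(Y * T) :=
      Real.abs_le_sqrt (h2.trans (mul_le_mul_of_nonneg_left h3 hY0))
    exact (abs_le.1 h4).1.trans h1
  have h5 : Y ≤ √(Y * T) := by linarith
  have h6 : Y ^ 2 ≤ Y * T := (Real.le_sqrt hY0 (by positivity)).1 h5
  by_contra! hlt
  nlinarith

/-- A uniform lower bound for the Poisson kernel at a fixed radius. -/
theorem exists_pK_lower (ν : ℝ) (hν : 0 < ν) :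
    ∃ c₀ > 0, ∀ c ∈ Icc (-1 : ℝ) 1, c₀ ≤ pK ν (-1) c := by
  have ht : (-1 : ℝ) < 0 := by norm_num
  refine ⟨(1 - Real.exp (-1) ^ 2) * ((1 + Real.exp (-1)) ^ 2) ^ (-ν), ?_, fun c hc => ?_⟩
  · exact mul_pos (one_sub_exp_sq_pos ht) (Real.rpow_pos_of_pos (by positivity) _)
  · exact mul_le_mul_of_nonneg_left (Real.rpow_le_rpow_of_nonpos (pA_pos ht hc) (pA_upper hc)
      (by linarith)) (one_sub_exp_sq_pos ht).le

theorem avg_mul_zonalOp_le (hn : 3 ≤ n) {c₀ : ℝ}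
    (hc₀ : ∀ c ∈ Icc (-1 : ℝ) 1, c₀ ≤ pK (n / 2) (-1) c)
    {w : USphere n → ℝ} (cw : Continuous w) (hw : avg w = 0) :
    avg (fun η => w η * zonalOp (pK (n / 2) (-1)) w η) ≤ (1 - c₀) * avg (fun x => w x ^ 2) := by
  have ht : (-1 : ℝ) < 0 := by norm_num
  have cκ := slice_continuousOn (continuousOn_pK ((n : ℝ) / 2)) ht
  set W := avg (fun x => w x ^ 2)
  have cκ' : ContinuousOn (fun c => pK (n / 2) (-1) c) (Icc (-1 : ℝ) 1) := cκ
  have step : ∀ η, w η * zonalOp (pK (n / 2) (-1)) w η ≤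
      (1 / 2) * zonalOp (pK (n / 2) (-1)) (fun x => w x ^ 2) η +
        ((1 / 2) * w η ^ 2 - c₀ / 2 * (W + w η ^ 2)) := by
    intro η
    have cK : Continuous fun x => pK (n / 2) (-1) (sdot x η) :=
      continuous_zonal cκ continuous_id continuous_const
    have c1 : Continuous fun x => (pK (n / 2) (-1) (sdot x η) - c₀) * (w x - w η) ^ 2 :=
      (cK.sub continuous_const).mul ((cw.sub continuous_const).pow 2)
    have h0 : 0 ≤ avg fun x => (pK (n / 2) (-1) (sdot x η) - c₀) * (w x - w η) ^ 2 :=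
      avg_nonneg fun x => mul_nonneg (sub_nonneg.2 (hc₀ _ (sdot_mem _ _))) (sq_nonneg _)
    have e : (fun x => (pK (n / 2) (-1) (sdot x η) - c₀) * (w x - w η) ^ 2) = fun x =>
        (pK (n / 2) (-1) (sdot x η) * w x ^ 2 + ((-2 * w η) * (pK (n / 2) (-1) (sdot x η) * w x) +
          w η ^ 2 * pK (n / 2) (-1) (sdot x η))) +
        ((-c₀) * w x ^ 2 + ((2 * c₀ * w η) * w x + (-c₀ * w η ^ 2))) := by
      ext x; ring
    have d1 : Continuous fun x => pK (n / 2) (-1) (sdot x η) * w x ^ 2 := cK.mul (cw.pow 2)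
    have d2 : Continuous fun x => (-2 * w η) * (pK (n / 2) (-1) (sdot x η) * w x) :=
      continuous_const.mul (cK.mul cw)
    have d3 : Continuous fun x => w η ^ 2 * pK (n / 2) (-1) (sdot x η) := continuous_const.mul cK
    have d4 : Continuous fun x => (-2 * w η) * (pK (n / 2) (-1) (sdot x η) * w x) +
          w η ^ 2 * pK (n / 2) (-1) (sdot x η) := d2.add d3
    have d5 : Continuous fun x => pK (n / 2) (-1) (sdot x η) * w x ^ 2 +
          ((-2 * w η) * (pK (n / 2) (-1) (sdot x η) * w x) +
          w η ^ 2 * pK (n / 2) (-1) (sdot x η)) := d1.add d4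
    rw [e, avg_add d5 (by fun_prop), avg_add d1 d4, avg_add d2 d3, avg_add (by fun_prop)
      (by fun_prop), avg_add (by fun_prop) (by fun_prop)] at h0
    simp only [avg_const_mul] at h0
    rw [avg_pK hn ht, hw, avg_const] at h0
    change 0 ≤ zonalOp (pK (n / 2) (-1)) (fun x => w x ^ 2) η +
      (-2 * w η * zonalOp (pK (n / 2) (-1)) w η + w η ^ 2 * 1) + (-c₀ * W + _) at h0
    nlinarith
  have cZ := continuous_zonalOp cκ cw
  have cZ2 : Continuous (zonalOp (pK (n / 2) (-1)) (fun x => w x ^ 2)) :=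
    continuous_zonalOp cκ (cw.pow 2)
  have hmass : avg (zonalOp (pK (n / 2) (-1)) (fun x => w x ^ 2)) = W := by
    have cF : Continuous fun z : USphere n × USphere n =>
        pK (n / 2) (-1) (sdot z.2 z.1) * w z.2 ^ 2 :=
      (continuous_zonal cκ continuous_snd continuous_fst).mul ((cw.comp continuous_snd).pow 2)
    have := avg_comm (F := fun η x => pK (n / 2) (-1) (sdot x η) * w x ^ 2) cF
    change avg (fun η => avg fun x => pK (n / 2) (-1) (sdot x η) * w x ^ 2) = W
    rw [this]
    congr 1; ext x
    rw [avg_mul_const]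
    simp only [sdot_comm x]
    rw [avg_pK hn ht, one_mul]
  refine (avg_mono (by fun_prop) (by fun_prop) step).trans (le_of_eq ?_)
  rw [avg_add (by fun_prop) (by fun_prop), avg_sub (by fun_prop) (by fun_prop), avg_const_mul,
    avg_const_mul, avg_const_mul, avg_add (by fun_prop) (by fun_prop), avg_const]
  change 1 / 2 * avg (zonalOp (pK (n / 2) (-1)) (fun x => w x ^ 2)) +
    (1 / 2 * W - c₀ / 2 * (W + W)) = _
  rw [hmass]
  ring

variable (n) in
/-- The Poincaré inequality on the sphere. -/
theorem exists_poincare (hn : 3 ≤ n) : ∃ C > 0, ∀ {w : USphere n → ℝ}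
    {g₁ g₂ : Fin n × Fin n → USphere n → ℝ}, (∀ q, HasRot q w (g₁ q)) →
    (∀ q, HasRot q (g₁ q) (g₂ q)) → Continuous w → (∀ q, Continuous (g₁ q)) →
    (∀ q, Continuous (g₂ q)) → avg w = 0 →
    avg (fun x => w x ^ 2) ≤ C * ((1 / 2) * ∑ q, avg (fun x => g₁ q x ^ 2)) := by
  obtain ⟨c₀, hc₀, hc⟩ := exists_pK_lower ((n : ℝ) / 2) half_natCast_pos
  refine ⟨1 / c₀ ^ 2, by positivity, ?_⟩
  intro w g₁ g₂ hg hg₁ cw cg₁ cg₂ hw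
  set T := (1 / 2) * ∑ q, avg (fun x => g₁ q x ^ 2) with hT
  set W := avg (fun x => w x ^ 2) with hW
  have hW0 : 0 ≤ W := avg_nonneg fun x => sq_nonneg _
  have hT0 : 0 ≤ T := by
    have := Finset.sum_nonneg fun q (_ : q ∈ Finset.univ) =>
      (avg_nonneg fun x => sq_nonneg (g₁ q x))
    positivity
  have cκ := continuousOn_pK ((n : ℝ) / 2)
  have cκt := continuousOn_pKt ((n : ℝ) / 2)
  set m : ℝ → ℝ := fun t => avg (fun η => w η * zonalOp (pK (n / 2) t) w η) with hm
  have dm : ∀ t < 0, HasDerivAt m (avg fun η => w η * zonalOp (pKt (n / 2) t) w η) t := by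
    intro t ht
    exact hasDerivAt_avg (F := fun t η => w η * zonalOp (pK (n / 2) t) w η)
      (F' := fun t η => w η * zonalOp (pKt (n / 2) t) w η) isOpen_Iio
      (fun t ht => cw.mul (continuous_zonalOp (slice_continuousOn cκ ht) cw))
      ((cw.comp continuous_snd).continuousOn.mul (continuousOn_zonalOp cκt cw))
      (fun t ht η => (hasDerivAt_zonalOp cκ cκt (fun t ht c hc => hasDerivAt_pK _ ht hc) cw η
        ht).const_mul _) ht
  have bm : ∀ t < 0, |avg fun η => w η * zonalOp (pKt (n / 2) t) w η| ≤ √(W * T) := by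
    intro t ht
    have c1 := continuous_zonalOp (slice_continuousOn cκt ht) cw
    exact Real.abs_le_sqrt ((sq_avg_mul_le cw c1).trans (mul_le_mul_of_nonneg_left
      (avg_zonalOp_pKt_sq_le hn ht hg hg₁ cw cg₁ cg₂) hW0))
  have hlim : Tendsto m (nhdsWithin 0 (Iio (0 : ℝ))) (nhds W) := by
    have := tendsto_avg_mul_zonalOp hn cw cw
    have e : avg (fun η => w η * w η) = W := by
      rw [hW]; congr 1; ext x; ring
    rwa [e] at this
  have hmv : W ≤ m (-1) + √(W * T) := by
    refine le_of_tendsto hlim ?_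
    filter_upwards [Ioo_mem_nhdsLT (show (-1 : ℝ) < 0 by norm_num)] with t ht
    have := (convex_Iio (0 : ℝ)).norm_image_sub_le_of_norm_hasDerivWithin_le (f := m)
      (C := √(W * T)) (x := -1) (y := t) (fun u hu => (dm u hu).hasDerivWithinAt)
      (fun u hu => bm u hu) (show (-1 : ℝ) < 0 by norm_num) ht.2
    rw [Real.norm_eq_abs, Real.norm_eq_abs] at this
    have h1 := (abs_le.1 this).2
    have h2 : |t - -1| ≤ 1 := abs_le.2 ⟨by linarith [ht.1], by linarith [ht.2]⟩
    nlinarith [Real.sqrt_nonneg (W * T)]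
  have h1 := avg_mul_zonalOp_le hn hc cw hw
  have h2 : c₀ * W ≤ √(W * T) := by
    change m (-1) ≤ (1 - c₀) * W at h1
    linarith
  have h3 : (c₀ * W) ^ 2 ≤ W * T := (Real.le_sqrt (by positivity) (by positivity)).1 h2
  rw [div_mul_eq_mul_div, one_mul, le_div_iff₀ (by positivity)]
  by_contra! hlt
  have hWpos : 0 < W := by
    rcases hW0.lt_or_eq with h | h
    · exact h
    · rw [← h] at hlt; linarith
  nlinarith

end consequences

/-- A function on the cylinder `ℝ × Sⁿ⁻¹` together with its continuous first and second
derivatives in the axial and in the rotational directions. -/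
structure CylFun (n : ℕ) where
  /-- the function -/
  y : ℝ → USphere n → ℝ
  /-- its axial derivative -/
  yt : ℝ → USphere n → ℝ
  /-- its second axial derivative -/
  ytt : ℝ → USphere n → ℝ
  /-- its rotational derivatives -/
  y₁ : Fin n × Fin n → ℝ → USphere n → ℝ
  /-- its second rotational derivatives -/
  y₂ : Fin n × Fin n → ℝ → USphere n → ℝ
  cont_y : Continuous fun z : ℝ × USphere n => y z.1 z.2
  cont_yt : Continuous fun z : ℝ × USphere n => yt z.1 z.2
  cont_ytt : Continuous fun z : ℝ × USphere n => ytt z.1 z.2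
  cont_y₁ : ∀ q, Continuous fun z : ℝ × USphere n => y₁ q z.1 z.2
  cont_y₂ : ∀ q, Continuous fun z : ℝ × USphere n => y₂ q z.1 z.2
  hasDerivAt_y : ∀ t x, HasDerivAt (fun t => y t x) (yt t x) t
  hasDerivAt_yt : ∀ t x, HasDerivAt (fun t => yt t x) (ytt t x) t
  hasRot_y : ∀ q t, HasRot q (y t) (y₁ q t)
  hasRot_y₁ : ∀ q t, HasRot q (y₁ q t) (y₂ q t)

namespace CylFun

variable {n : ℕ} (D : CylFun n)

/-- The spherical Laplacian. -/
noncomputable def lap (t : ℝ) (x : USphere n) : ℝ := (1 / 2) * ∑ q, D.y₂ q t x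

/-- The squared length of the spherical gradient. -/
noncomputable def tang (t : ℝ) (x : USphere n) : ℝ := (1 / 2) * ∑ q, D.y₁ q t x ^ 2

/-- The Euclidean Laplacian, rescaled by the squared radius. -/
noncomputable def elap (t : ℝ) (x : USphere n) : ℝ := D.ytt t x + (n - 2) * D.yt t x + D.lap t x

theorem cont_lap : Continuous fun z : ℝ × USphere n => D.lap z.1 z.2 :=
  continuous_const.mul (continuous_finsetSum _ fun q _ => D.cont_y₂ q)

theorem cont_tang : Continuous fun z : ℝ × USphere n => D.tang z.1 z.2 :=
  continuous_const.mul (continuous_finsetSum _ fun q _ => (D.cont_y₁ q).pow 2)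

theorem cont_elap : Continuous fun z : ℝ × USphere n => D.elap z.1 z.2 :=
  (D.cont_ytt.add (continuous_const.mul D.cont_yt)).add D.cont_lap

theorem slice {f : ℝ → USphere n → ℝ} (hf : Continuous fun z : ℝ × USphere n => f z.1 z.2)
    (t : ℝ) : Continuous (f t) :=
  hf.comp (by fun_prop : Continuous fun x : USphere n => (t, x))

theorem tang_nonneg (t : ℝ) (x : USphere n) : 0 ≤ D.tang t x :=
  mul_nonneg (by norm_num) (Finset.sum_nonneg fun _ _ => sq_nonneg _)

variable [NeZero n]

theorem avg_tang (t : ℝ) : avg (D.tang t) = (1 / 2) * ∑ q, avg fun x => D.y₁ q t x ^ 2 := by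
  rw [← avg_sum (F := fun q x => D.y₁ q t x ^ 2) _ (fun q => (slice (D.cont_y₁ q) t).pow 2),
    ← avg_const_mul]
  rfl

end CylFun

theorem exists_pK_bound {ν : ℝ} (hν : 0 < ν) {r : ℝ} (hr : r < 0) :
    ∃ C > 0, ∀ s ≤ r, ∀ c ∈ Icc (-1 : ℝ) 1, |pK ν s c| ≤ C ∧ |pKt ν s c| ≤ C := by
  have hr1 : Real.exp r < 1 := by simpa using hr
  have ha : 0 < (1 - Real.exp r) ^ 2 := by nlinarith
  set a := (1 - Real.exp r) ^ 2 with ha'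
  have ha1 := Real.rpow_pos_of_pos ha (-ν)
  have ha2 := Real.rpow_pos_of_pos ha (-ν - 1)
  refine ⟨2 * a ^ (-ν) + ν * 4 * a ^ (-ν - 1), by positivity, fun s hs c hc => ?_⟩
  have hs1 : Real.exp s ≤ Real.exp r := Real.exp_le_exp.2 hs
  have hs0 := Real.exp_pos s
  have hA : a ≤ pA s c := by
    refine le_trans ?_ (pA_lower hc)
    rw [ha']
    exact pow_le_pow_left₀ (by linarith) (by linarith) 2
  have b1 : pA s c ^ (-ν) ≤ a ^ (-ν) := Real.rpow_le_rpow_of_nonpos ha hA (by linarith)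
  have b2 : pA s c ^ (-ν - 1) ≤ a ^ (-ν - 1) := Real.rpow_le_rpow_of_nonpos ha hA (by linarith)
  have p1 : 0 ≤ pA s c ^ (-ν) := Real.rpow_nonneg (ha.le.trans hA) _
  have p2 : 0 ≤ pA s c ^ (-ν - 1) := Real.rpow_nonneg (ha.le.trans hA) _
  have hB : |1 - Real.exp s ^ 2| ≤ 1 := abs_le.2 ⟨by nlinarith, by nlinarith⟩
  have hd : |pA s c - (1 - Real.exp s ^ 2)| ≤ 4 := by
    have : pA s c - (1 - Real.exp s ^ 2) = 2 * Real.exp s * (Real.exp s - c) := by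
      unfold pA; ring
    rw [this, abs_mul, abs_of_pos (by positivity)]
    have : |Real.exp s - c| ≤ 2 := abs_le.2 ⟨by linarith [hc.2], by linarith [hc.1]⟩
    nlinarith [abs_nonneg (Real.exp s - c)]
  constructor
  · unfold pK
    rw [abs_mul, abs_of_nonneg p1]
    have := mul_le_mul hB b1 p1 zero_le_one
    have : 0 < ν * 4 * a ^ (-ν - 1) := by positivity
    linarith
  · unfold pKt
    refine (abs_sub _ _).trans (add_le_add ?_ ?_)
    · rw [abs_mul, abs_of_nonneg p1, abs_mul, abs_of_pos (by positivity : 0 < Real.exp s ^ 2)]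
      have : |(-2 : ℝ)| = 2 := by norm_num
      rw [this]
      exact mul_le_mul (by nlinarith) b1 p1 (by norm_num)
    · rw [abs_mul, abs_mul, abs_mul, abs_of_nonneg p2, abs_of_pos hν]
      calc ν * |1 - Real.exp s ^ 2| * |pA s c - (1 - Real.exp s ^ 2)| * pA s c ^ (-ν - 1)
          ≤ ν * 1 * 4 * a ^ (-ν - 1) := by gcongr
        _ = _ := by ring

namespace CylFun

variable {n : ℕ} [NeZero n] (D : CylFun n)

/-- Comparison of a subharmonic function with the Poisson extension of its boundary values. -/
theorem zonalOp_pKt_le (hsub : ∀ t ≤ 0, ∀ x, 0 ≤ D.elap t x)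
    (hgrowth : ∀ ε > 0, ∃ t ≤ 0, Real.exp ((n - 2) * t) *
      (avg (fun x => |D.y t x|) + avg (fun x => |D.yt t x|)) ≤ ε)
    {r : ℝ} (hr : r < 0) (η : USphere n) :
    zonalOp (pKt (n / 2) r) (D.y 0) η ≤ zonalOp (pK (n / 2) r) (D.yt 0) η := by
  set ν : ℝ := (n : ℝ) / 2 with hν
  have hν0 : 0 < ν := half_natCast_pos
  set I : Set ℝ := Iio (-r) with hI
  have comp : ∀ {K : ℝ → ℝ → ℝ},
      ContinuousOn (fun z : ℝ × ℝ => K z.1 z.2) (Iio 0 ×ˢ Icc (-1) 1) →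
      ContinuousOn (fun z : ℝ × USphere n => K (z.1 + r) (sdot z.2 η)) (I ×ˢ univ) := by
    intro K hK
    refine hK.comp (f := fun z : ℝ × USphere n => (z.1 + r, sdot z.2 η))
      (Continuous.continuousOn (by fun_prop)) fun z hz => ⟨?_, sdot_mem _ _⟩
    have : z.1 < -r := hz.1
    change z.1 + r < 0
    linarith
  have sl : ∀ {K : ℝ → ℝ → ℝ},
      ContinuousOn (fun z : ℝ × ℝ => K z.1 z.2) (Iio 0 ×ˢ Icc (-1) 1) → ∀ t ∈ I,
      Continuous (fun x : USphere n => K (t + r) (sdot x η)) := by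
    intro K hK t ht
    have ht : t < -r := ht
    exact continuous_zonal (slice_continuousOn hK (by linarith)) continuous_id continuous_const
  have cκ := continuousOn_pK ν
  have cκt := continuousOn_pKt ν
  have cκtt := continuousOn_pKtt ν
  set N : ℝ → ℝ := fun t => avg fun x =>
    pKt ν (t + r) (sdot x η) * D.y t x - pK ν (t + r) (sdot x η) * D.yt t x with hN
  have dN : ∀ t ∈ I, HasDerivAt N (avg fun x =>
      pKtt ν (t + r) (sdot x η) * D.y t x - pK ν (t + r) (sdot x η) * D.ytt t x) t := by
    intro t ht
    refine hasDerivAt_avg (F := fun t x =>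
        pKt ν (t + r) (sdot x η) * D.y t x - pK ν (t + r) (sdot x η) * D.yt t x)
      (F' := fun t x => pKtt ν (t + r) (sdot x η) * D.y t x -
        pK ν (t + r) (sdot x η) * D.ytt t x) isOpen_Iio
      (fun t ht => ((sl cκt t ht).mul (slice D.cont_y t)).sub
        ((sl cκ t ht).mul (slice D.cont_yt t)))
      (((comp cκtt).mul D.cont_y.continuousOn).sub ((comp cκ).mul D.cont_ytt.continuousOn))
      (fun t ht x => ?_) ht
    have ht : t < -r := ht
    have ht' : t + r < 0 := by linarith
    have h1 : HasDerivAt (fun t => pKt ν (t + r) (sdot x η)) (pKtt ν (t + r) (sdot x η)) t :=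
      (hasDerivAt_pKt ν ht' (sdot_mem x η)).comp_add_const t r
    have h2 : HasDerivAt (fun t => pK ν (t + r) (sdot x η)) (pKt ν (t + r) (sdot x η)) t :=
      (hasDerivAt_pK ν ht' (sdot_mem x η)).comp_add_const t r
    refine ((h1.mul (D.hasDerivAt_y t x)).sub (h2.mul (D.hasDerivAt_yt t x))).congr_deriv ?_
    ring
  set M : ℝ → ℝ := fun t => Real.exp ((n - 2) * t) * N t with hM
  have dM : ∀ t ∈ I, HasDerivAt M (-(Real.exp ((n - 2) * t) *
      avg fun x => pK ν (t + r) (sdot x η) * D.elap t x)) t := by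
    intro t ht
    have ht0 : t < -r := ht
    have ht' : t + r < 0 := by linarith
    have he : HasDerivAt (fun t : ℝ => Real.exp ((n - 2) * t))
        (Real.exp ((n - 2) * t) * ((n - 2) * 1)) t :=
      ((hasDerivAt_id t).const_mul ((n : ℝ) - 2)).exp
    refine (he.mul (dN t ht)).congr_deriv ?_
    have harm := zonalOp_laplacian ht' η (fun q => D.hasRot_y q t) (fun q => D.hasRot_y₁ q t)
      (slice D.cont_y t) (fun q => slice (D.cont_y₁ q) t) (fun q => slice (D.cont_y₂ q) t)
    have c0 := sl cκ t ht
    have c1 := sl cκt t ht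
    have c2 := sl cκtt t ht
    have cy := slice D.cont_y t
    have cyt := slice D.cont_yt t
    have cytt := slice D.cont_ytt t
    have clap := slice D.cont_lap t
    have e0 : (1 / 2) * ∑ q, zonalOp (pK ν (t + r)) (D.y₂ q t) η =
        avg fun x => pK ν (t + r) (sdot x η) * D.lap t x := by
      unfold zonalOp
      rw [← avg_sum (F := fun q x => pK ν (t + r) (sdot x η) * D.y₂ q t x) _
        (fun q => c0.mul (slice (D.cont_y₂ q) t)), ← avg_const_mul]
      congr 1; ext x; rw [← Finset.mul_sum, lap]; ring
    rw [e0] at harm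
    have e1 : (avg fun x => pK ν (t + r) (sdot x η) * D.elap t x) =
        (avg fun x => pK ν (t + r) (sdot x η) * D.ytt t x) +
        ((n - 2) * (avg fun x => pK ν (t + r) (sdot x η) * D.yt t x) +
        avg fun x => pK ν (t + r) (sdot x η) * D.lap t x) := by
      have f1 : Continuous fun x => pK ν (t + r) (sdot x η) * D.ytt t x := c0.mul cytt
      have f2 : Continuous fun x => (n - 2 : ℝ) * (pK ν (t + r) (sdot x η) * D.yt t x) :=
        continuous_const.mul (c0.mul cyt)
      have f3 : Continuous fun x => pK ν (t + r) (sdot x η) * D.lap t x := c0.mul clap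
      have f4 : Continuous fun x => (n - 2 : ℝ) * (pK ν (t + r) (sdot x η) * D.yt t x) +
        pK ν (t + r) (sdot x η) * D.lap t x := f2.add f3
      rw [← avg_const_mul, ← avg_add f2 f3, ← avg_add f1 f4]
      congr 1; ext x; rw [elap]; ring
    have e2 : (avg fun x => pKtt ν (t + r) (sdot x η) * D.y t x -
        pK ν (t + r) (sdot x η) * D.ytt t x) = zonalOp (pKtt ν (t + r)) (D.y t) η -
        avg fun x => pK ν (t + r) (sdot x η) * D.ytt t x :=
      avg_sub (c2.mul cy) (c0.mul cytt)
    have e3 : N t = zonalOp (pKt ν (t + r)) (D.y t) η -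
        avg fun x => pK ν (t + r) (sdot x η) * D.yt t x :=
      avg_sub (c1.mul cy) (c0.mul cyt)
    rw [e1, e2, e3, harm]
    ring
  have h0I : (0 : ℝ) ∈ I := by simpa [hI] using hr
  have hsubI : Iic (0 : ℝ) ⊆ I := fun t ht =>
    lt_of_le_of_lt (show t ≤ 0 from ht) (show (0 : ℝ) < -r from h0I)
  have anti : AntitoneOn M (Iic 0) := by
    refine antitoneOn_of_deriv_nonpos (convex_Iic 0)
      (fun t ht => (dM t (hsubI ht)).continuousAt.continuousWithinAt)
      (fun t ht => (dM t (hsubI (interior_subset ht))).differentiableAt.differentiableWithinAt)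
      (fun t ht => ?_)
    have ht := interior_subset ht
    rw [(dM t (hsubI ht)).deriv]
    refine neg_nonpos.2 (mul_nonneg (Real.exp_pos _).le (avg_nonneg fun x => ?_))
    have ht' : t ≤ 0 := ht
    exact mul_nonneg (pK_pos ν (by linarith) (sdot_mem _ _)).le (hsub t ht' x)
  obtain ⟨C, hC0, hC⟩ := exists_pK_bound hν0 hr
  have hMle : ∀ t ≤ 0, M t ≤ C * (Real.exp ((n - 2) * t) *
      (avg (fun x => |D.y t x|) + avg (fun x => |D.yt t x|))) := by
    intro t ht
    have cy := slice D.cont_y t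
    have cyt := slice D.cont_yt t
    have c3 : Continuous fun x => pKt ν (t + r) (sdot x η) * D.y t x -
        pK ν (t + r) (sdot x η) * D.yt t x :=
      ((sl cκt t (hsubI ht)).mul cy).sub ((sl cκ t (hsubI ht)).mul cyt)
    have h1 : N t ≤ avg (fun x => C * (|D.y t x| + |D.yt t x|)) := by
      refine avg_mono c3 (by fun_prop) fun x => ?_
      obtain ⟨k1, k2⟩ := hC (t + r) (by linarith) _ (sdot_mem x η)
      have a1 := mul_le_mul_of_nonneg_right k2 (abs_nonneg (D.y t x))
      have a2 := mul_le_mul_of_nonneg_right k1 (abs_nonneg (D.yt t x))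
      rw [← abs_mul] at a1 a2
      linarith [le_abs_self (pKt ν (t + r) (sdot x η) * D.y t x),
        neg_abs_le (pK ν (t + r) (sdot x η) * D.yt t x)]
    rw [avg_const_mul, avg_add (by fun_prop) (by fun_prop)] at h1
    calc M t ≤ Real.exp ((n - 2) * t) *
        (C * (avg (fun x => |D.y t x|) + avg (fun x => |D.yt t x|))) :=
          mul_le_mul_of_nonneg_left h1 (Real.exp_pos _).le
      _ = _ := by ring
  have hM0 : M 0 ≤ 0 := by
    refine le_of_forall_pos_le_add fun ε hε => ?_
    obtain ⟨t, ht, hle⟩ := hgrowth (ε / C) (by positivity)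
    calc M 0 ≤ M t := anti ht (mem_Iic.2 le_rfl) ht
      _ ≤ C * (ε / C) := (hMle t ht).trans (mul_le_mul_of_nonneg_left hle hC0.le)
      _ = 0 + ε := by field_simp; ring
  have e3 : N 0 = zonalOp (pKt ν (0 + r)) (D.y 0) η -
      zonalOp (pK ν (0 + r)) (D.yt 0) η :=
    avg_sub ((sl cκt 0 h0I).mul (slice D.cont_y 0)) ((sl cκ 0 h0I).mul (slice D.cont_yt 0))
  simp only [hM, mul_zero, Real.exp_zero, one_mul, e3, zero_add] at hM0
  linarith

/-- The negative part of the radial derivative of a subharmonic function is controlled by its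
tangential gradient. -/
theorem avg_negPart_yt_sq_le (hn : 3 ≤ n) (hsub : ∀ t ≤ 0, ∀ x, 0 ≤ D.elap t x)
    (hgrowth : ∀ ε > 0, ∃ t ≤ 0, Real.exp ((n - 2) * t) *
      (avg (fun x => |D.y t x|) + avg (fun x => |D.yt t x|)) ≤ ε) :
    avg (fun x => max (-D.yt 0 x) 0 ^ 2) ≤ avg (D.tang 0) := by
  rw [avg_tang]
  exact avg_negPart_sq_le hn (fun q => D.hasRot_y q 0) (fun q => D.hasRot_y₁ q 0)
    (slice D.cont_y 0) (fun q => slice (D.cont_y₁ q) 0) (fun q => slice (D.cont_y₂ q) 0)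
    (slice D.cont_yt 0) fun t ht η => D.zonalOp_pKt_le hsub hgrowth ht η

/-- Translation along the axis of the cylinder. -/
def shift (a : ℝ) : CylFun n where
  y t x := D.y (t + a) x
  yt t x := D.yt (t + a) x
  ytt t x := D.ytt (t + a) x
  y₁ q t x := D.y₁ q (t + a) x
  y₂ q t x := D.y₂ q (t + a) x
  cont_y := D.cont_y.comp (by fun_prop : Continuous fun z : ℝ × USphere n => (z.1 + a, z.2))
  cont_yt := D.cont_yt.comp (by fun_prop : Continuous fun z : ℝ × USphere n => (z.1 + a, z.2))
  cont_ytt := D.cont_ytt.comp (by fun_prop : Continuous fun z : ℝ × USphere n => (z.1 + a, z.2))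
  cont_y₁ q := (D.cont_y₁ q).comp
    (by fun_prop : Continuous fun z : ℝ × USphere n => (z.1 + a, z.2))
  cont_y₂ q := (D.cont_y₂ q).comp
    (by fun_prop : Continuous fun z : ℝ × USphere n => (z.1 + a, z.2))
  hasDerivAt_y t x := (D.hasDerivAt_y (t + a) x).comp_add_const t a
  hasDerivAt_yt t x := (D.hasDerivAt_yt (t + a) x).comp_add_const t a
  hasRot_y q t := D.hasRot_y q (t + a)
  hasRot_y₁ q t := D.hasRot_y₁ q (t + a)

/-- Reflection of the cylinder, corresponding to the Kelvin inversion of the conformal factor. -/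
def reflect (a : ℝ) : CylFun n where
  y t x := D.y (a - t) x + 2 * t
  yt t x := 2 - D.yt (a - t) x
  ytt t x := D.ytt (a - t) x
  y₁ q t x := D.y₁ q (a - t) x
  y₂ q t x := D.y₂ q (a - t) x
  cont_y := (D.cont_y.comp (by fun_prop : Continuous fun z : ℝ × USphere n => (a - z.1, z.2))).add
    (by fun_prop)
  cont_yt := continuous_const.sub
    (D.cont_yt.comp (by fun_prop : Continuous fun z : ℝ × USphere n => (a - z.1, z.2)))
  cont_ytt := D.cont_ytt.comp (by fun_prop : Continuous fun z : ℝ × USphere n => (a - z.1, z.2))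
  cont_y₁ q := (D.cont_y₁ q).comp
    (by fun_prop : Continuous fun z : ℝ × USphere n => (a - z.1, z.2))
  cont_y₂ q := (D.cont_y₂ q).comp
    (by fun_prop : Continuous fun z : ℝ × USphere n => (a - z.1, z.2))
  hasDerivAt_y t x := by
    refine (((D.hasDerivAt_y (a - t) x).comp_const_sub a t).add
      ((hasDerivAt_id t).const_mul 2)).congr_deriv ?_
    ring
  hasDerivAt_yt t x := by
    refine (((D.hasDerivAt_yt (a - t) x).comp_const_sub a t).const_sub 2).congr_deriv ?_
    ring
  hasRot_y q t := (D.hasRot_y q (a - t)).add_const _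
  hasRot_y₁ q t := D.hasRot_y₁ q (a - t)

end CylFun

theorem nonneg_of_deriv_nonneg_of_tendsto_atBot {V V' : ℝ → ℝ} (hV : ∀ t, HasDerivAt V (V' t) t)
    (hV' : ∀ t, 0 ≤ V' t) (hlim : Tendsto V atBot (nhds 0)) : Monotone V ∧ ∀ t, 0 ≤ V t := by
  have hm : Monotone V := monotone_of_deriv_nonneg (fun t => (hV t).differentiableAt)
    fun t => (hV t).deriv ▸ hV' t
  exact ⟨hm, fun t => hm.le_of_tendsto hlim t⟩

/-- A lower bound on the derivative yields linear growth. -/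
theorem add_mul_le_of_le_deriv {S S' : ℝ → ℝ} {c a : ℝ} (hS : ∀ t, HasDerivAt S (S' t) t)
    (hS' : ∀ t ≥ a, c ≤ S' t) {t : ℝ} (ht : a ≤ t) : S a + c * (t - a) ≤ S t := by
  have := (convex_Ici a).mul_sub_le_image_sub_of_le_deriv
    (fun t _ => (hS t).continuousAt.continuousWithinAt)
    (fun t _ => (hS t).differentiableAt.differentiableWithinAt)
    (C := c) (fun t ht => (hS t).deriv ▸ hS' t (interior_subset ht)) a self_mem_Ici t ht ht
  linarith

/-- Global solutions of the Riccati inequality `V' ≥ k (V² - 2V)` with `V' ≥ 0` are at most `2`. -/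
theorem le_two_of_riccati {V V' : ℝ → ℝ} {k : ℝ} (hk : 0 < k) (hV : ∀ t, HasDerivAt V (V' t) t)
    (hm : Monotone V) (hric : ∀ t, k * (V t ^ 2 - 2 * V t) ≤ V' t) (t : ℝ) : V t ≤ 2 := by
  by_contra! h
  set a := V t with ha
  have ha0 : 0 < a := by linarith
  have hpos : ∀ s, t ≤ s → a ≤ V s := fun s hs => hm hs
  set c := k * (a - 2) / a with hc
  have hc0 : 0 < c := div_pos (mul_pos hk (by linarith)) ha0
  have hgrow : ∀ s ≥ t, c ≤ V' s / V s ^ 2 := by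
    intro s hs
    have h1 := hpos s hs
    have h2 : 0 < V s := by linarith
    rw [le_div_iff₀ (by positivity), hc, div_mul_eq_mul_div, div_le_iff₀ ha0]
    have h3 := mul_le_mul_of_nonneg_right (hric s) ha0.le
    have : k * (a - 2) * V s ^ 2 ≤ k * (V s ^ 2 - 2 * V s) * a := by
      have : 0 ≤ k * V s * (2 * (V s - a)) := by
        have : 0 ≤ V s - a := by linarith
        positivity
      nlinarith
    linarith
  have key : ∀ s, t ≤ s → -(V t)⁻¹ + c * (s - t) ≤ -(V s)⁻¹ := by
    intro s hs
    have hd : ∀ r ∈ Ici t, HasDerivAt (fun r => -(V r)⁻¹) (V' r / V r ^ 2) r := by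
      intro r hr
      have : V r ≠ 0 := by have := hpos r hr; linarith
      refine ((hV r).inv this).neg.congr_deriv ?_
      ring
    have := (convex_Ici t).mul_sub_le_image_sub_of_le_deriv (C := c)
      (fun r hr => (hd r hr).continuousAt.continuousWithinAt)
      (fun r hr => (hd r (interior_subset hr)).differentiableAt.differentiableWithinAt)
      (fun r hr => (hd r (interior_subset hr)).deriv ▸ hgrow r (interior_subset hr))
      t self_mem_Ici s hs hs
    linarith
  have h1 := key (t + a⁻¹ / c) (by have : 0 < a⁻¹ / c := by positivity
                                   linarith)
  have h2 : 0 < V (t + a⁻¹ / c) := by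
    have := hpos (t + a⁻¹ / c) (by have : 0 < a⁻¹ / c := by positivity
                                   linarith)
    linarith
  have h3 : c * (t + a⁻¹ / c - t) = a⁻¹ := by field_simp; ring
  rw [h3, ← ha] at h1
  have := inv_pos.2 h2
  linarith

/-- A monotone function with values in `[0, 2]` that is not identically zero and whose slow growth
forces `2V - V²` to be, up to its derivative, a derivative, comes close to `2`. -/
theorem exists_three_halves_le {V V' Z Z' : ℝ → ℝ} {A B : ℝ} {c : ℝ → ℝ} {a : ℝ}
    (hA : 0 < A) (hB : 0 < B)
    (hV : ∀ t, HasDerivAt V (V' t) t) (hm : Monotone V) (hV2 : ∀ t, V t ≤ 2) (ha : 0 < V a)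
    (hZ : ∀ t, HasDerivAt Z (Z' t) t) (hZle : ∀ t, |Z t| ≤ A + A * V' t)
    (hle : ∀ δ > 0, ∀ t, 2 * V t - V t ^ 2 ≤ Z' t + B * δ + c δ * V' t) :
    ∃ b, 3 / 2 ≤ V b := by
  by_contra! h
  set m := V a with hma
  have hm2 : m < 3 / 2 := h a
  have hlow : ∀ t ≥ a, m / 2 ≤ 2 * V t - V t ^ 2 := by
    intro t ht
    have h1 : m ≤ V t := hm ht
    have h2 := h t
    nlinarith
  set δ := m / (4 * B) with hδ
  have hδ0 : 0 < δ := by positivity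
  have hBδ : B * δ = m / 4 := by rw [hδ]; field_simp
  set K := c δ with hK
  have hS : ∀ t, HasDerivAt (fun t => Z t + K * V t) (Z' t + K * V' t) t :=
    fun t => (hZ t).add ((hV t).const_mul K)
  have hgrow : ∀ t, a ≤ t → (Z a + K * V a) + m / 4 * (t - a) ≤ Z t + K * V t := fun t ht =>
    add_mul_le_of_le_deriv hS (fun s hs => by
      have := hlow s hs
      have := hle δ hδ0 s
      linarith) ht
  have hbd : ∀ t, a ≤ t → |V t| ≤ 2 := fun t ht => by
    have : m ≤ V t := hm ht
    exact abs_le.2 ⟨by linarith, hV2 t⟩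
  set R := |Z a| + 4 * |K| + 2 * A with hR
  have hR0 : 0 < R := by positivity
  set b := a + R * (4 / m) with hb
  have hab : a ≤ b := by
    have : 0 < R * (4 / m) := by positivity
    linarith
  have hV1 : ∀ t ≥ b, 1 ≤ V' t := by
    intro t ht
    have hat : a ≤ t := hab.trans ht
    have h1 := hgrow t hat
    have h2 : R ≤ m / 4 * (t - a) := by
      have : m / 4 * (R * (4 / m)) ≤ m / 4 * (t - a) :=
        mul_le_mul_of_nonneg_left (by linarith) (by positivity)
      have h3 : m / 4 * (R * (4 / m)) = R := by field_simp
      linarith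
    have h3 : |K * V a| ≤ 2 * |K| := by
      rw [abs_mul]; nlinarith [hbd a le_rfl, abs_nonneg K]
    have h4 : |K * V t| ≤ 2 * |K| := by
      rw [abs_mul]; nlinarith [hbd t hat, abs_nonneg K]
    have h5 := hZle t
    have h6 : 2 * A ≤ A + A * V' t := by
      linarith [le_abs_self (Z t), le_abs_self (K * V t), neg_abs_le (K * V a), neg_abs_le (Z a)]
    nlinarith
  have h7 := add_mul_le_of_le_deriv hV hV1 (show b ≤ b + 2 by linarith)
  have h8 := hV2 (b + 2)
  have h9 : m ≤ V b := hm hab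
  linarith

theorem avg_pos {n : ℕ} [NeZero n] {F : USphere n → ℝ} (hF : Continuous F) (h0 : ∀ x, 0 ≤ F x)
    (x : USphere n) (hx : F x ≠ 0) : 0 < avg F := by
  have : (sphereProb n).IsOpenPosMeasure :=
    Measure.isOpenPosMeasure_smul _ (ENNReal.inv_ne_zero.2 (measure_ne_top _ _))
  exact integral_pos_of_integrable_nonneg_nonzero hF (integrable_sphereProb hF) h0 hx

namespace CylFun

variable {n : ℕ} [NeZero n] (D : CylFun n)

theorem hasDerivAt_avg_y (t : ℝ) : HasDerivAt (fun t => avg (D.y t)) (avg (D.yt t)) t :=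
  hasDerivAt_avg isOpen_univ (fun t _ => slice D.cont_y t) D.cont_yt.continuousOn
    (fun t _ x => D.hasDerivAt_y t x) (mem_univ t)

theorem hasDerivAt_avg_yt (t : ℝ) : HasDerivAt (fun t => avg (D.yt t)) (avg (D.ytt t)) t :=
  hasDerivAt_avg isOpen_univ (fun t _ => slice D.cont_yt t) D.cont_ytt.continuousOn
    (fun t _ x => D.hasDerivAt_yt t x) (mem_univ t)

theorem avg_lap (t : ℝ) : avg (D.lap t) = 0 := by
  have : avg (D.lap t) = (1 / 2) * ∑ q, avg (D.y₂ q t) := by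
    rw [← avg_sum _ (fun q => slice (D.cont_y₂ q) t), ← avg_const_mul]
    rfl
  rw [this, Finset.sum_eq_zero, mul_zero]
  exact fun q _ => (D.hasRot_y₁ q t).avg_eq_zero (slice (D.cont_y₁ q) t) (slice (D.cont_y₂ q) t)

theorem avg_elap (t : ℝ) : avg (D.elap t) = avg (D.ytt t) + (n - 2) * avg (D.yt t) := by
  have h1 : Continuous fun x => D.ytt t x + (n - 2) * D.yt t x :=
    (slice D.cont_ytt t).add (continuous_const.mul (slice D.cont_yt t))
  have h2 : Continuous fun x => (n - 2 : ℝ) * D.yt t x := continuous_const.mul (slice D.cont_yt t)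
  have : avg (D.elap t) = avg fun x => D.ytt t x + (n - 2) * D.yt t x + D.lap t x := rfl
  rw [this, avg_add h1 (slice D.cont_lap t), avg_add (slice D.cont_ytt t) h2, avg_const_mul,
    D.avg_lap, add_zero]

/-- The deviation from the spherical mean. -/
noncomputable def center : CylFun n where
  y t x := D.y t x + -avg (D.y t)
  yt t x := D.yt t x - avg (D.yt t)
  ytt t x := D.ytt t x - avg (D.ytt t)
  y₁ := D.y₁
  y₂ := D.y₂
  cont_y := D.cont_y.add ((continuous_avg D.cont_y).comp continuous_fst).neg
  cont_yt := D.cont_yt.sub ((continuous_avg D.cont_yt).comp continuous_fst)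
  cont_ytt := D.cont_ytt.sub ((continuous_avg D.cont_ytt).comp continuous_fst)
  cont_y₁ := D.cont_y₁
  cont_y₂ := D.cont_y₂
  hasDerivAt_y t x := (D.hasDerivAt_y t x).add (D.hasDerivAt_avg_y t).neg
  hasDerivAt_yt t x := (D.hasDerivAt_yt t x).sub (D.hasDerivAt_avg_yt t)
  hasRot_y q t := (D.hasRot_y q t).add_const _
  hasRot_y₁ := D.hasRot_y₁

theorem avg_center_y (t : ℝ) : avg (D.center.y t) = 0 := by
  have : avg (D.center.y t) = avg fun x => D.y t x + -avg (D.y t) := rfl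
  rw [this, avg_add (slice D.cont_y t) continuous_const, avg_const]
  ring

theorem avg_center_yt_sq (t : ℝ) :
    avg (fun x => D.center.yt t x ^ 2) = avg (fun x => D.yt t x ^ 2) - avg (D.yt t) ^ 2 := by
  have c := slice D.cont_yt t
  have : avg (fun x => D.center.yt t x ^ 2) = avg fun x => D.yt t x ^ 2 -
      (2 * avg (D.yt t) * D.yt t x - avg (D.yt t) ^ 2) := by
    congr 1; ext x
    change (D.yt t x - avg (D.yt t)) ^ 2 = _
    ring
  have c1 : Continuous fun x => 2 * avg (D.yt t) * D.yt t x := continuous_const.mul c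
  have c2 : Continuous fun x => D.yt t x ^ 2 := c.pow 2
  have c3 : Continuous fun x => 2 * avg (D.yt t) * D.yt t x - avg (D.yt t) ^ 2 :=
    c1.sub continuous_const
  rw [this, avg_sub c2 c3, avg_sub c1 continuous_const, avg_const_mul, avg_const]
  ring

/-- The spherical mean of `F w ∂ₜw`, where `w` is the deviation from the mean and
`F w = w / (1 + w²)`. -/
noncomputable def flux (t : ℝ) : ℝ :=
  avg fun x => D.center.y t x / (1 + D.center.y t x ^ 2) * D.center.yt t x

/-- The derivative of `flux`. -/
noncomputable def fluxDeriv (t : ℝ) : ℝ :=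
  avg fun x => (1 - D.center.y t x ^ 2) / (1 + D.center.y t x ^ 2) ^ 2 * D.center.yt t x ^ 2 +
    D.center.y t x / (1 + D.center.y t x ^ 2) * D.center.ytt t x

theorem hasDerivAt_truncation (w : ℝ) :
    HasDerivAt (fun w : ℝ => w / (1 + w ^ 2)) ((1 - w ^ 2) / (1 + w ^ 2) ^ 2) w := by
  have h : (1 + w ^ 2) ≠ 0 := by positivity
  refine ((hasDerivAt_id w).div (((hasDerivAt_id w).pow 2).const_add 1) h).congr_deriv ?_
  simp only [id, Pi.pow_apply]
  congr 1
  push_cast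
  ring

theorem continuous_truncation : Continuous fun w : ℝ => w / (1 + w ^ 2) :=
  continuous_id.div (by fun_prop) fun w => by positivity

theorem continuous_truncation_deriv : Continuous fun w : ℝ => (1 - w ^ 2) / (1 + w ^ 2) ^ 2 :=
  Continuous.div (by fun_prop) (by fun_prop) fun w => by positivity

theorem hasDerivAt_flux (t : ℝ) : HasDerivAt D.flux (D.fluxDeriv t) t := by
  have cF := continuous_truncation.comp D.center.cont_y
  have cF' := continuous_truncation_deriv.comp D.center.cont_y
  refine hasDerivAt_avg
    (F := fun t x => D.center.y t x / (1 + D.center.y t x ^ 2) * D.center.yt t x)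
    (F' := fun t x => (1 - D.center.y t x ^ 2) / (1 + D.center.y t x ^ 2) ^ 2 *
      D.center.yt t x ^ 2 + D.center.y t x / (1 + D.center.y t x ^ 2) * D.center.ytt t x)
    isOpen_univ (fun t _ => slice (f := fun t x => D.center.y t x / (1 + D.center.y t x ^ 2) *
      D.center.yt t x) (cF.mul D.center.cont_yt) t)
    ((cF'.mul (D.center.cont_yt.pow 2)).add (cF.mul D.center.cont_ytt)).continuousOn
    (fun t _ x => ?_) (mem_univ t)
  refine (((hasDerivAt_truncation _).comp t (D.center.hasDerivAt_y t x)).mul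
    (D.center.hasDerivAt_yt t x)).congr_deriv ?_
  simp only [Function.comp_apply]
  ring

/-- Green's formula on the sphere for the truncated deviation. -/
theorem avg_truncation_mul_lap (t : ℝ) :
    avg (fun x => D.center.y t x / (1 + D.center.y t x ^ 2) * D.lap t x) =
      -avg (fun x => (1 - D.center.y t x ^ 2) / (1 + D.center.y t x ^ 2) ^ 2 * D.tang t x) := by
  have cw := slice D.center.cont_y t
  have cF := continuous_truncation.comp cw
  have cF' := continuous_truncation_deriv.comp cw
  have c1 := fun q => slice (D.cont_y₁ q) t
  have c2 := fun q => slice (D.cont_y₂ q) t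
  have e1 : avg (fun x => D.center.y t x / (1 + D.center.y t x ^ 2) * D.lap t x) =
      (1 / 2) * ∑ q, avg fun x => D.center.y t x / (1 + D.center.y t x ^ 2) * D.y₂ q t x := by
    rw [← avg_sum (F := fun q x => D.center.y t x / (1 + D.center.y t x ^ 2) * D.y₂ q t x) _
      (fun q => cF.mul (c2 q)), ← avg_const_mul]
    congr 1; ext x; rw [← Finset.mul_sum, lap]; ring
  have e2 : avg (fun x => (1 - D.center.y t x ^ 2) / (1 + D.center.y t x ^ 2) ^ 2 * D.tang t x) =
      (1 / 2) * ∑ q, avg fun x => (1 - D.center.y t x ^ 2) / (1 + D.center.y t x ^ 2) ^ 2 *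
        D.y₁ q t x * D.y₁ q t x := by
    rw [← avg_sum (F := fun q x => (1 - D.center.y t x ^ 2) / (1 + D.center.y t x ^ 2) ^ 2 *
      D.y₁ q t x * D.y₁ q t x) _ (fun q => (cF'.mul (c1 q)).mul (c1 q)), ← avg_const_mul]
    congr 1; ext x; rw [tang, Finset.mul_sum, Finset.mul_sum, Finset.mul_sum]
    exact Finset.sum_congr rfl fun q _ => by ring
  rw [e1, e2, ← mul_neg, ← Finset.sum_neg_distrib]
  congr 1
  refine Finset.sum_congr rfl fun q _ => ?_
  have hF : HasRot q (fun x => D.center.y t x / (1 + D.center.y t x ^ 2)) fun x =>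
      (1 - D.center.y t x ^ 2) / (1 + D.center.y t x ^ 2) ^ 2 * D.y₁ q t x :=
    (D.center.hasRot_y q t).comp (κ' := fun w => (1 - w ^ 2) / (1 + w ^ 2) ^ 2)
      fun x => hasDerivAt_truncation _
  exact hF.avg_mul (D.hasRot_y₁ q t) cF (cF'.mul (c1 q)) (c1 q) (c2 q)

end CylFun

namespace CylFun

variable {n : ℕ} [NeZero n] (D : CylFun n)

/-- The rescaled scalar curvature. -/
noncomputable def excess (t : ℝ) (x : USphere n) : ℝ :=
  D.elap t x - (n - 2) / 2 * (D.yt t x ^ 2 + D.tang t x)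

omit [NeZero n] in
theorem cont_excess : Continuous fun z : ℝ × USphere n => D.excess z.1 z.2 :=
  D.cont_elap.sub (continuous_const.mul ((D.cont_yt.pow 2).add D.cont_tang))

theorem avg_excess (t : ℝ) : avg (D.excess t) = avg (D.ytt t) + (n - 2) * avg (D.yt t) -
    (n - 2) / 2 * (avg (fun x => D.yt t x ^ 2) + avg (D.tang t)) := by
  have c1 : Continuous fun x => D.yt t x ^ 2 := (slice D.cont_yt t).pow 2
  have c2 : Continuous fun x => D.yt t x ^ 2 + D.tang t x := c1.add (slice D.cont_tang t)
  have c3 : Continuous fun x => (n - 2 : ℝ) / 2 * (D.yt t x ^ 2 + D.tang t x) :=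
    continuous_const.mul c2
  have : avg (D.excess t) =
    avg fun x => D.elap t x - (n - 2) / 2 * (D.yt t x ^ 2 + D.tang t x) := rfl
  rw [this, avg_sub (slice D.cont_elap t) c3, avg_const_mul, avg_add c1 (slice D.cont_tang t),
    avg_elap]

/-- The curvature conditions, written for the logarithm of the conformal factor in exponential
polar coordinates, together with the behaviour at the centre. -/
structure Admissible (τ : ℝ) : Prop where
  three_le : 3 ≤ n
  tau_pos : 0 < τ
  excess_nonneg : ∀ t x, 0 ≤ D.excess t x
  schouten : ∀ t, (n - 2) * avg (D.tang t) + τ * avg (D.excess t) ≤ (n - 1) * avg (D.ytt t)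
  bounded : ∃ B, ∀ t ≤ 0, ∀ x, |D.y t x| ≤ B ∧ |D.yt t x| ≤ B
  tendsto_avg_yt : Tendsto (fun t => avg (D.yt t)) atBot (nhds 0)

namespace Admissible

variable {D} {τ : ℝ} (h : D.Admissible τ)
include h

omit [NeZero n] in
theorem three_le_cast : (3 : ℝ) ≤ n := by exact_mod_cast h.three_le

omit [NeZero n] in
theorem elap_nonneg (t : ℝ) (x : USphere n) : 0 ≤ D.elap t x := by
  have h1 := h.excess_nonneg t x
  have h2 := D.tang_nonneg t x
  have h3 := h.three_le_cast
  unfold excess at h1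
  nlinarith [sq_nonneg (D.yt t x)]

omit h in
omit [NeZero n] in
theorem avg_tang_nonneg (t : ℝ) : 0 ≤ avg (D.tang t) := avg_nonneg (D.tang_nonneg t)

omit [NeZero n] in
theorem avg_excess_nonneg (t : ℝ) : 0 ≤ avg (D.excess t) := avg_nonneg (h.excess_nonneg t)

omit [NeZero n] in
theorem avg_ytt_nonneg (t : ℝ) : 0 ≤ avg (D.ytt t) := by
  have h1 := h.schouten t
  have h2 := h.three_le_cast
  have h3 := mul_nonneg (by linarith : (0 : ℝ) ≤ n - 2) (avg_tang_nonneg (D := D) t)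
  have h4 := mul_nonneg h.tau_pos.le (h.avg_excess_nonneg t)
  by_contra! h5
  nlinarith

omit [NeZero n] in
theorem avg_tang_le (t : ℝ) : avg (D.tang t) ≤ 2 * avg (D.ytt t) := by
  have h1 := h.schouten t
  have h2 := h.three_le_cast
  have h4 := mul_nonneg h.tau_pos.le (h.avg_excess_nonneg t)
  have h5 := h.avg_ytt_nonneg t
  by_contra! h6
  nlinarith

omit [NeZero n] in
theorem avg_excess_le (t : ℝ) : avg (D.excess t) ≤ (n - 1) / τ * avg (D.ytt t) := by
  have h1 := h.schouten t
  have h2 := h.three_le_cast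
  have h3 := mul_nonneg (by linarith : (0 : ℝ) ≤ n - 2) (avg_tang_nonneg (D := D) t)
  rw [div_mul_eq_mul_div, le_div_iff₀ h.tau_pos]
  linarith

omit h in
theorem avg_yt_sq_add (t : ℝ) : (n - 2) / 2 * (avg (fun x => D.yt t x ^ 2) + avg (D.tang t)) =
    avg (D.ytt t) + (n - 2) * avg (D.yt t) - avg (D.excess t) := by
  rw [avg_excess]; ring

theorem monotone_avg_yt : Monotone fun t => avg (D.yt t) :=
  (nonneg_of_deriv_nonneg_of_tendsto_atBot D.hasDerivAt_avg_yt h.avg_ytt_nonneg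
    h.tendsto_avg_yt).1

theorem avg_yt_nonneg (t : ℝ) : 0 ≤ avg (D.yt t) :=
  (nonneg_of_deriv_nonneg_of_tendsto_atBot D.hasDerivAt_avg_yt h.avg_ytt_nonneg
    h.tendsto_avg_yt).2 t

theorem avg_yt_le_two (t : ℝ) : avg (D.yt t) ≤ 2 := by
  have h3 := h.three_le_cast
  refine le_two_of_riccati (k := (n - 2) / 2) (by linarith) D.hasDerivAt_avg_yt
    h.monotone_avg_yt (fun t => ?_) t
  have h1 := avg_yt_sq_add (D := D) t
  have h2 := sq_avg_le (slice D.cont_yt t)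
  have h4 := h.avg_excess_nonneg t
  have h5 := avg_tang_nonneg (D := D) t
  have h6 : ((n : ℝ) - 2) / 2 * avg (D.yt t) ^ 2 ≤
      (n - 2) / 2 * (avg (fun x => D.yt t x ^ 2) + avg (D.tang t)) :=
    mul_le_mul_of_nonneg_left (by linarith) (by linarith)
  linarith

theorem avg_yt_sq_le (t : ℝ) : avg (fun x => D.yt t x ^ 2) ≤ 4 + 2 * avg (D.ytt t) := by
  have h3 := h.three_le_cast
  have h1 := avg_yt_sq_add (D := D) t
  have h2 := h.avg_yt_le_two t
  have h4 := h.avg_excess_nonneg t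
  have h5 := avg_tang_nonneg (D := D) t
  have h6 := h.avg_ytt_nonneg t
  by_contra! h7
  nlinarith

/-- If the mean radial derivative vanishes identically, so does the radial derivative. -/
theorem yt_eq_zero (h0 : ∀ t, avg (D.yt t) = 0) (t : ℝ) (x : USphere n) : D.yt t x = 0 := by
  have h1 : avg (D.ytt t) = 0 := by
    refine (D.hasDerivAt_avg_yt t).unique ?_
    simp only [h0]
    exact hasDerivAt_const t 0
  have h2 := avg_yt_sq_add (D := D) t
  have h3 := h.three_le_cast
  have h4 := h.avg_excess_nonneg t
  have h5 := avg_tang_nonneg (D := D) t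
  have h6 : avg (fun x => D.yt t x ^ 2) ≤ 0 := by
    rw [h0, h1] at h2
    by_contra! h6
    nlinarith
  have hc : Continuous fun x => D.yt t x ^ 2 := (slice D.cont_yt t).pow 2
  have h7 : avg (fun x => D.yt t x ^ 2) = 0 := le_antisymm h6 (avg_nonneg fun x => sq_nonneg _)
  by_contra hne
  have : 0 < avg (fun x => D.yt t x ^ 2) := avg_pos hc (fun x => sq_nonneg _) x (by positivity)
  linarith

theorem avg_negPart_sq_le (t : ℝ) :
    avg (fun x => max (-D.yt t x) 0 ^ 2) ≤ avg (D.tang t) := by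
  have h3 := h.three_le_cast
  have key := (D.shift t).avg_negPart_yt_sq_le h.three_le
    (fun s _ x => h.elap_nonneg (s + t) x) ?_
  · have e : (D.shift t).tang 0 = D.tang t := by
      funext x
      simp [shift, tang]
    rw [e] at key
    simpa [shift] using key
  · intro ε hε
    obtain ⟨B, hB⟩ := h.bounded
    have hlim : Tendsto (fun s : ℝ => Real.exp s * (2 * B)) atBot (nhds 0) := by
      simpa using Real.tendsto_exp_atBot.mul_const (2 * B)
    obtain ⟨s, hs, hs'⟩ := ((hlim.eventually_lt_const hε).and (eventually_le_atBot (-|t|))).exists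
    have hs0 : s ≤ 0 := hs'.trans (neg_nonpos.2 (abs_nonneg t))
    refine ⟨s, hs0, ?_⟩
    have hst : s + t ≤ 0 := by linarith [le_abs_self t]
    have b1 : avg (fun x => |D.y (s + t) x|) ≤ B := by
      rw [← avg_const (n := n) B]
      exact avg_mono (slice D.cont_y _).abs continuous_const fun x => (hB _ hst x).1
    have b2 : avg (fun x => |D.yt (s + t) x|) ≤ B := by
      rw [← avg_const (n := n) B]
      exact avg_mono (slice D.cont_yt _).abs continuous_const fun x => (hB _ hst x).2
    have b3 : 0 ≤ avg (fun x => |D.y (s + t) x|) := avg_nonneg fun x => abs_nonneg _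
    have b4 : 0 ≤ avg (fun x => |D.yt (s + t) x|) := avg_nonneg fun x => abs_nonneg _
    have hexp : Real.exp ((n - 2) * s) ≤ Real.exp s := Real.exp_le_exp.2 (by nlinarith)
    refine le_trans ?_ hs.le
    refine mul_le_mul hexp ?_ (add_nonneg b3 b4) (Real.exp_pos _).le
    change avg (fun x => |D.y (s + t) x|) + avg (fun x => |D.yt (s + t) x|) ≤ _
    linarith

/-- Arbitrarily late times at which the mean second derivative is small. -/
theorem exists_avg_ytt_le (a : ℝ) : ∃ s ≥ a, avg (D.ytt s) ≤ 1 := by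
  obtain ⟨c, hc, hc'⟩ := exists_hasDerivAt_eq_slope (fun t => avg (D.yt t)) (fun t => avg (D.ytt t))
    (show a < a + 3 by linarith)
    (fun t _ => (D.hasDerivAt_avg_yt t).continuousAt.continuousWithinAt)
    (fun t _ => D.hasDerivAt_avg_yt t)
  refine ⟨c, hc.1.le, ?_⟩
  rw [hc', div_le_one (by linarith)]
  have h1 := h.avg_yt_le_two (a + 3)
  have h2 := h.avg_yt_nonneg a
  linarith

theorem exists_avg_center_sq_le : ∃ C > 0, ∀ t,
    avg (fun x => D.center.y t x ^ 2) ≤ C * avg (D.tang t) := by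
  obtain ⟨C, hC, hP⟩ := exists_poincare n h.three_le
  refine ⟨C, hC, fun t => ?_⟩
  have := hP (fun q => D.center.hasRot_y q t) (fun q => D.center.hasRot_y₁ q t)
    (slice D.center.cont_y t) (fun q => slice (D.center.cont_y₁ q) t)
    (fun q => slice (D.center.cont_y₂ q) t) (D.avg_center_y t)
  rw [avg_tang]
  exact this

theorem abs_avg_y_le {t : ℝ} (ht : 0 ≤ t) : |avg (D.y t)| ≤ |avg (D.y 0)| + 2 * t := by
  have h1 := add_mul_le_of_le_deriv D.hasDerivAt_avg_y (fun s _ => h.avg_yt_nonneg s) ht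
  have h2 := add_mul_le_of_le_deriv (fun s => (D.hasDerivAt_avg_y s).neg) (c := -2)
    (fun s _ => neg_le_neg (h.avg_yt_le_two s)) ht
  simp only [Pi.neg_apply] at h2
  exact abs_le.2 ⟨by linarith [neg_abs_le (avg (D.y 0))], by linarith [le_abs_self (avg (D.y 0))]⟩

theorem avg_sub_two_posPart_sq_le (t : ℝ) :
    avg (fun x => max (D.yt t x - 2) 0 ^ 2) ≤ avg (D.tang t) := by
  have h3 := h.three_le_cast
  have key := (D.reflect t).avg_negPart_yt_sq_le h.three_le (fun s _ x => ?_) ?_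
  · have e : (D.reflect t).tang 0 = D.tang t := by
      funext x
      simp [reflect, tang]
    rw [e] at key
    simpa [reflect] using key
  · have h1 := h.excess_nonneg (t - s) x
    have h2 := D.tang_nonneg (t - s) x
    simp only [excess, elap, lap, reflect] at h1 ⊢
    have h4 := mul_nonneg (by linarith : (0 : ℝ) ≤ (n - 2) / 2) h2
    have h5 := mul_nonneg (by linarith : (0 : ℝ) ≤ (n - 2) / 2) (sq_nonneg (D.yt (t - s) x - 2))
    linarith
  · intro ε hε
    obtain ⟨C, hC, hP⟩ := h.exists_avg_center_sq_le
    set K := 8 + 2 * C + |avg (D.y 0)| + 2 * |t| + 2 with hK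
    have hlim : Tendsto (fun s : ℝ => Real.exp (t - s) * (K + 4 * s)) atTop (nhds 0) := by
      have h1 : Tendsto (fun s : ℝ => Real.exp t * K * Real.exp (-s)) atTop (nhds 0) := by
        simpa using (Real.tendsto_exp_neg_atTop_nhds_zero.const_mul (Real.exp t * K))
      have h2 : Tendsto (fun s : ℝ => 4 * Real.exp t * (s ^ 1 * Real.exp (-s))) atTop (nhds 0) := by
        simpa using (Real.tendsto_pow_mul_exp_neg_atTop_nhds_zero 1).const_mul (4 * Real.exp t)
      refine (by simpa using h1.add h2 : Tendsto _ atTop (nhds (0 : ℝ))).congr fun s => ?_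
      rw [sub_eq_add_neg, Real.exp_add]; ring
    obtain ⟨a, ha⟩ := eventually_atTop.1 (hlim.eventually_lt_const hε)
    obtain ⟨s, hs, hs1⟩ := h.exists_avg_ytt_le (max a |t|)
    have hst : |t| ≤ s := (le_max_right _ _).trans hs
    have hs0 : 0 ≤ s := (abs_nonneg t).trans hst
    have hts : t - s ≤ 0 := by linarith [le_abs_self t]
    refine ⟨t - s, hts, ?_⟩
    have cy := slice D.cont_y s
    have cyt := slice D.cont_yt s
    have cw : Continuous fun x => D.center.y s x ^ 2 := (slice D.center.cont_y s).pow 2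
    have hW := hP s
    have hT := h.avg_tang_le s
    have hU := h.abs_avg_y_le hs0
    have hQ := h.avg_yt_sq_le s
    have b1 : avg (fun x => |D.y (t - (t - s)) x + 2 * (t - s)|) ≤
        1 + 2 * C + (|avg (D.y 0)| + 2 * s) + (2 * |t| + 2 * s) := by
      rw [sub_sub_cancel]
      have : avg (fun x => |D.y s x + 2 * (t - s)|) ≤
          avg (fun x => D.center.y s x ^ 2 + (1 + |avg (D.y s)| + (2 * |t| + 2 * s))) := by
        refine avg_mono (by fun_prop) (cw.add continuous_const) fun x => ?_
        have e : D.y s x + 2 * (t - s) = D.center.y s x + avg (D.y s) + 2 * (t - s) := by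
          change _ = D.y s x + -avg (D.y s) + avg (D.y s) + 2 * (t - s)
          ring
        rw [e]
        have a1 := abs_add_le (D.center.y s x + avg (D.y s)) (2 * (t - s))
        have a2 := abs_add_le (D.center.y s x) (avg (D.y s))
        have a3 : |2 * (t - s)| ≤ 2 * |t| + 2 * s := by
          refine abs_le.2 ⟨?_, ?_⟩ <;> linarith [neg_abs_le t, le_abs_self t]
        have a4 : |D.center.y s x| ≤ D.center.y s x ^ 2 + 1 := by
          refine abs_le.2 ⟨?_, ?_⟩ <;> nlinarith [sq_nonneg (D.center.y s x - 1),
            sq_nonneg (D.center.y s x + 1)]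
        linarith
      rw [avg_add cw continuous_const, avg_const] at this
      nlinarith
    have b2 : avg (fun x => |2 - D.yt (t - (t - s)) x|) ≤ 9 := by
      rw [sub_sub_cancel]
      have c1 : Continuous fun x => D.yt s x ^ 2 := by fun_prop
      have : avg (fun x => |2 - D.yt s x|) ≤ avg (fun x => D.yt s x ^ 2 + 3) := by
        refine avg_mono (by fun_prop) (by fun_prop) fun x => ?_
        refine abs_le.2 ⟨?_, ?_⟩ <;> nlinarith [sq_nonneg (D.yt s x - 1),
            sq_nonneg (D.yt s x + 1)]
      rw [avg_add c1 continuous_const, avg_const] at this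
      linarith
    have b3 : 0 ≤ avg (fun x => |D.y (t - (t - s)) x + 2 * (t - s)|) :=
      avg_nonneg fun x => abs_nonneg _
    have b4 : 0 ≤ avg (fun x => |2 - D.yt (t - (t - s)) x|) := avg_nonneg fun x => abs_nonneg _
    have hexp : Real.exp ((n - 2) * (t - s)) ≤ Real.exp (t - s) :=
      Real.exp_le_exp.2 (by nlinarith)
    refine le_trans (mul_le_mul hexp ?_ (add_nonneg b3 b4) (Real.exp_pos _).le)
      (ha s ((le_max_left _ _).trans hs)).le
    change avg (fun x => |D.y (t - (t - s)) x + 2 * (t - s)|) +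
      avg (fun x => |2 - D.yt (t - (t - s)) x|) ≤ _
    linarith

end Admissible

end CylFun

theorem abs_truncation_le_one (w : ℝ) : |w / (1 + w ^ 2)| ≤ 1 := by
  rw [abs_div, abs_of_pos (by positivity : 0 < 1 + w ^ 2), div_le_one (by positivity), ← sq_abs w]
  nlinarith [sq_nonneg (|w| - 1), abs_nonneg w]

theorem abs_truncation_le (w : ℝ) : |w / (1 + w ^ 2)| ≤ |w| := by
  rw [abs_div, abs_of_pos (by positivity : 0 < 1 + w ^ 2)]
  exact div_le_self (abs_nonneg w) (by nlinarith [sq_nonneg w])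

theorem abs_truncation_deriv_le (w : ℝ) : |(1 - w ^ 2) / (1 + w ^ 2) ^ 2| ≤ 1 := by
  rw [abs_div, abs_of_pos (by positivity : 0 < (1 + w ^ 2) ^ 2), div_le_one (by positivity)]
  refine abs_le.2 ⟨?_, ?_⟩ <;> nlinarith [sq_nonneg w, sq_nonneg (w ^ 2)]

theorem one_sub_truncation_deriv_le (w : ℝ) :
    1 - (1 - w ^ 2) / (1 + w ^ 2) ^ 2 ≤ 3 * (w ^ 2 / (1 + w ^ 2)) := by
  have h : 0 < 1 + w ^ 2 := by positivity
  rw [← sub_nonneg]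
  have : 3 * (w ^ 2 / (1 + w ^ 2)) - (1 - (1 - w ^ 2) / (1 + w ^ 2) ^ 2) =
    2 * w ^ 4 / (1 + w ^ 2) ^ 2 := by
    field_simp
    ring
  rw [this]
  positivity

theorem truncation_integrand_le {F F' g v m f e T N a : ℝ} (hF : |F| ≤ 1) (hF' : |F'| ≤ 1)
    (hg : 1 - F' ≤ 3 * g) (hg0 : 0 ≤ g) (hm0 : 0 ≤ m) (hm2 : m ≤ 2) (hT : 0 ≤ T) (he : 0 ≤ e)
    (hf : f = e + (N - 2) / 2 * (v ^ 2 + T)) (hN : 3 ≤ N) (ha : 0 ≤ a) :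
    ((1 - F') * (v - m) ^ 2 - F' * T) - F * (f - (N - 2) * v - a) ≤
      6 * (g * v ^ 2) + 24 * g + (1 + N) * T + e + 2 * N * (|F| * v ^ 2) + N * |F| + a := by
  have f0 := abs_nonneg F
  have hf0 : 0 ≤ f := by
    rw [hf]
    have : 0 ≤ (N - 2) / 2 := by linarith
    positivity
  have p1 : (1 - F') * (v - m) ^ 2 ≤ 6 * (g * v ^ 2) + 24 * g := by
    have q1 : (v - m) ^ 2 ≤ 2 * v ^ 2 + 8 := by nlinarith [sq_nonneg (v + m)]
    have q2 := mul_le_mul_of_nonneg_right hg (sq_nonneg (v - m))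
    have q3 := mul_le_mul_of_nonneg_left q1 hg0
    linarith
  have p2 : -(F' * T) ≤ T := by
    have := mul_le_mul_of_nonneg_right (abs_le.1 hF').1 hT
    linarith
  have p3 : -(F * f) ≤ |F| * f := by
    have := mul_le_mul_of_nonneg_right (neg_abs_le F) hf0
    linarith
  have p4 : |F| * f ≤ e + N * (|F| * v ^ 2) + N * T := by
    have r1 : |F| * e ≤ 1 * e := mul_le_mul_of_nonneg_right hF he
    have r2 : (N - 2) / 2 * (|F| * v ^ 2) ≤ N * (|F| * v ^ 2) :=
      mul_le_mul_of_nonneg_right (by linarith) (by positivity)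
    have r0 : |F| * T ≤ 1 * T := mul_le_mul_of_nonneg_right hF hT
    have r3 : (N - 2) / 2 * (|F| * T) ≤ N * T :=
      mul_le_mul (by linarith) (by linarith) (by positivity) (by linarith)
    rw [hf]
    linarith
  have p5 : F * ((N - 2) * v) ≤ N * (|F| * v ^ 2) + N * |F| := by
    have r0 : |v| ≤ v ^ 2 + 1 := by
      rw [← sq_abs v]
      nlinarith [sq_nonneg (|v| - 1), abs_nonneg v]
    have r1 : F * v ≤ |F| * (v ^ 2 + 1) := by
      calc F * v ≤ |F * v| := le_abs_self _
        _ = |F| * |v| := abs_mul _ _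
        _ ≤ _ := mul_le_mul_of_nonneg_left r0 f0
    have r2 : 0 ≤ |F| * (v ^ 2 + 1) := by positivity
    have r3 := mul_le_mul_of_nonneg_left r1 (by linarith : 0 ≤ N - 2)
    linarith
  have p6 : F * a ≤ 1 * a := mul_le_mul_of_nonneg_right ((le_abs_self F).trans hF) ha
  linarith

namespace CylFun.Admissible

variable {n : ℕ} [NeZero n] {D : CylFun n} {τ : ℝ} (h : D.Admissible τ)
include h

/-- Uniform integrability of the squared radial derivative. -/
theorem avg_mul_yt_sq_le (t : ℝ) {g : USphere n → ℝ} (cg : Continuous g) (g0 : ∀ x, 0 ≤ g x)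
    (g1 : ∀ x, g x ≤ 1) :
    avg (fun x => g x * D.yt t x ^ 2) ≤ 8 * avg g + 3 * avg (D.tang t) := by
  have c := slice D.cont_yt t
  have h1 := h.avg_negPart_sq_le t
  have h2 := h.avg_sub_two_posPart_sq_le t
  have c1 : Continuous fun x => 8 * g x := by fun_prop
  have c2 : Continuous fun x => 2 * max (D.yt t x - 2) 0 ^ 2 := by fun_prop
  have c3 : Continuous fun x => max (-D.yt t x) 0 ^ 2 := by fun_prop
  have c4 : Continuous fun x => 8 * g x + 2 * max (D.yt t x - 2) 0 ^ 2 := by fun_prop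
  have key : avg (fun x => g x * D.yt t x ^ 2) ≤ avg (fun x => 8 * g x +
      2 * max (D.yt t x - 2) 0 ^ 2 + max (-D.yt t x) 0 ^ 2) := by
    refine avg_mono (by fun_prop) (by fun_prop) fun x => ?_
    have a0 := g0 x
    have a1 := g1 x
    set v := D.yt t x
    have b : v ^ 2 ≤ 8 + (2 * max (v - 2) 0 ^ 2 + max (-v) 0 ^ 2) := by
      rcases le_total v 0 with hv | hv
      · rw [max_eq_left (by linarith : 0 ≤ -v), max_eq_right (by linarith : v - 2 ≤ 0)]
        nlinarith
      · rw [max_eq_right (by linarith : -v ≤ 0)]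
        rcases le_total v 2 with hv' | hv'
        · rw [max_eq_right (by linarith : v - 2 ≤ 0)]
          nlinarith
        · rw [max_eq_left (by linarith : 0 ≤ v - 2)]
          nlinarith [sq_nonneg (v - 4)]
    have b1 := mul_le_mul_of_nonneg_left b a0
    have b2 : 0 ≤ 2 * max (v - 2) 0 ^ 2 + max (-v) 0 ^ 2 := by positivity
    nlinarith
  rw [avg_add c4 c3, avg_add c1 c2, avg_const_mul, avg_const_mul] at key
  linarith

omit h in
theorem flux_eq (t : ℝ) : avg (fun x => D.center.yt t x ^ 2) = D.fluxDeriv t + avg (fun x =>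
    ((1 - (1 - D.center.y t x ^ 2) / (1 + D.center.y t x ^ 2) ^ 2) * D.center.yt t x ^ 2 -
      (1 - D.center.y t x ^ 2) / (1 + D.center.y t x ^ 2) ^ 2 * D.tang t x) -
    D.center.y t x / (1 + D.center.y t x ^ 2) *
      (D.elap t x - (n - 2) * D.yt t x - avg (D.ytt t))) := by
  have cw := slice D.center.cont_y t
  have cwt := slice D.center.cont_yt t
  have cwtt := slice D.center.cont_ytt t
  have cT := slice D.cont_tang t
  have cL := slice D.cont_lap t
  have cE := slice D.cont_elap t
  have cyt := slice D.cont_yt t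
  have hG := D.avg_truncation_mul_lap t
  have cF : Continuous fun x => D.center.y t x / (1 + D.center.y t x ^ 2) :=
    continuous_truncation.comp cw
  have cF' : Continuous fun x => (1 - D.center.y t x ^ 2) / (1 + D.center.y t x ^ 2) ^ 2 :=
    continuous_truncation_deriv.comp cw
  unfold fluxDeriv
  set F := fun x => D.center.y t x / (1 + D.center.y t x ^ 2)
  set F' := fun x => (1 - D.center.y t x ^ 2) / (1 + D.center.y t x ^ 2) ^ 2
  have c1 : Continuous fun x => F' x * D.center.yt t x ^ 2 + F x * D.center.ytt t x := by fun_prop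
  have c2 : Continuous fun x => ((1 - F' x) * D.center.yt t x ^ 2 - F' x * D.tang t x) -
      F x * (D.elap t x - (n - 2) * D.yt t x - avg (D.ytt t)) := by fun_prop
  have c3 : Continuous fun x => F x * D.lap t x := by fun_prop
  have c4 : Continuous fun x => F' x * D.tang t x := by fun_prop
  have c5 : Continuous fun x => F x * D.lap t x + F' x * D.tang t x := by fun_prop
  have e0 : avg (fun x => F x * D.lap t x + F' x * D.tang t x) = 0 := by
    rw [avg_add c3 c4]
    change avg (fun x => F x * D.lap t x) = -avg (fun x => F' x * D.tang t x) at hG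
    linarith
  change _ = avg (fun x => F' x * D.center.yt t x ^ 2 + F x * D.center.ytt t x) +
    avg (fun x => ((1 - F' x) * D.center.yt t x ^ 2 - F' x * D.tang t x) -
      F x * (D.elap t x - (n - 2) * D.yt t x - avg (D.ytt t)))
  have c6 : Continuous fun x => F' x * D.center.yt t x ^ 2 + F x * D.center.ytt t x +
      (((1 - F' x) * D.center.yt t x ^ 2 - F' x * D.tang t x) -
        F x * (D.elap t x - (n - 2) * D.yt t x - avg (D.ytt t))) := by fun_prop
  rw [← avg_add c1 c2, ← add_zero (avg fun x => _ + _), ← e0, ← avg_add c6 c5]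
  congr 1
  funext x
  have e1 : D.center.ytt t x = D.ytt t x - avg (D.ytt t) := rfl
  have e2 : D.elap t x = D.ytt t x + (n - 2) * D.yt t x + D.lap t x := rfl
  rw [e1, e2]
  ring

theorem avg_center_yt_sq_le_fluxDeriv : ∃ A > 0, ∃ c : ℝ → ℝ, ∀ δ > 0, ∀ t,
    avg (fun x => D.center.yt t x ^ 2) ≤ D.fluxDeriv t + A * δ + c δ * avg (D.ytt t) := by
  obtain ⟨C, hC, hP⟩ := h.exists_avg_center_sq_le
  have hn3 := h.three_le_cast
  set N : ℝ := (n : ℝ) with hN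
  refine ⟨17 * N, by linarith, fun δ => 17 * N * (δ⁻¹ * (2 * C)) +
    (144 * C + 2 * (19 + 7 * N) + (N - 1) / τ + 1), fun δ hδ t => ?_⟩
  have cw := slice D.center.cont_y t
  have cwt := slice D.center.cont_yt t
  have cT := slice D.cont_tang t
  have cX := slice D.cont_excess t
  have cE := slice D.cont_elap t
  have cyt := slice D.cont_yt t
  have cF : Continuous fun x => D.center.y t x / (1 + D.center.y t x ^ 2) :=
    continuous_truncation.comp cw
  have cF' : Continuous fun x => (1 - D.center.y t x ^ 2) / (1 + D.center.y t x ^ 2) ^ 2 :=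
    continuous_truncation_deriv.comp cw
  have cg : Continuous fun x => D.center.y t x ^ 2 / (1 + D.center.y t x ^ 2) :=
    (cw.pow 2).div (by fun_prop) fun x => by positivity
  have hle1 := flux_eq (D := D) t
  have hW := hP t
  have hT := h.avg_tang_le t
  have hX := h.avg_excess_le t
  have hV := h.avg_yt_le_two t
  have hV0 := h.avg_yt_nonneg t
  have hV1 := h.avg_ytt_nonneg t
  have aF1 := fun x => abs_truncation_le_one (D.center.y t x)
  have aF2 := fun x => abs_truncation_le (D.center.y t x)
  have aF3 := fun x => abs_truncation_deriv_le (D.center.y t x)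
  have aF4 := fun x => one_sub_truncation_deriv_le (D.center.y t x)
  have ag0 : ∀ x, 0 ≤ D.center.y t x ^ 2 / (1 + D.center.y t x ^ 2) := fun x => by positivity
  have ag1 : ∀ x, D.center.y t x ^ 2 / (1 + D.center.y t x ^ 2) ≤ 1 := fun x => by
    rw [div_le_one (by positivity)]; linarith
  have ag2 : ∀ x, D.center.y t x ^ 2 / (1 + D.center.y t x ^ 2) ≤ D.center.y t x ^ 2 := fun x =>
    div_le_self (sq_nonneg _) (by nlinarith [sq_nonneg (D.center.y t x)])
  set F := fun x => D.center.y t x / (1 + D.center.y t x ^ 2)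
  set F' := fun x => (1 - D.center.y t x ^ 2) / (1 + D.center.y t x ^ 2) ^ 2
  set g := fun x => D.center.y t x ^ 2 / (1 + D.center.y t x ^ 2)
  change _ = D.fluxDeriv t + avg (fun x => ((1 - F' x) * D.center.yt t x ^ 2 - F' x * D.tang t x) -
    F x * (D.elap t x - (n - 2) * D.yt t x - avg (D.ytt t))) at hle1
  have hg := h.avg_mul_yt_sq_le t cg ag0 ag1
  have hFa := h.avg_mul_yt_sq_le t cF.abs (fun x => abs_nonneg _) aF1
  have cw2 : Continuous fun x => D.center.y t x ^ 2 := cw.pow 2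
  have gW : avg g ≤ avg (fun x => D.center.y t x ^ 2) := avg_mono cg cw2 ag2
  have FW : avg (fun x => |F x|) ≤ δ + δ⁻¹ * avg (fun x => D.center.y t x ^ 2) := by
    have c1 : Continuous fun x => δ⁻¹ * D.center.y t x ^ 2 := by fun_prop
    have : avg (fun x => |F x|) ≤ avg (fun x => δ + δ⁻¹ * D.center.y t x ^ 2) := by
      refine avg_mono cF.abs (by fun_prop) fun x => (aF2 x).trans ?_
      rw [← sq_abs (D.center.y t x)]
      have : 0 ≤ δ⁻¹ * (|D.center.y t x| - δ / 2) ^ 2 + δ * (3 / 4) := by positivity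
      have e : δ⁻¹ * (|D.center.y t x| - δ / 2) ^ 2 = δ⁻¹ * |D.center.y t x| ^ 2 -
        |D.center.y t x| + δ / 4 := by field_simp; ring
      linarith
    rwa [avg_add continuous_const c1, avg_const, avg_const_mul] at this
  have key : avg (fun x => ((1 - F' x) * D.center.yt t x ^ 2 - F' x * D.tang t x) -
      F x * (D.elap t x - (n - 2) * D.yt t x - avg (D.ytt t))) ≤
      avg (fun x => 6 * (g x * D.yt t x ^ 2) + 24 * g x + (1 + N) * D.tang t x + D.excess t x +
        2 * N * (|F x| * D.yt t x ^ 2) + N * |F x| + avg (D.ytt t)) := by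
    refine avg_mono (by fun_prop) (by fun_prop) fun x => ?_
    exact truncation_integrand_le (aF1 x) (aF3 x) (aF4 x) (ag0 x) hV0 hV (D.tang_nonneg t x)
      (h.excess_nonneg t x) (by unfold excess; ring) hn3 hV1
  have d1 : Continuous fun x => 6 * (g x * D.yt t x ^ 2) := by fun_prop
  have d2 : Continuous fun x => 24 * g x := by fun_prop
  have d3 : Continuous fun x => (1 + N) * D.tang t x := by fun_prop
  have d5 : Continuous fun x => 2 * N * (|F x| * D.yt t x ^ 2) := by fun_prop
  have d6 : Continuous fun x => N * |F x| := by fun_prop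
  rw [avg_add (F := fun x => 6 * (g x * D.yt t x ^ 2) + 24 * g x + (1 + N) * D.tang t x +
      D.excess t x + 2 * N * (|F x| * D.yt t x ^ 2) + N * |F x|) (by fun_prop) continuous_const,
    avg_add (F := fun x => 6 * (g x * D.yt t x ^ 2) + 24 * g x + (1 + N) * D.tang t x +
      D.excess t x + 2 * N * (|F x| * D.yt t x ^ 2)) (by fun_prop) d6,
    avg_add (F := fun x => 6 * (g x * D.yt t x ^ 2) + 24 * g x + (1 + N) * D.tang t x +
      D.excess t x) (by fun_prop) d5,
    avg_add (F := fun x => 6 * (g x * D.yt t x ^ 2) + 24 * g x + (1 + N) * D.tang t x)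
      (by fun_prop) cX,
    avg_add (F := fun x => 6 * (g x * D.yt t x ^ 2) + 24 * g x) (by fun_prop) d3,
    avg_add d1 d2, avg_const_mul, avg_const_mul, avg_const_mul, avg_const_mul, avg_const_mul,
    avg_const] at key
  rw [hle1]
  have hFN := mul_le_mul_of_nonneg_left hFa (by linarith : 0 ≤ 2 * N)
  have s1 : avg (fun x => D.center.y t x ^ 2) ≤ 2 * C * avg (D.ytt t) := by nlinarith
  have s2 : δ⁻¹ * avg (fun x => D.center.y t x ^ 2) ≤ δ⁻¹ * (2 * C * avg (D.ytt t)) :=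
    mul_le_mul_of_nonneg_left s1 (by positivity)
  have FW' := mul_le_mul_of_nonneg_left (FW.trans (add_le_add_right s2 δ))
    (by linarith : 0 ≤ 17 * N)
  have hT' := mul_le_mul_of_nonneg_left hT (by linarith : 0 ≤ 19 + 7 * N)
  have gW' : 72 * avg g ≤ 144 * C * avg (D.ytt t) := by linarith
  linarith

end CylFun.Admissible

namespace CylFun.Admissible

variable {n : ℕ} [NeZero n] {D : CylFun n} {τ : ℝ} (h : D.Admissible τ)
include h

theorem avg_center_yt_sq_le (t : ℝ) :
    avg (fun x => D.center.yt t x ^ 2) ≤ 4 + 2 * avg (D.ytt t) := by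
  rw [D.avg_center_yt_sq]
  linarith [h.avg_yt_sq_le t, sq_nonneg (avg (D.yt t))]

theorem abs_flux_le (t : ℝ) : |D.flux t| ≤ 5 + 5 * avg (D.ytt t) := by
  have cF : Continuous fun x => D.center.y t x / (1 + D.center.y t x ^ 2) :=
    continuous_truncation.comp (slice D.center.cont_y t)
  have c := slice D.center.cont_yt t
  have c2 : Continuous fun x => D.center.yt t x ^ 2 := c.pow 2
  have h1 : |D.flux t| ≤ avg (fun x => 1 + D.center.yt t x ^ 2) := by
    refine (abs_avg_le _).trans (avg_mono (cF.mul c).abs (by fun_prop) fun x => ?_)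
    rw [abs_mul, ← sq_abs (D.center.yt t x)]
    have h2 := mul_le_mul_of_nonneg_right (abs_truncation_le_one (D.center.y t x))
      (abs_nonneg (D.center.yt t x))
    nlinarith [sq_nonneg (|D.center.yt t x| - 1)]
  rw [avg_add continuous_const c2, avg_const] at h1
  linarith [h.avg_center_yt_sq_le t, h.avg_ytt_nonneg t]

theorem exists_three_halves_le_avg_yt {a : ℝ} (ha : 0 < avg (D.yt a)) :
    ∃ b, 3 / 2 ≤ avg (D.yt b) := by
  obtain ⟨A, hA, c, hc⟩ := h.avg_center_yt_sq_le_fluxDeriv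
  have hn := h.three_le_cast
  refine _root_.exists_three_halves_le (A := 5) (B := A) (c := fun δ => c δ + 2 * ((n - 1) / τ) + 2)
    (by norm_num) hA D.hasDerivAt_avg_yt h.monotone_avg_yt h.avg_yt_le_two ha D.hasDerivAt_flux
    h.abs_flux_le fun δ hδ t => ?_
  have h1 := hc δ hδ t
  rw [D.avg_center_yt_sq] at h1
  have h2 := avg_yt_sq_add (D := D) t
  have h3 := h.avg_tang_le t
  have h4 := h.avg_excess_le t
  have h5 := h.avg_ytt_nonneg t
  have h6 := h.avg_excess_nonneg t
  have h7 : 2 * avg (D.yt t) - 2 * avg (D.excess t) - 2 * avg (D.ytt t) ≤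
      avg fun x => D.yt t x ^ 2 := by
    by_contra! h8
    have h9 := mul_lt_mul_of_pos_left h8 (by linarith : 0 < ((n : ℝ) - 2) / 2)
    have h10 := mul_le_mul_of_nonneg_left h3 (by linarith : 0 ≤ ((n : ℝ) - 2) / 2)
    nlinarith
  linarith

/-- Along almost every ray the deviation from the mean grows sublinearly. -/
theorem exists_tendsto_center : ∃ x,
    Tendsto (fun t => D.center.y t x ^ 2 / t ^ 2) atTop (nhds 0) := by
  obtain ⟨C, hC, hP⟩ := h.exists_avg_center_sq_le
  set H : ℝ → USphere n → ℝ := fun t x => (D.center.y t x ^ 2 + D.center.yt t x ^ 2) / t ^ 2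
  have H0 : ∀ t x, 0 ≤ H t x := fun t x => by positivity
  have cN : Continuous fun z : ℝ × USphere n =>
      D.center.y z.1 z.2 ^ 2 + D.center.yt z.1 z.2 ^ 2 :=
    (D.center.cont_y.pow 2).add (D.center.cont_yt.pow 2)
  have mH : Measurable fun z : ℝ × USphere n => H z.1 z.2 :=
    cN.measurable.div (measurable_fst.pow_const 2)
  have cH : ∀ t, Continuous (H t) := fun t =>
    (slice (f := fun t x => D.center.y t x ^ 2 + D.center.yt t x ^ 2) cN t).div_const _
  set K := 4 + (2 * C + 2) with hK
  set G : ℝ → ℝ := fun t => K * (t ^ 2)⁻¹ + K * avg (D.ytt t)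
  have avgH : ∀ t ∈ Ioi (1 : ℝ), avg (H t) ≤ G t := by
    intro t ht
    have ht : 1 < t := ht
    have e : avg (H t) = (avg (fun x => D.center.y t x ^ 2) +
        avg (fun x => D.center.yt t x ^ 2)) * (t ^ 2)⁻¹ := by
      have c1 : Continuous fun x => D.center.y t x ^ 2 := (slice D.center.cont_y t).pow 2
      have c2 : Continuous fun x => D.center.yt t x ^ 2 := (slice D.center.cont_yt t).pow 2
      rw [← avg_add c1 c2, ← avg_mul_const]
      rfl
    have h1 := h.avg_center_yt_sq_le t
    have h2 := hP t
    have h3 := h.avg_tang_le t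
    have h4 := h.avg_ytt_nonneg t
    have h5 : (t ^ 2)⁻¹ ≤ 1 := inv_le_one_of_one_le₀ (by nlinarith)
    have h6 : 0 < (t ^ 2)⁻¹ := by positivity
    have h7 : avg (fun x => D.center.y t x ^ 2) + avg (fun x => D.center.yt t x ^ 2) ≤
        K + K * avg (D.ytt t) := by
      have := mul_le_mul_of_nonneg_left h3 hC.le
      rw [hK]
      nlinarith
    rw [e]
    refine (mul_le_mul_of_nonneg_right h7 h6.le).trans ?_
    have : K * avg (D.ytt t) * (t ^ 2)⁻¹ ≤ K * avg (D.ytt t) * 1 :=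
      mul_le_mul_of_nonneg_left h5 (by positivity)
    simp only [G]
    linarith
  have intG : IntegrableOn G (Ioi 1) := by
    have hbdd : BddAbove (range fun t => avg (D.yt t)) :=
      ⟨2, by rintro _ ⟨t, rfl⟩; exact h.avg_yt_le_two t⟩
    have hlim := tendsto_atTop_ciSup h.monotone_avg_yt hbdd
    have hlim2 : Tendsto (fun t : ℝ => -t⁻¹) atTop (nhds (-0)) := tendsto_inv_atTop_zero.neg
    refine integrableOn_Ioi_deriv_of_nonneg' (g := fun t => K * (-t⁻¹) + K * avg (D.yt t))
      (fun t ht => ?_) (fun t _ => ?_) ((hlim2.const_mul K).add (hlim.const_mul K))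
    · have ht : 1 ≤ t := ht
      refine (((hasDerivAt_inv (by linarith : t ≠ 0)).neg.const_mul K).add
        ((D.hasDerivAt_avg_yt t).const_mul K)).congr_deriv ?_
      simp only [G, neg_neg]
    · have := h.avg_ytt_nonneg t
      positivity
  have hfin : ∫⁻ x, ∫⁻ t in Ioi (1 : ℝ), ENNReal.ofReal (H t x) ∂volume ∂sphereProb n ≠ ⊤ := by
    rw [lintegral_lintegral_swap (f := fun x t => ENNReal.ofReal (H t x))
      (mH.comp measurable_swap).ennreal_ofReal.aemeasurable]
    have hle : ∫⁻ t in Ioi (1 : ℝ), ∫⁻ x, ENNReal.ofReal (H t x) ∂sphereProb n ≤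
        ∫⁻ t in Ioi (1 : ℝ), ENNReal.ofReal (G t) := by
      refine setLIntegral_mono_ae' measurableSet_Ioi (Eventually.of_forall fun t ht => ?_)
      rw [← ofReal_integral_eq_lintegral_ofReal (integrable_sphereProb (cH t))
        (Eventually.of_forall (H0 t))]
      exact ENNReal.ofReal_le_ofReal (avgH t ht)
    refine ne_top_of_le_ne_top ?_ hle
    exact intG.lintegral_lt_top.ne
  have mI : Measurable fun x => ∫⁻ t in Ioi (1 : ℝ), ENNReal.ofReal (H t x) :=
    Measurable.lintegral_prod_right' (f := fun z : USphere n × ℝ => ENNReal.ofReal (H z.2 z.1))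
      (mH.comp measurable_swap).ennreal_ofReal
  obtain ⟨x, hx⟩ := (ae_lt_top mI hfin).exists
  refine ⟨x, ?_⟩
  have mHx : Measurable fun t => H t x := mH.comp (measurable_id.prodMk measurable_const)
  have iH : IntegrableOn (fun t => H t x) (Ioi 1) :=
    ⟨mHx.aestronglyMeasurable, by
      rw [hasFiniteIntegral_iff_ofReal (Eventually.of_forall fun t => H0 t x)]
      exact hx⟩
  have cy : Continuous fun t => D.center.y t x :=
    D.center.cont_y.comp (by fun_prop : Continuous fun t : ℝ => (t, x))
  have cyt : Continuous fun t => D.center.yt t x :=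
    D.center.cont_yt.comp (by fun_prop : Continuous fun t : ℝ => (t, x))
  refine tendsto_zero_of_hasDerivAt_of_integrableOn_Ioi (a := 1)
    (f' := fun t => 2 * D.center.y t x * D.center.yt t x / t ^ 2 -
      2 * D.center.y t x ^ 2 / t ^ 3) (fun t ht => ?_) ?_ ?_
  · have ht : 1 < t := ht
    have ht0 : t ≠ 0 := by linarith
    refine (((D.center.hasDerivAt_y t x).pow 2).div ((hasDerivAt_id t).pow 2)
      (pow_ne_zero 2 ht0)).congr_deriv ?_
    simp only [id, Pi.pow_apply]
    push_cast
    field_simp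
  · refine (iH.const_mul 3).mono' (Measurable.aestronglyMeasurable (by fun_prop)) ?_
    refine (ae_restrict_iff' measurableSet_Ioi).2 (Eventually.of_forall fun t ht => ?_)
    have ht : 1 < t := ht
    have ht0 : t ≠ 0 := by linarith
    set w := D.center.y t x
    set v := D.center.yt t x
    have e : 2 * w * v / t ^ 2 - 2 * w ^ 2 / t ^ 3 = (2 * w * v - 2 * w ^ 2 * t⁻¹) / t ^ 2 := by
      field_simp
    have e2 : 3 * H t x = (3 * (w ^ 2 + v ^ 2)) / t ^ 2 := by
      simp only [H, w, v]; ring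
    rw [e, e2, Real.norm_eq_abs, abs_div, abs_of_pos (by positivity : 0 < t ^ 2)]
    have hti : t⁻¹ ≤ 1 := inv_le_one_of_one_le₀ ht.le
    have hti0 : 0 < t⁻¹ := by positivity
    gcongr
    refine abs_le.2 ⟨?_, ?_⟩ <;>
      nlinarith [sq_nonneg (w - v), sq_nonneg (w + v), mul_nonneg (sq_nonneg w) hti0.le,
        mul_nonneg (sq_nonneg w) (sub_nonneg.2 hti)]
  · refine iH.mono' (Measurable.aestronglyMeasurable (by fun_prop))
      (Eventually.of_forall fun t => ?_)
    rw [Real.norm_eq_abs, abs_of_nonneg (by positivity)]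
    simp only [H]
    gcongr
    nlinarith [sq_nonneg (D.center.yt t x)]

/-- Either the function is radially constant, or it grows superlinearly along some ray. -/
theorem exists_ray_of_avg_yt_pos {a : ℝ} (ha : 0 < avg (D.yt a)) :
    ∃ x C, ∀ t ≥ 0, 5 / 4 * t - C ≤ D.y t x := by
  obtain ⟨b, hb⟩ := h.exists_three_halves_le_avg_yt ha
  obtain ⟨x, hx⟩ := h.exists_tendsto_center
  have hev := hx.eventually_lt_const (by norm_num : (0 : ℝ) < 1 / 16)
  obtain ⟨T, hT⟩ := eventually_atTop.1 (hev.and (eventually_ge_atTop (max b 1)))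
  have cy : Continuous fun t => D.y t x - 5 / 4 * t :=
    (D.cont_y.comp (by fun_prop : Continuous fun t : ℝ => (t, x))).sub (by fun_prop)
  obtain ⟨m, hm⟩ := (isCompact_Icc (a := (0 : ℝ)) (b := T)).bddBelow_image cy.continuousOn
  refine ⟨x, max (-m) (3 / 2 * b - avg (D.y b)), fun t ht => ?_⟩
  rcases le_total t T with htT | htT
  · have := hm (mem_image_of_mem _ ⟨ht, htT⟩)
    have := le_max_left (-m) (3 / 2 * b - avg (D.y b))
    linarith
  · obtain ⟨h1, h2⟩ := hT t htT
    have hbt : b ≤ t := (le_max_left _ _).trans h2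
    have ht1 : 1 ≤ t := (le_max_right _ _).trans h2
    have hU := add_mul_le_of_le_deriv D.hasDerivAt_avg_y
      (fun s hs => hb.trans (h.monotone_avg_yt hs)) hbt
    rw [div_lt_iff₀ (by positivity)] at h1
    have h3 : |D.center.y t x| ≤ t / 4 := abs_le_of_sq_le_sq (by nlinarith) (by linarith)
    have h4 : D.center.y t x = D.y t x + -avg (D.y t) := rfl
    have := le_max_right (-m) (3 / 2 * b - avg (D.y b))
    have := neg_abs_le (D.center.y t x)
    linarith

theorem yt_eq_zero_or_exists_ray :
    (∀ t x, D.yt t x = 0) ∨ ∃ x C, ∀ t ≥ 0, 5 / 4 * t - C ≤ D.y t x := by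
  by_cases h0 : ∀ t, avg (D.yt t) = 0
  · exact Or.inl (h.yt_eq_zero h0)
  · push Not at h0
    obtain ⟨a, ha⟩ := h0
    exact Or.inr (h.exists_ray_of_avg_yt_pos (lt_of_le_of_ne (h.avg_yt_nonneg a) ha.symm))

end CylFun.Admissible

section rotations

variable {n : ℕ}

/-- `rotField` as a continuous linear map. -/
noncomputable def rotCLM (q : Fin n × Fin n) :
    EuclideanSpace ℝ (Fin n) →L[ℝ] EuclideanSpace ℝ (Fin n) :=
  (EuclideanSpace.proj q.1).smulRight (EuclideanSpace.single q.2 (1 : ℝ)) -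
    (EuclideanSpace.proj q.2).smulRight (EuclideanSpace.single q.1 (1 : ℝ))

theorem rotCLM_apply (q : Fin n × Fin n) (x : EuclideanSpace ℝ (Fin n)) :
    rotCLM q x = rotField q x := by
  simp [rotCLM, rotField]

theorem sum_smul_single (x : EuclideanSpace ℝ (Fin n)) :
    ∑ i, x i • EuclideanSpace.single i (1 : ℝ) = x := by
  ext j
  simp [Finset.sum_apply, Pi.single_apply]

theorem apply_eq_sum (L : EuclideanSpace ℝ (Fin n) →L[ℝ] ℝ) (x : EuclideanSpace ℝ (Fin n)) :
    L x = ∑ i, x i * L (EuclideanSpace.single i 1) := by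
  conv_lhs => rw [← sum_smul_single x]
  simp [map_sum]

theorem sum_rotField_rotField (x : EuclideanSpace ℝ (Fin n)) :
    ∑ q, rotField q (rotField q x) = (-2 * ((n : ℝ) - 1)) • x := by
  have key : ∀ i j : Fin n, rotField (i, j) (rotField (i, j) x) =
      -(x j • EuclideanSpace.single j (1 : ℝ)) - x i • EuclideanSpace.single i (1 : ℝ) +
        if i = j then (2 * x i) • EuclideanSpace.single i (1 : ℝ) else 0 := by
    intro i j
    by_cases hij : i = j
    · subst hij
      simp [rotField, two_mul, add_smul]
    · have hji : ¬ j = i := fun h => hij h.symm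
      simp [rotField, hij, hji]
  rw [Fintype.sum_prod_type]
  simp only [key, Finset.sum_add_distrib, Finset.sum_sub_distrib, Finset.sum_neg_distrib,
    Finset.sum_const, Finset.card_univ, Fintype.card_fin, sum_smul_single, Finset.sum_ite_eq,
    Finset.mem_univ, if_true, mul_smul, ← Finset.smul_sum]
  rw [← Nat.cast_smul_eq_nsmul ℝ, ← neg_smul, ← mul_smul]
  module

/-- Lagrange's identity for a bilinear form. -/
theorem sum_bilin_rotField
    (B : EuclideanSpace ℝ (Fin n) →L[ℝ] EuclideanSpace ℝ (Fin n) →L[ℝ] ℝ)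
    {x : EuclideanSpace ℝ (Fin n)} (hx : ‖x‖ = 1) :
    (1 / 2) * ∑ q, B (rotField q x) (rotField q x) =
      ∑ i, B (EuclideanSpace.single i 1) (EuclideanSpace.single i 1) - B x x := by
  have hx2 : ∑ i, x i * x i = 1 := by
    have := EuclideanSpace.real_norm_sq_eq x
    rw [hx] at this
    rw [← one_pow 2, this]
    exact Finset.sum_congr rfl fun i _ => by ring
  set b : Fin n → Fin n → ℝ := fun i j =>
    B (EuclideanSpace.single i 1) (EuclideanSpace.single j 1) with hb
  have key : ∀ i j : Fin n, B (rotField (i, j) x) (rotField (i, j) x) =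
      x i * x i * b j j - x i * (x j * b i j) - x j * (x i * b j i) + x j * x j * b i i := by
    intro i j
    simp only [rotField, map_sub, map_smul, sub_apply, smul_apply, smul_eq_mul, hb]
    ring
  have hBx : B x x = ∑ i, ∑ j, x i * (x j * b i j) := by
    rw [apply_eq_sum (B x) x]
    have : ∀ j, B x (EuclideanSpace.single j 1) = ∑ i, x i * b i j := fun j =>
      apply_eq_sum (B.flip (EuclideanSpace.single j 1)) x
    simp only [this, Finset.mul_sum]
    rw [Finset.sum_comm]
    exact Finset.sum_congr rfl fun i _ => Finset.sum_congr rfl fun j _ => by ring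
  have s1 : ∑ i, ∑ j, x i * x i * b j j = ∑ j, b j j := by
    simp only [← Finset.mul_sum]
    rw [← Finset.sum_mul, hx2, one_mul]
  have s2 : ∑ i, ∑ j, x j * x j * b i i = ∑ j, b j j := by
    simp only [← Finset.sum_mul, hx2, one_mul]
  have s3 : ∑ i, ∑ j, x j * (x i * b j i) = B x x := by
    rw [Finset.sum_comm, hBx]
  rw [Fintype.sum_prod_type]
  simp only [key, Finset.sum_add_distrib, Finset.sum_sub_distrib, s1, s2, s3, ← hBx]
  ring

end rotations

namespace CylFun

variable {n : ℕ}

/-- A `C²` function on Euclidean space in exponential polar coordinates around `p`. -/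
noncomputable def ofContDiff (u : EuclideanSpace ℝ (Fin n) → ℝ) (hu : ContDiff ℝ 2 u)
    (p : EuclideanSpace ℝ (Fin n)) : CylFun n where
  y t x := u (p + Real.exp t • (x : EuclideanSpace ℝ (Fin n)))
  yt t x := Real.exp t * fderiv ℝ u (p + Real.exp t • (x : EuclideanSpace ℝ (Fin n))) x
  ytt t x := Real.exp t * fderiv ℝ u (p + Real.exp t • (x : EuclideanSpace ℝ (Fin n))) x +
    Real.exp t ^ 2 *
      fderiv ℝ (fderiv ℝ u) (p + Real.exp t • (x : EuclideanSpace ℝ (Fin n))) x x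
  y₁ q t x := Real.exp t *
    fderiv ℝ u (p + Real.exp t • (x : EuclideanSpace ℝ (Fin n))) (rotField q x)
  y₂ q t x := Real.exp t * fderiv ℝ u (p + Real.exp t • (x : EuclideanSpace ℝ (Fin n)))
      (rotField q (rotField q x)) +
    Real.exp t ^ 2 * fderiv ℝ (fderiv ℝ u) (p + Real.exp t • (x : EuclideanSpace ℝ (Fin n)))
      (rotField q x) (rotField q x)
  cont_y := hu.continuous.comp (by fun_prop)
  cont_yt := by
    have := hu.continuous_fderiv (by norm_num)
    fun_prop
  cont_ytt := by
    have h1 := hu.continuous_fderiv (by norm_num)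
    have h2 := (hu.fderiv_right (m := 1) (by norm_num)).continuous_fderiv (by norm_num)
    fun_prop
  cont_y₁ q := by
    have := hu.continuous_fderiv (by norm_num)
    simp only [← rotCLM_apply]
    fun_prop
  cont_y₂ q := by
    have h1 := hu.continuous_fderiv (by norm_num)
    have h2 := (hu.fderiv_right (m := 1) (by norm_num)).continuous_fderiv (by norm_num)
    simp only [← rotCLM_apply]
    fun_prop
  hasDerivAt_y t x := by
    have hz : HasDerivAt (fun t : ℝ => p + Real.exp t • (x : EuclideanSpace ℝ (Fin n)))
      (Real.exp t • (x : EuclideanSpace ℝ (Fin n))) t :=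
      ((Real.hasDerivAt_exp t).smul_const _).const_add p
    refine (((hu.differentiable (by norm_num)) _).hasFDerivAt.comp_hasDerivAt t hz).congr_deriv ?_
    simp
  hasDerivAt_yt t x := by
    have hz : HasDerivAt (fun t : ℝ => p + Real.exp t • (x : EuclideanSpace ℝ (Fin n)))
      (Real.exp t • (x : EuclideanSpace ℝ (Fin n))) t :=
      ((Real.hasDerivAt_exp t).smul_const _).const_add p
    have h2 := (((hu.fderiv_right (m := 1) (by norm_num)).differentiable (by norm_num))
      _).hasFDerivAt.comp_hasDerivAt t hz
    refine ((Real.hasDerivAt_exp t).mul (h2.clm_apply (hasDerivAt_const t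
      (x : EuclideanSpace ℝ (Fin n))))).congr_deriv ?_
    simp
    ring
  hasRot_y q t x s := by
    have hz : HasDerivAt (fun s : ℝ => p + Real.exp t • rot q s (x : EuclideanSpace ℝ (Fin n)))
      (Real.exp t • rotField q (rot q s (x : EuclideanSpace ℝ (Fin n)))) s :=
      ((hasDerivAt_rot q x s).fun_const_smul (Real.exp t)).const_add p
    refine (((hu.differentiable (by norm_num)) _).hasFDerivAt.comp_hasDerivAt s hz).congr_deriv ?_
    rw [map_smul, smul_eq_mul]
    rfl
  hasRot_y₁ q t x s := by
    have hz : HasDerivAt (fun s : ℝ => p + Real.exp t • rot q s (x : EuclideanSpace ℝ (Fin n)))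
      (Real.exp t • rotField q (rot q s (x : EuclideanSpace ℝ (Fin n)))) s :=
      ((hasDerivAt_rot q x s).fun_const_smul (Real.exp t)).const_add p
    have h2 := (((hu.fderiv_right (m := 1) (by norm_num)).differentiable (by norm_num))
      _).hasFDerivAt.comp_hasDerivAt s hz
    have h3 := (rotCLM q).hasFDerivAt.comp_hasDerivAt s (hasDerivAt_rot q x s)
    simp only [← rotCLM_apply] at h2 h3 ⊢
    refine ((h2.clm_apply h3).const_mul (Real.exp t)).congr_deriv ?_
    simp only [Function.comp_apply, map_smul, smul_apply, smul_eq_mul]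
    change _ = Real.exp t * fderiv ℝ u (p + Real.exp t • rot q s (x : EuclideanSpace ℝ (Fin n)))
      (rotCLM q (rotCLM q (rot q s (x : EuclideanSpace ℝ (Fin n))))) + Real.exp t ^ 2 * fderiv ℝ
      (fderiv ℝ u) (p + Real.exp t • rot q s (x : EuclideanSpace ℝ (Fin n)))
      (rotCLM q (rot q s (x : EuclideanSpace ℝ (Fin n))))
      (rotCLM q (rot q s (x : EuclideanSpace ℝ (Fin n))))
    ring

variable {u : EuclideanSpace ℝ (Fin n) → ℝ} (hu : ContDiff ℝ 2 u) (p : EuclideanSpace ℝ (Fin n))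

theorem ofContDiff_elap (t : ℝ) (x : USphere n) : (ofContDiff u hu p).elap t x =
    Real.exp t ^ 2 * ∑ i, fderiv ℝ (fderiv ℝ u) (p + Real.exp t • (x : EuclideanSpace ℝ (Fin n)))
      (EuclideanSpace.single i 1) (EuclideanSpace.single i 1) := by
  have h1 := sum_bilin_rotField (fderiv ℝ (fderiv ℝ u)
    (p + Real.exp t • (x : EuclideanSpace ℝ (Fin n)))) (norm_usphere x)
  have h2 := congrArg (fderiv ℝ u (p + Real.exp t • (x : EuclideanSpace ℝ (Fin n))))
    (sum_rotField_rotField (x : EuclideanSpace ℝ (Fin n)))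
  rw [map_sum, map_smul, smul_eq_mul] at h2
  simp only [elap, lap, ofContDiff, Finset.sum_add_distrib, ← Finset.mul_sum, h2]
  linear_combination Real.exp t ^ 2 * h1

theorem ofContDiff_yt_sq_add_tang (t : ℝ) (x : USphere n) :
    (ofContDiff u hu p).yt t x ^ 2 + (ofContDiff u hu p).tang t x =
    Real.exp t ^ 2 * ∑ i, fderiv ℝ u (p + Real.exp t • (x : EuclideanSpace ℝ (Fin n)))
      (EuclideanSpace.single i 1) ^ 2 := by
  set L := fderiv ℝ u (p + Real.exp t • (x : EuclideanSpace ℝ (Fin n))) with hL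
  have h1 := sum_bilin_rotField (L.smulRight L) (norm_usphere x)
  simp only [ContinuousLinearMap.smulRight_apply, smul_apply, smul_eq_mul, ← sq] at h1
  simp only [tang, ofContDiff, ← hL, mul_pow, ← Finset.mul_sum]
  linear_combination Real.exp t ^ 2 * h1

end CylFun

section logarithm

variable {n : ℕ} {φ : EuclideanSpace ℝ (Fin n) → ℝ} (hφ : ContDiff ℝ 2 φ) (hpos : ∀ x, 0 < φ x)
include hφ hpos

theorem contDiff_log_comp : ContDiff ℝ 2 fun z => Real.log (φ z) :=
  hφ.log fun x => (hpos x).ne'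

theorem fderiv_eq_mul_fderiv_log (z v : EuclideanSpace ℝ (Fin n)) :
    fderiv ℝ φ z v = φ z * fderiv ℝ (fun z => Real.log (φ z)) z v := by
  rw [fderiv.log (hφ.differentiable (by norm_num) z) (hpos z).ne', smul_apply, smul_eq_mul,
    mul_inv_cancel_left₀ (hpos z).ne']

theorem hess2_eq_mul_log (z v : EuclideanSpace ℝ (Fin n)) :
    hess2 φ z v = φ z * (fderiv ℝ (fderiv ℝ fun z => Real.log (φ z)) z v v +
      fderiv ℝ (fun z => Real.log (φ z)) z v ^ 2) := by
  have hu := contDiff_log_comp hφ hpos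
  have h1 : HasFDerivAt φ (fderiv ℝ φ z) z := (hφ.differentiable (by norm_num) z).hasFDerivAt
  have h2 := (((hu.fderiv_right (m := 1) (by norm_num)).differentiable
    (by norm_num) z).hasFDerivAt).clm_apply (hasFDerivAt_const v z)
  have h3 := (h1.mul h2).fderiv
  unfold hess2
  rw [show (fun y => fderiv ℝ φ y v) = fun y => φ y * fderiv ℝ (fun z => Real.log (φ z)) y v from
    funext fun y => fderiv_eq_mul_fderiv_log hφ hpos y v]
  refine (congrArg (fun L => L v) h3).trans ?_
  simp [fderiv_eq_mul_fderiv_log hφ hpos z v]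
  ring

theorem lapl_eq_mul_log (z : EuclideanSpace ℝ (Fin n)) :
    lapl φ z = φ z * (∑ i, fderiv ℝ (fderiv ℝ fun z => Real.log (φ z)) z
      (EuclideanSpace.single i 1) (EuclideanSpace.single i 1) +
      ∑ i, fderiv ℝ (fun z => Real.log (φ z)) z (EuclideanSpace.single i 1) ^ 2) := by
  simp only [lapl, hess2_eq_mul_log hφ hpos, ← Finset.mul_sum, Finset.sum_add_distrib]

theorem norm_gradient_sq_eq_mul_log (z : EuclideanSpace ℝ (Fin n)) :
    ‖gradient φ z‖ ^ 2 =
      φ z ^ 2 * ∑ i, fderiv ℝ (fun z => Real.log (φ z)) z (EuclideanSpace.single i 1) ^ 2 := by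
  have key : ∀ i, gradient φ z i = fderiv ℝ φ z (EuclideanSpace.single i 1) := fun i => by
    have := InnerProductSpace.toDual_symm_apply (𝕜 := ℝ) (x := EuclideanSpace.single i (1 : ℝ))
      (y := fderiv ℝ φ z)
    rw [← this, EuclideanSpace.inner_single_right]
    simp [gradient]
  rw [EuclideanSpace.real_norm_sq_eq]
  simp only [key, fderiv_eq_mul_fderiv_log hφ hpos, mul_pow, Finset.mul_sum]

end logarithm

section center

variable {n : ℕ} [NeZero n] {u : EuclideanSpace ℝ (Fin n) → ℝ} (hu : ContDiff ℝ 2 u)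
  (p : EuclideanSpace ℝ (Fin n))

omit [NeZero n] in
theorem CylFun.ofContDiff_bounded : ∃ B, ∀ t ≤ 0, ∀ x,
    |(ofContDiff u hu p).y t x| ≤ B ∧ |(ofContDiff u hu p).yt t x| ≤ Real.exp t * B := by
  have hK := isCompact_closedBall p 1
  obtain ⟨A, hA⟩ := hK.exists_bound_of_continuousOn hu.continuous.continuousOn
  obtain ⟨A', hA'⟩ := hK.exists_bound_of_continuousOn
    (hu.continuous_fderiv (by norm_num)).continuousOn
  refine ⟨max A A', fun t ht x => ?_⟩
  have hz : p + Real.exp t • (x : EuclideanSpace ℝ (Fin n)) ∈ Metric.closedBall p 1 := by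
    simp [norm_smul, ht]
  refine ⟨(hA _ hz).trans (le_max_left _ _), ?_⟩
  simp only [ofContDiff, abs_mul, Real.abs_exp]
  have := (fderiv ℝ u (p + Real.exp t • (x : EuclideanSpace ℝ (Fin n)))).le_opNorm x
  rw [norm_usphere, mul_one] at this
  gcongr
  exact (this.trans (hA' _ hz)).trans (le_max_right _ _)

theorem CylFun.ofContDiff_tendsto_avg_yt :
    Tendsto (fun t => avg ((ofContDiff u hu p).yt t)) atBot (nhds 0) := by
  obtain ⟨B, hB⟩ := ofContDiff_bounded hu p
  refine squeeze_zero_norm' (a := fun t => Real.exp t * B) ?_ ?_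
  · filter_upwards [eventually_le_atBot 0] with t ht
    have c := slice (ofContDiff u hu p).cont_yt t
    rw [Real.norm_eq_abs, abs_le]
    have e : ∀ c, avg (fun _ : USphere n => c) = c := avg_const
    constructor
    · rw [← e (-(Real.exp t * B))]
      exact avg_mono continuous_const c fun x => (abs_le.1 (hB t ht x).2).1
    · rw [← e (Real.exp t * B)]
      exact avg_mono c continuous_const fun x => (abs_le.1 (hB t ht x).2).2
  · simpa using Real.tendsto_exp_atBot.mul_const B

theorem sphereIntegral_nonneg_iff_avg {r : ℝ} (hr : 0 < r) (F : EuclideanSpace ℝ (Fin n) → ℝ) :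
    0 ≤ sphereIntegral p r F ↔
      0 ≤ avg fun x : USphere n => F (p + r • (x : EuclideanSpace ℝ (Fin n))) := by
  have h0 : (volume : Measure (EuclideanSpace ℝ (Fin n))).toSphere univ ≠ 0 := by
    have : Nontrivial (EuclideanSpace ℝ (Fin n)) := by
      have : Nonempty (Fin n) := ⟨0⟩
      infer_instance
    rw [Ne, Measure.measure_univ_eq_zero]
    exact Measure.toSphere_ne_zero _
  rw [sphereIntegral, avg, sphereProb, integral_smul_measure, smul_eq_mul,
    mul_nonneg_iff_of_pos_left (pow_pos hr _), mul_nonneg_iff_of_pos_left]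
  exact ENNReal.toReal_pos (ENNReal.inv_ne_zero.2 (measure_ne_top _ _))
    (ENNReal.inv_ne_top.2 h0)

end center

section rigidity

variable {n : ℕ} [NeZero n] {φ : EuclideanSpace ℝ (Fin n) → ℝ} (hφ : ContDiff ℝ 2 φ)
  (hpos : ∀ x, 0 < φ x) (p : EuclideanSpace ℝ (Fin n))

theorem admissible_log (hn : 3 ≤ n) {τ : ℝ} (hτ : 0 < τ)
    (hscal : ∀ x, n * ‖gradient φ x‖ ^ 2 ≤ 2 * φ x * lapl φ x)
    (hSchouten : ∀ r : ℝ, 0 < r →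
      0 ≤ sphereIntegral p r (fun x =>
        (φ x)⁻¹ ^ 2 * ((n - 2) * φ x * hess2 φ x (‖x - p‖⁻¹ • (x - p))
          + (1 - τ) * φ x * lapl φ x - (n - 1 - τ * n / 2) * ‖gradient φ x‖ ^ 2))) :
    (CylFun.ofContDiff _ (contDiff_log_comp hφ hpos) p).Admissible τ := by
  have hu := contDiff_log_comp hφ hpos
  set D := CylFun.ofContDiff _ hu p with hD
  refine ⟨hn, hτ, fun t x => ?_, fun t => ?_, ?_, CylFun.ofContDiff_tendsto_avg_yt hu p⟩
  · rw [CylFun.excess, CylFun.ofContDiff_elap, CylFun.ofContDiff_yt_sq_add_tang]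
    have h1 := hscal (p + Real.exp t • (x : EuclideanSpace ℝ (Fin n)))
    rw [lapl_eq_mul_log hφ hpos, norm_gradient_sq_eq_mul_log hφ hpos] at h1
    have h2 := hpos (p + Real.exp t • (x : EuclideanSpace ℝ (Fin n)))
    set a := φ (p + Real.exp t • (x : EuclideanSpace ℝ (Fin n)))
    set S := ∑ i, fderiv ℝ (fun z => Real.log (φ z))
      (p + Real.exp t • (x : EuclideanSpace ℝ (Fin n))) (EuclideanSpace.single i 1) ^ 2
    set T := ∑ i, fderiv ℝ (fderiv ℝ (fun z => Real.log (φ z)))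
      (p + Real.exp t • (x : EuclideanSpace ℝ (Fin n))) (EuclideanSpace.single i 1)
      (EuclideanSpace.single i 1)
    have h3 : 0 ≤ a ^ 2 * (2 * (T + S) - n * S) := by linarith
    have h4 := nonneg_of_mul_nonneg_right h3 (by positivity)
    have h5 := mul_nonneg (sq_nonneg (Real.exp t)) h4
    linarith
  · have h1 := (sphereIntegral_nonneg_iff_avg p (Real.exp_pos t) _).1
      (hSchouten _ (Real.exp_pos t))
    have h2 : ∀ x : USphere n, Real.exp t ^ 2 *
        ((fun x => (φ x)⁻¹ ^ 2 * ((n - 2) * φ x * hess2 φ x (‖x - p‖⁻¹ • (x - p))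
          + (1 - τ) * φ x * lapl φ x - (n - 1 - τ * n / 2) * ‖gradient φ x‖ ^ 2))
          (p + Real.exp t • (x : EuclideanSpace ℝ (Fin n)))) =
        (n - 2) * (D.ytt t x - D.yt t x) + (1 - τ) * D.excess t x +
          (n - 2) / 2 * (D.yt t x ^ 2 - D.tang t x) := by
      intro x
      have e1 := CylFun.ofContDiff_elap hu p t x
      have e2 := CylFun.ofContDiff_yt_sq_add_tang hu p t x
      have e3 : ‖p + Real.exp t • (x : EuclideanSpace ℝ (Fin n)) - p‖⁻¹ •
          (p + Real.exp t • (x : EuclideanSpace ℝ (Fin n)) - p) = x := by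
        rw [add_sub_cancel_left, norm_smul, norm_usphere, mul_one, Real.norm_eq_abs,
          Real.abs_exp, inv_smul_smul₀ (Real.exp_ne_zero t)]
      have e4 : D.yt t x = Real.exp t * fderiv ℝ (fun z => Real.log (φ z))
        (p + Real.exp t • (x : EuclideanSpace ℝ (Fin n))) x := rfl
      have e5 : D.ytt t x = D.yt t x + Real.exp t ^ 2 *
        fderiv ℝ (fderiv ℝ (fun z => Real.log (φ z)))
        (p + Real.exp t • (x : EuclideanSpace ℝ (Fin n))) x x := rfl
      have h2 := (hpos (p + Real.exp t • (x : EuclideanSpace ℝ (Fin n)))).ne'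
      rw [← hD] at e1 e2
      simp only [e3, hess2_eq_mul_log hφ hpos, lapl_eq_mul_log hφ hpos,
        norm_gradient_sq_eq_mul_log hφ hpos]
      simp only [CylFun.excess]
      set a := φ (p + Real.exp t • (x : EuclideanSpace ℝ (Fin n)))
      set S := ∑ i, fderiv ℝ (fun z => Real.log (φ z))
        (p + Real.exp t • (x : EuclideanSpace ℝ (Fin n))) (EuclideanSpace.single i 1) ^ 2
      set T := ∑ i, fderiv ℝ (fderiv ℝ (fun z => Real.log (φ z)))
        (p + Real.exp t • (x : EuclideanSpace ℝ (Fin n))) (EuclideanSpace.single i 1)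
        (EuclideanSpace.single i 1)
      set g := fderiv ℝ (fun z => Real.log (φ z))
        (p + Real.exp t • (x : EuclideanSpace ℝ (Fin n))) x
      set k := fderiv ℝ (fderiv ℝ (fun z => Real.log (φ z)))
        (p + Real.exp t • (x : EuclideanSpace ℝ (Fin n))) x x
      have e6 : D.tang t x = Real.exp t ^ 2 * S - Real.exp t ^ 2 * g ^ 2 := by
        rw [← e2, e4]; ring
      rw [e1, e6, e5, e4]
      field_simp
      ring
    have c1 := CylFun.slice D.cont_yt t
    have c2 := CylFun.slice D.cont_ytt t
    have c3 := CylFun.slice D.cont_excess t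
    have c4 := CylFun.slice D.cont_tang t
    have h3 := mul_nonneg (sq_nonneg (Real.exp t)) h1
    rw [← avg_const_mul] at h3
    simp only [h2] at h3
    rw [avg_add (by fun_prop) (by fun_prop), avg_add (by fun_prop) (by fun_prop), avg_const_mul,
      avg_const_mul, avg_const_mul, avg_sub (by fun_prop) (by fun_prop),
      avg_sub (by fun_prop) (by fun_prop)] at h3
    have h4 := D.avg_excess t
    linear_combination h3 + h4
  · obtain ⟨B, hB⟩ := CylFun.ofContDiff_bounded hu p
    refine ⟨B, fun t ht x => ⟨(hB t ht x).1, (hB t ht x).2.trans ?_⟩⟩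
    have hB0 : 0 ≤ B := (abs_nonneg _).trans (hB t ht x).1
    exact mul_le_of_le_one_left hB0 (Real.exp_le_one_iff.2 ht)

end rigidity

/-- Rigidity of conformal metrics on `ℝⁿ` with nonnegative scalar
curvature whose modified Schouten tensor has nonnegative radial spherical averages. -/
theorem stmt1 {n : ℕ} (hn : 3 ≤ n) (τ : ℝ) (hτ0 : 0 < τ) (hτ1 : τ < 2 * (n - 1) / n)
    (φ : EuclideanSpace ℝ (Fin n) → ℝ) (hφ : ContDiff ℝ (⊤ : ℕ∞) φ) (hφpos : ∀ x, 0 < φ x)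
    -- completeness of `g = φ⁻² g₀` : every divergent `C¹` curve has infinite `g`-length
    (hcomplete : ∀ γ : ℝ → EuclideanSpace ℝ (Fin n), ContDiff ℝ 1 γ →
      Tendsto (fun t => ‖γ t‖) atTop atTop →
      ∫⁻ t in Ioi (0 : ℝ), ENNReal.ofReal ((φ (γ t))⁻¹ * ‖deriv γ t‖) = ⊤)
    -- nonnegative scalar curvature `R_g ≥ 0`
    (hscal : ∀ x, n * ‖gradient φ x‖ ^ 2 ≤ 2 * φ x * lapl φ x)
    -- nonnegative spherical average of the radial modified Schouten tensor
    (p : EuclideanSpace ℝ (Fin n))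
    (hSchouten : ∀ r : ℝ, 0 < r →
      0 ≤ sphereIntegral p r (fun x =>
        (φ x)⁻¹ ^ 2 * ((n - 2) * φ x * hess2 φ x (‖x - p‖⁻¹ • (x - p))
          + (1 - τ) * φ x * lapl φ x - (n - 1 - τ * n / 2) * ‖gradient φ x‖ ^ 2))) :
    ∃ c : ℝ, ∀ x, φ x = c := by
  have : NeZero n := ⟨by omega⟩
  have hφ2 : ContDiff ℝ 2 φ := mod_cast contDiff_infty.1 hφ 2
  have hu := contDiff_log_comp hφ2 hφpos
  have hadm := admissible_log hφ2 hφpos p hn hτ0 hscal hSchouten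
  rcases hadm.yt_eq_zero_or_exists_ray with h0 | ⟨x, C, hC⟩
  · refine ⟨φ p, fun z => ?_⟩
    rcases eq_or_ne z p with rfl | hz
    · rfl
    have hzp : 0 < ‖z - p‖ := norm_pos_iff.2 (sub_ne_zero.2 hz)
    set D := CylFun.ofContDiff _ hu p with hD
    let x : USphere n := ⟨‖z - p‖⁻¹ • (z - p), by
      simp [norm_smul, inv_mul_cancel₀ hzp.ne']⟩
    have hconst : ∀ s, D.y s x = D.y (Real.log ‖z - p‖) x := fun s =>
      is_const_of_deriv_eq_zero (fun t => (D.hasDerivAt_y t x).differentiableAt)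
        (fun t => (D.hasDerivAt_y t x).deriv.trans (h0 t x)) _ _
    have hlim : Tendsto (fun s => D.y s x) atBot (nhds (Real.log (φ p))) := by
      have h1 : Tendsto (fun s => p + Real.exp s • (x : EuclideanSpace ℝ (Fin n))) atBot
          (nhds p) := by
        simpa using (Real.tendsto_exp_atBot.smul_const (x : EuclideanSpace ℝ (Fin n))).const_add p
      exact (hu.continuous.tendsto p).comp h1
    have h2 := tendsto_nhds_unique (tendsto_const_nhds.congr fun s => (hconst s).symm) hlim
    have h3 : p + Real.exp (Real.log ‖z - p‖) • (x : EuclideanSpace ℝ (Fin n)) = z := by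
      simp only [x]
      rw [Real.exp_log hzp, smul_inv_smul₀ hzp.ne', add_sub_cancel]
    have h4 : Real.log (φ z) = Real.log (φ p) := by
      rw [← h2, ← h3]
      simp only [hD, CylFun.ofContDiff, h3]
    exact Real.log_injOn_pos (hφpos z) (hφpos p) h4
  · exfalso
    set γ : ℝ → EuclideanSpace ℝ (Fin n) := fun t =>
      p + Real.exp t • (x : EuclideanSpace ℝ (Fin n)) with hγ
    have hγ' : ∀ t, deriv γ t = Real.exp t • (x : EuclideanSpace ℝ (Fin n)) := fun t =>
      (((Real.hasDerivAt_exp t).smul_const _).const_add p).deriv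
    have hdiv : Tendsto (fun t => ‖γ t‖) atTop atTop := by
      refine tendsto_atTop_mono (fun t => ?_) (tendsto_atTop_add_const_right _ (-‖p‖)
        Real.tendsto_exp_atTop)
      have := norm_sub_le (γ t) p
      simp only [hγ, add_sub_cancel_left, norm_smul, norm_usphere, mul_one, Real.norm_eq_abs,
        Real.abs_exp] at this ⊢
      linarith
    refine absurd (hcomplete γ (contDiff_const.add (Real.contDiff_exp.smul contDiff_const)) hdiv)
      (ne_of_lt ?_)
    have hint : IntegrableOn (fun t => Real.exp C * Real.exp (-(1 / 4) * t)) (Ioi 0) :=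
      (exp_neg_integrableOn_Ioi 0 (by norm_num)).const_mul _
    refine lt_of_le_of_lt (setLIntegral_mono' measurableSet_Ioi fun t ht => ?_)
      hint.lintegral_lt_top
    refine ENNReal.ofReal_le_ofReal ?_
    rw [hγ', norm_smul, norm_usphere, mul_one, Real.norm_eq_abs, Real.abs_exp,
      ← Real.exp_log (hφpos (γ t)), ← Real.exp_neg, ← Real.exp_add, ← Real.exp_add]
    have : 5 / 4 * t - C ≤ Real.log (φ (γ t)) := hC t (le_of_lt ht)
    exact Real.exp_le_exp.2 (by linarith)
end

section
/- Let n ≥ 2, let k be an integer with 2 ≤ k ≤ n, and fix μ ∈ (0, 1/n). For Λ = (λ₁, …, λₙ) ∈ ℝⁿ set S_Λ = Λ − μ·(Σᵢλᵢ)·(1, 1, …, 1). If S_Λ lies in the closed cone Γ̄_k (that is, σ_j(S_Λ) ≥ 0 for all 1 ≤ j ≤ k), then minᵢ λᵢ ≥ [(μ·n·(n−1) − (n−k)) / (n·(k−1))] · Σᵢ λᵢ. -/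
/-- The `j`-th elementary symmetric polynomial of the entries of `Λ : Fin n → ℝ`. -/
noncomputable def esymm {n : ℕ} (j : ℕ) (Λ : Fin n → ℝ) : ℝ :=
  ∑ s ∈ Finset.univ.powersetCard j, ∏ i ∈ s, Λ i

open Polynomial in
/-- Rolle's theorem for elementary symmetric functions: the critical points of a real-rooted
polynomial have the same normalized elementary symmetric functions as its roots. -/
theorem exists_multiset_esymm_of_derivative {m : ℕ} (s : Multiset ℝ)
    (hs : Multiset.card s = m + 1) :
    ∃ t : Multiset ℝ, Multiset.card t = m ∧
      ∀ j ≤ m, ((m : ℝ) + 1) * t.esymm j = ((m : ℝ) + 1 - j) * s.esymm j := by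
  set P : ℝ[X] := (s.map fun r => X + C r).prod with hP
  have hProots : Multiset.card P.roots = m + 1 := by
    have h : P = ((s.map Neg.neg).map fun r => X - C r).prod := by
      simp [hP, Multiset.map_map]
    rw [h, roots_multiset_prod_X_sub_C, Multiset.card_map, hs]
  have hPcoeff : ∀ i ≤ m + 1, P.coeff i = s.esymm (m + 1 - i) := fun i hi => by
    rw [hP, Multiset.prod_X_add_C_coeff s (hs ▸ hi), hs]
  have hPdeg : P.natDegree = m + 1 := by
    rw [hP, ← hs]
    simpa [Multiset.map_map] using natDegree_multiset_prod_X_sub_C_eq_card (s.map Neg.neg)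
  have hQcoeff : ∀ i ≤ m, (derivative P).coeff i = s.esymm (m - i) * (i + 1) := fun i hi => by
    rw [coeff_derivative, hPcoeff _ (by omega), Nat.add_sub_add_right]
  have hQdeg : (derivative P).natDegree ≤ m :=
    (natDegree_derivative_le P).trans (by omega)
  have hrolle := card_roots_le_derivative P
  have hcard := card_roots' (derivative P)
  have hdeg : (derivative P).natDegree = m := by omega
  have hroots : Multiset.card (derivative P).roots = m := by omega
  have hlead : (derivative P).leadingCoeff = m + 1 := by
    rw [leadingCoeff, hdeg, hQcoeff m le_rfl]
    simp [Multiset.esymm]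
  refine ⟨(derivative P).roots.map Neg.neg, by rw [Multiset.card_map, hroots], fun j hj => ?_⟩
  have h1 := coeff_eq_esymm_roots_of_card (hroots.trans hdeg.symm)
    (hdeg.symm ▸ Nat.sub_le m j)
  rw [hdeg, hQcoeff _ (Nat.sub_le m j), Nat.sub_sub_self hj, hlead] at h1
  rw [Multiset.esymm_neg, ← mul_assoc, ← h1, Nat.cast_sub hj]
  ring

theorem Multiset.esymm_cons_succ {R : Type*} [CommSemiring R] (a : R) (s : Multiset R) (j : ℕ) :
    (a ::ₘ s).esymm (j + 1) = s.esymm (j + 1) + a * s.esymm j := by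
  simp [Multiset.esymm, Multiset.powersetCard_cons, Multiset.map_map, Multiset.sum_map_mul_left]

theorem Multiset.esymm_eq_zero_of_card_lt {R : Type*} [CommSemiring R] {s : Multiset R} {j : ℕ}
    (h : Multiset.card s < j) : s.esymm j = 0 := by
  simp [Multiset.esymm, Multiset.powersetCard_eq_empty j h]

theorem Multiset.esymm_zero' {R : Type*} [CommSemiring R] (s : Multiset R) : s.esymm 0 = 1 := by
  simp [Multiset.esymm]

theorem Multiset.esymm_nonneg {s : Multiset ℝ} (hs : ∀ a ∈ s, 0 ≤ a) (j : ℕ) :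
    0 ≤ s.esymm j := by
  refine Multiset.sum_nonneg fun x hx => ?_
  obtain ⟨t, ht, rfl⟩ := Multiset.mem_map.1 hx
  exact Multiset.prod_nonneg fun a ha =>
    hs a (Multiset.mem_of_le (Multiset.mem_powersetCard.1 ht).1 ha)

theorem nonneg_of_forall_esymm_pos {s : Multiset ℝ}
    (hs : ∀ j ≤ Multiset.card s, 0 < s.esymm j) : ∀ a ∈ s, 0 ≤ a := by
  intro a ha
  by_contra! hneg
  have h := congrArg (Polynomial.eval (-a)) (Multiset.prod_X_add_C_eq_sum_esymm s)
  rw [Polynomial.eval_multiset_prod, Multiset.map_map, Polynomial.eval_finsetSum,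
    Multiset.prod_eq_zero (Multiset.mem_map.2 ⟨a, ha, by simp⟩)] at h
  refine h.not_lt (Finset.sum_pos (fun j hj => ?_) ⟨0, by simp⟩)
  have := hs j (Nat.lt_succ_iff.1 (Finset.mem_range.1 hj))
  have ha' : 0 < -a := by linarith
  simp only [Polynomial.eval_mul, Polynomial.eval_C, Polynomial.eval_pow, Polynomial.eval_X]
  positivity

/-- The inequality between the arithmetic and the harmonic mean, with denominators cleared. -/
theorem sq_mul_esymm_card_le {m : ℕ} {s : Multiset ℝ} (hs : ∀ a ∈ s, 0 ≤ a)
    (hm : Multiset.card s = m + 1) :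
    ((m : ℝ) + 1) ^ 2 * s.esymm (m + 1) ≤ s.esymm 1 * s.esymm m := by
  induction m generalizing s with
  | zero => simp [Multiset.esymm_zero']
  | succ m ih =>
    obtain ⟨a, has⟩ := Multiset.card_pos_iff_exists_mem.1 (by omega : 0 < Multiset.card s)
    obtain ⟨t, rfl⟩ := Multiset.exists_cons_of_mem has
    have ht : Multiset.card t = m + 1 := by simpa using hm
    have hta : ∀ b ∈ t, 0 ≤ b := fun b hb => hs b (Multiset.mem_cons_of_mem hb)
    have ha : 0 ≤ a := hs a (Multiset.mem_cons_self a t)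
    have h := ih hta ht
    rw [Multiset.esymm_cons_succ, Multiset.esymm_cons_succ a t m,
      Multiset.esymm_cons_succ a t 0, Multiset.esymm_zero',
      Multiset.esymm_eq_zero_of_card_lt (s := t) (j := m + 1 + 1) (by omega)]
    have hP := Multiset.esymm_nonneg hta (m + 1)
    have hE := Multiset.esymm_nonneg hta m
    have hS := Multiset.esymm_nonneg hta 1
    simp only [zero_add]
    set P := t.esymm (m + 1)
    set E := t.esymm m
    set S := t.esymm 1
    have key : 2 * ((m : ℝ) + 1) * a * P ≤ a ^ 2 * E + S * P := by
      refine abs_le_of_sq_le_sq' ?_ (by positivity) |>.2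
      have h2 := mul_le_mul_of_nonneg_left h (mul_nonneg (sq_nonneg a) hP)
      nlinarith [sq_nonneg (a ^ 2 * E - S * P)]
    push_cast
    nlinarith [mul_le_mul_of_nonneg_left h ha]

/-- A consequence of Newton's inequalities: `p_{k+1} ≤ p₁ p_k` for the normalized elementary
symmetric functions `p_j`, when they are positive up to `j = k + 1`. -/
theorem esymm_succ_le_of_forall_pos (d k : ℕ) (s : Multiset ℝ)
    (hm : Multiset.card s = k + 1 + d) (hs : ∀ j ≤ k + 1, 0 < s.esymm j) :
    ((k : ℝ) + 1) * (k + 1 + d) * s.esymm (k + 1) ≤ (d + 1) * (s.esymm 1 * s.esymm k) := by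
  induction d generalizing s with
  | zero =>
    have h := sq_mul_esymm_card_le (nonneg_of_forall_esymm_pos (by rwa [hm])) hm
    simp only [Nat.cast_zero]
    linarith
  | succ d ih =>
    obtain ⟨t, ht, hts⟩ := exists_multiset_esymm_of_derivative s (m := k + 1 + d) (by omega)
    push_cast at hts ⊢
    have ht' : ∀ j ≤ k + 1 + d, t.esymm j =
        ((k : ℝ) + 1 + d + 1 - j) / (k + 1 + d + 1) * s.esymm j := fun j hj => by
      have := hts j hj
      field_simp
      linarith
    have hpos : ∀ j ≤ k + 1, 0 < t.esymm j := fun j hj => by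
      rw [ht' j (by omega)]
      have hj' : (j : ℝ) ≤ k + 1 := by exact_mod_cast hj
      have : (0 : ℝ) < k + 1 + d + 1 - j := by linarith [Nat.cast_nonneg (α := ℝ) d]
      have := hs j hj
      positivity
    have h := ih t ht hpos
    rw [ht' _ (by omega), ht' 1 (by omega), ht' k (by omega)] at h
    push_cast at h
    have hc : (0 : ℝ) < (d + 1) * (k + 1 + d) / (k + 1 + d + 1) ^ 2 := by positivity
    refine le_of_mul_le_mul_left ((Eq.le ?_).trans (h.trans (Eq.le ?_))) hc
    · field_simp
      ring
    · field_simp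
      ring

/-- Each entry `b` of a vector `b ::ₘ t` in the closed cone `Γ̄ₖ₊₂` of `ℝᵐ⁺¹` is bounded below by
a multiple of the sum of the entries. -/
theorem neg_mul_le_of_forall_esymm_cons_nonneg {m k : ℕ} {b : ℝ} {t : Multiset ℝ}
    (hm : Multiset.card t = m) (hk : k + 1 ≤ m)
    (h : ∀ j ≤ k + 2, 0 ≤ (b ::ₘ t).esymm j) :
    -((m : ℝ) - (k + 1)) * (b ::ₘ t).esymm 1 ≤ ((m : ℝ) + 1) * (k + 1) * b := by
  have hkm : (k : ℝ) + 1 ≤ m := by exact_mod_cast hk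
  have hsum := h 1 (by omega)
  rcases le_or_gt 0 b with hb | hb
  · have : 0 ≤ ((m : ℝ) - (k + 1)) * (b ::ₘ t).esymm 1 := mul_nonneg (by linarith) hsum
    have : 0 ≤ ((m : ℝ) + 1) * (k + 1) * b := by positivity
    linarith
  have hstep : ∀ j ≤ k + 1, -b * t.esymm j ≤ t.esymm (j + 1) := fun j hj => by
    have := h (j + 1) (by omega)
    rw [Multiset.esymm_cons_succ] at this
    linarith
  have hpos : ∀ j ≤ k + 2, 0 < t.esymm j := by
    intro j
    induction j with
    | zero => simp [Multiset.esymm_zero']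
    | succ j ih =>
      intro hj
      exact (mul_pos (by linarith) (ih (by omega))).trans_le (hstep j (by omega))
  have hkm' : k + 2 ≤ m := by
    by_contra! hlt
    exact (hpos (k + 2) le_rfl).ne' (Multiset.esymm_eq_zero_of_card_lt (by omega))
  obtain ⟨d, rfl⟩ := Nat.exists_eq_add_of_le hkm'
  have hmac := esymm_succ_le_of_forall_pos d (k + 1) t (by omega) hpos
  have hlow := mul_le_mul_of_nonneg_left (hstep (k + 1) le_rfl)
    (by positivity : (0 : ℝ) ≤ ((k + 1 : ℕ) + 1) * ((k + 1 : ℕ) + 1 + d))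
  have hb' : (((k + 1 : ℕ) : ℝ) + 1) * ((k + 1 : ℕ) + 1 + d) * -b ≤ (d + 1) * t.esymm 1 := by
    refine le_of_mul_le_mul_right ?_ (hpos (k + 1) (by omega))
    linarith
  rw [Multiset.esymm_cons_succ, Multiset.esymm_zero']
  push_cast at hb' ⊢
  linarith

theorem esymm_eq_esymm_cons {n : ℕ} (x : Fin n → ℝ) (i : Fin n) (j : ℕ) :
    esymm j x = (x i ::ₘ (Finset.univ.erase i).val.map x).esymm j := by
  rw [esymm, ← Finset.esymm_map_val, ← Multiset.map_cons, ← Finset.insert_val_of_notMem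
    (Finset.notMem_erase i _), Finset.insert_erase (Finset.mem_univ i)]

/-- The algebraic pinching lemma: if the `μ`-modified vector
`S_Λ = Λ - μ (Σ λᵢ) (1,…,1)` lies in the closed cone `Γ̄ₖ`, then each entry of `Λ`
is at least `((μ n (n-1) - (n-k)) / (n (k-1))) Σ λᵢ`. -/
theorem stmt2 {n : ℕ} (hn : 2 ≤ n) (k : ℕ) (hk1 : 2 ≤ k) (hk2 : k ≤ n)
    (μ : ℝ) (hμ0 : 0 < μ) (hμ1 : μ < 1 / n) (Λ : Fin n → ℝ)
    (hΓ : ∀ j : ℕ, 1 ≤ j → j ≤ k →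
      0 ≤ esymm j (fun i => Λ i - μ * ∑ l, Λ l)) :
    ∀ i : Fin n,
      ((μ * n * (n - 1) - (n - k)) / (n * (k - 1))) * ∑ l, Λ l ≤ Λ i := by
  intro i
  obtain ⟨k, rfl⟩ := Nat.exists_eq_add_of_le' hk1
  obtain ⟨m, rfl⟩ := Nat.exists_eq_add_of_le' (by omega : 1 ≤ n)
  set x : Fin (m + 1) → ℝ := fun i => Λ i - μ * ∑ l, Λ l with hx
  have hcone : ∀ j ≤ k + 2, 0 ≤ (x i ::ₘ (Finset.univ.erase i).val.map x).esymm j := by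
    intro j hj
    rw [← esymm_eq_esymm_cons]
    rcases Nat.eq_zero_or_pos j with rfl | hj0
    · simp [esymm]
    · exact hΓ j hj0 hj
  have hmain := neg_mul_le_of_forall_esymm_cons_nonneg (m := m) (k := k) (by simp) (by omega) hcone
  have hsum : esymm 1 x = (1 - (m + 1) * μ) * ∑ l, Λ l := by
    simp [esymm, Finset.powersetCard_one, hx, Finset.sum_sub_distrib]
    ring
  rw [← esymm_eq_esymm_cons, hsum] at hmain
  simp only [hx] at hmain
  push_cast
  rw [div_mul_eq_mul_div, div_le_iff₀
    (mul_pos (by positivity) (by linarith [Nat.cast_nonneg (α := ℝ) k]))]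
  linarith
end
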